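/- Let π ∈ ℤ[i] be a primary prime with p = π·π̄. Then the quartic Gauss sum satisfies G₄(π) = χ_π(−2)·π̃³·π̃̄, where π̃̄ denotes the complex conjugate of the canonical quartic root π̃ of −π. (This is equivalent to Matthews' formula; in particular G₄(π)² = −χ_π(−1)·π·√p and G₄(π)⁴ = π³·π̄.) -/

import Mathlib

open Complex BigOperators

noncomputable section

/-- The ring of Gaussian integers `ℤ[i]`, realized as a subring of `ℂ`. -/
def O4 : Subring ℂ := Subring.closure {Complex.I}

/-- `ζ₈ = e^{2πi/8}`, a primitive eighth root of unity. -/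
def zeta8 : ℂ := Complex.exp (2 * Real.pi * Complex.I / 8)

/-- The ring `ℤ[ζ₈]`, realized as a subring of `ℂ`. -/
def O8 : Subring ℂ := Subring.closure {zeta8}

/-- The congruence `a ≡ b (mod c)` in `ℤ[i]`. -/
def GCong (a b c : ℂ) : Prop := ∃ d ∈ O4, a - b = c * d

/-- `a` and `b` are coprime in `ℤ[i]`. -/
def GCoprime (a b : ℂ) : Prop := ∃ u ∈ O4, ∃ v ∈ O4, u * a + v * b = 1

/-- The real period `ϖ = 2∫₀¹ (1−x⁴)^{−1/2} dx`. -/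
def varpi : ℝ := 2 * ∫ x in (0:ℝ)..(1:ℝ), (1 - x ^ 4) ^ (-(1:ℝ)/2)

/-- The points of the period lattice `ϖ·ℤ[i]`. -/
def ω4 (m : ℤ × ℤ) : ℂ := (varpi : ℂ) * ((m.1 : ℂ) + (m.2 : ℂ) * Complex.I)

/-- The Weierstrass `℘`-function of the period lattice `ϖ·ℤ[i]`
(so that `℘′² = 4℘³ − 4℘`). -/
def wp4 (u : ℂ) : ℂ :=
  (u ^ 2)⁻¹ + ∑' m : ℤ × ℤ, if m = 0 then 0 else (((u - ω4 m) ^ 2)⁻¹ - ((ω4 m) ^ 2)⁻¹)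

/-- The derivative `℘′` of the Weierstrass `℘`-function of `ϖ·ℤ[i]`. -/
def wp4' (u : ℂ) : ℂ := ∑' m : ℤ × ℤ, (-2) * ((u - ω4 m) ^ 3)⁻¹

/-- The Weierstrass `ζ`-function of the period lattice `ϖ·ℤ[i]`. -/
def wzeta4 (u : ℂ) : ℂ :=
  u⁻¹ + ∑' m : ℤ × ℤ, if m = 0 then 0 else ((u - ω4 m)⁻¹ + (ω4 m)⁻¹ + u * ((ω4 m) ^ 2)⁻¹)

/-- The non-analytic doubly periodic function `Z(u) = ζ(ϖu) − (π/ϖ)·ū`. -/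
def Z4 (u : ℂ) : ℂ :=
  wzeta4 ((varpi : ℂ) * u) - ((Real.pi / varpi : ℝ) : ℂ) * (starRingEnd ℂ) u

/-- The lemniscatic sine `φ(u) = sl((1−i)ϖu) = −2(1−i)·℘(ϖu)/℘′(ϖu)`,
of period lattice `ℤ[i]`. -/
def phi4 (u : ℂ) : ℂ :=
  -2 * (1 - Complex.I) * wp4 ((varpi : ℂ) * u) / wp4' ((varpi : ℂ) * u)

/-- The lemniscatic cosine `ψ(u) = cl((1−i)ϖu) = (℘(ϖu)+i)/(℘(ϖu)−i)`,
of period lattice `ℤ[i]`. -/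
def psi4 (u : ℂ) : ℂ :=
  (wp4 ((varpi : ℂ) * u) + Complex.I) / (wp4 ((varpi : ℂ) * u) - Complex.I)

/-- A residue class character modulo `β` on `ℤ[i]`. -/
structure IsResChar4 (β : ℂ) (χ : ℂ → ℂ) : Prop where
  periodic : ∀ a ∈ O4, ∀ b ∈ O4, GCong a b β → χ a = χ b
  map_mul : ∀ a ∈ O4, ∀ b ∈ O4, χ (a * b) = χ a * χ b
  map_one : χ 1 = 1
  vanish : ∀ a ∈ O4, ¬ GCoprime a β → χ a = 0

/-- The quartic residue character `χ_π = (·/π)₄` modulo a prime `π` with `p = π·π̄`: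
`χ_π(ν)⁴ = 1` and `χ_π(ν) ≡ ν^{(p−1)/4} (mod π)`. -/
structure IsQuarticChar (π : ℂ) (p : ℕ) (χ : ℂ → ℂ) : Prop where
  resChar : IsResChar4 π χ
  quart : ∀ ν ∈ O4, GCoprime ν π → χ ν ^ 4 = 1
  euler : ∀ ν ∈ O4, GCoprime ν π → GCong (χ ν) (ν ^ ((p - 1) / 4)) π

/-- The elliptic Gauss sum `G_π(χ, f) = (1/4)·Σ_{ν ∈ (ℤ[i]/(π))^×} χ(ν)·f(ν/π)`,
computed via the integer representatives `1, …, p−1` of `(ℤ[i]/(π))^× ≅ (ℤ/p)^×`. -/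
def EGS4 (p : ℕ) (χ f : ℂ → ℂ) (π : ℂ) : ℂ :=
  (1/4 : ℂ) * ∑ r ∈ Finset.Icc 1 (p - 1), χ (r : ℂ) * f ((r : ℂ) / π)

/-- `S` is a quarter set of `(ℤ[i]/(π))^×`, i.e. `(ℤ[i]/(π))^× = S ∪ −S ∪ iS ∪ −iS`. -/
def IsQuarterSet (π : ℂ) (S : Finset ℂ) : Prop :=
  (∀ ν ∈ S, ν ∈ O4 ∧ GCoprime ν π) ∧
  (∀ a ∈ O4, GCoprime a π →
    ∃ ν ∈ S, ∃ ε ∈ ({1, -1, Complex.I, -Complex.I} : Set ℂ), GCong a (ε * ν) π) ∧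
  (∀ ν ∈ S, ∀ μ ∈ S, ∀ ε ∈ ({1, -1, Complex.I, -Complex.I} : Set ℂ),
    ∀ ε' ∈ ({1, -1, Complex.I, -Complex.I} : Set ℂ),
      GCong (ε * ν) (ε' * μ) π → ν = μ ∧ ε = ε')

/-- `γ(S)`: if `p ≡ 5 (mod 8)`, the fourth root of unity with
`γ(S) ≡ ∏_{ν∈S} ν (mod π)`; if `p ≡ 1 (mod 8)`, the fourth root of `−1` with
`γ(S) ≡ ∏_{ν∈S} ν (mod Π)` for a fixed prime `Π` of `ℤ[ζ₈]` with `π = Π·Π′`. -/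
def IsGamma4 (π : ℂ) (p : ℕ) (S : Finset ℂ) (γ : ℂ) : Prop :=
  (p % 8 = 5 → γ ^ 4 = 1 ∧ GCong γ (∏ ν ∈ S, ν) π) ∧
  (p % 8 = 1 → γ ^ 4 = -1 ∧
    ∃ P : O8, Prime P ∧ (∃ Q : O8, π = (P : ℂ) * (Q : ℂ)) ∧
      ∃ d ∈ O8, γ - ∏ ν ∈ S, ν = (P : ℂ) * d)

/-- `L` is the value at `s = 1` of the analytic continuation of the Hecke `L`-series
`L(s, χ̃) = Σ_𝔞 χ̃(𝔞)·N𝔞^{−s} = (1/4)·Σ_{ν ∈ ℤ[i]} χ₁(ν)·ν̄·|ν|^{−2s}` attached to the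
weight-one Hecke character `χ̃((ν)) = χ₁(ν)·ν̄` of `ℚ(i)`. -/
def IsLValue4 (χ₁ : ℂ → ℂ) (L : ℂ) : Prop :=
  ∃ F : ℂ → ℂ, DifferentiableOn ℂ F {s : ℂ | 0 < s.re} ∧
    (∀ s : ℂ, 3/2 < s.re →
      F s = (1/4 : ℂ) *
        ∑' ν : O4, χ₁ (ν : ℂ) * (starRingEnd ℂ) (ν : ℂ) *
          ((Complex.normSq (ν : ℂ) : ℂ) ^ (-s))) ∧
    F 1 = L

/-- `T` is a complete residue system modulo `β` in `ℤ[i]`. -/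
def IsCRS4 (β : ℂ) (T : Finset ℂ) : Prop :=
  (∀ a ∈ T, a ∈ O4) ∧ (∀ a ∈ T, ∀ b ∈ T, GCong a b β → a = b) ∧
  (∀ z ∈ O4, ∃ a ∈ T, GCong z a β)

/-- `e^{2πi·Re(z)}`. -/
def eRe4 (z : ℂ) : ℂ := Complex.exp (2 * Real.pi * Complex.I * (z.re : ℂ))

/-- `χ₀`: the character mod `(1+i)³` giving the natural isomorphism
`(ℤ[i]/(1+i)³)^× ≅ W`, i.e. `χ₀(ν) = ε` for `ν ≡ ε (mod (1+i)³)`, `ε ∈ W = {±1, ±i}`. -/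
def IsChi0₄ (χ₀ : ℂ → ℂ) : Prop :=
  IsResChar4 ((1 + Complex.I) ^ 3) χ₀ ∧
    ∀ ε ∈ ({1, -1, Complex.I, -Complex.I} : Set ℂ), χ₀ ε = ε

/-- `χ₀′`: the character mod `(1+i)² = 2i` giving `(ℤ[i]/(2))^× ≅ {±1}`, i.e.
`χ₀′(ν) = δ²` for `ν ≡ δ (mod (1+i)²)`, `δ ∈ {1, i}`. -/
def IsChi0'₄ (χ₀' : ℂ → ℂ) : Prop :=
  IsResChar4 2 χ₀' ∧ χ₀' Complex.I = -1

/-- The classical quartic Gauss sum `G₄(π) = Σ_{r=1}^{p−1} (r/π)₄·e^{2πir/p}`. -/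
def G4sum (p : ℕ) (χ : ℂ → ℂ) : ℂ :=
  ∑ r ∈ Finset.Icc 1 (p - 1), χ (r : ℂ) * Complex.exp (2 * Real.pi * Complex.I * (r : ℂ) / (p : ℂ))

namespace QGS

section

open Filter Topology

/-- `f` is holomorphic on a punctured neighbourhood of `c` and has a removable singularity there. -/
def Removable (f : ℂ → ℂ) (c : ℂ) : Prop :=
  (∀ᶠ z in 𝓝[≠] c, DifferentiableAt ℂ f z) ∧ Tendsto (fun z => (z - c) * f z) (𝓝[≠] c) (𝓝 0)

lemma Removable.of_differentiableAt {f : ℂ → ℂ} {c : ℂ}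
    (h : ∀ᶠ z in 𝓝 c, DifferentiableAt ℂ f z) : Removable f c := by
  refine ⟨h.filter_mono nhdsWithin_le_nhds, ?_⟩
  have h1 : ContinuousAt (fun z => (z - c) * f z) c :=
    (continuousAt_id.sub continuousAt_const).mul h.self_of_nhds.continuousAt
  have := h1.tendsto.mono_left (nhdsWithin_le_nhds (s := {c}ᶜ))
  simpa using this

lemma Removable.exists_tendsto {f : ℂ → ℂ} {c : ℂ} (h : Removable f c) :
    ∃ g : ℂ → ℂ, DifferentiableAt ℂ g c ∧ f =ᶠ[𝓝[≠] c] g := by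
  obtain ⟨h1, h2⟩ := h
  rw [eventually_nhdsWithin_iff] at h1
  obtain ⟨s, hs, hs2⟩ := Filter.eventually_iff_exists_mem.1 h1
  refine ⟨Function.update f c (limUnder (𝓝[≠] c) f), ?_, ?_⟩
  · have := Complex.differentiableOn_update_limUnder_of_isLittleO (f := f) (s := s) (c := c) hs
      (fun z hz => (hs2 z hz.1 hz.2).differentiableWithinAt) ?_
    · exact this.differentiableAt hs
    · rw [Asymptotics.isLittleO_iff_tendsto']
      · have h3 : Tendsto (fun z => (z - c) * f z - (z - c) * f c) (𝓝[≠] c) (𝓝 (0 - (c - c) * f c)) :=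
          h2.sub ((((continuous_id.sub continuous_const).mul continuous_const).continuousAt
            (x := c)).tendsto.mono_left nhdsWithin_le_nhds)
        simp only [sub_self, zero_mul] at h3
        refine h3.congr fun z => ?_
        rw [div_inv_eq_mul]; ring
      · filter_upwards [self_mem_nhdsWithin] with z hz h0
        exact absurd (inv_eq_zero.1 h0) (sub_ne_zero.2 hz)
  · filter_upwards [self_mem_nhdsWithin] with z hz
    rw [Function.update_of_ne hz]

lemma tendsto_add_punctured (c w : ℂ) : Tendsto (fun z => z + w) (𝓝[≠] c) (𝓝[≠] (c + w)) := by
  refine tendsto_nhdsWithin_iff.2 ⟨?_, ?_⟩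
  · exact ((continuous_id.add continuous_const).tendsto c).mono_left nhdsWithin_le_nhds
  · filter_upwards [self_mem_nhdsWithin] with z hz h
    exact hz (add_right_cancel h)

lemma tendsto_mul_punctured (c a : ℂ) (ha : a ≠ 0) :
    Tendsto (fun z => a * z) (𝓝[≠] c) (𝓝[≠] (a * c)) := by
  refine tendsto_nhdsWithin_iff.2 ⟨?_, ?_⟩
  · exact ((continuous_const.mul continuous_id).tendsto c).mono_left nhdsWithin_le_nhds
  · filter_upwards [self_mem_nhdsWithin] with z hz h
    exact hz (mul_left_cancel₀ ha h)

lemma Removable.shift {f : ℂ → ℂ} {c w μ : ℂ} (hf : ∀ v, f (v + w) = μ * f v)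
    (h : Removable f c) : Removable f (c - w) := by
  by_cases hμ : μ = 0
  · have h0 : ∀ v, f v = 0 := fun v => by
      have := hf (v - w); rw [hμ] at this; simpa using this
    have : f = fun _ => 0 := funext h0
    subst this
    exact Removable.of_differentiableAt (by simp)
  obtain ⟨h1, h2⟩ := h
  have ht : Tendsto (fun z => z + w) (𝓝[≠] (c - w)) (𝓝[≠] c) := by
    simpa using tendsto_add_punctured (c - w) w
  have hf' : ∀ v, f v = μ⁻¹ * f (v + w) := fun v => by rw [hf]; field_simp
  refine ⟨?_, ?_⟩
  · filter_upwards [ht.eventually h1] with z hz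
    have : f = fun v => μ⁻¹ * f (v + w) := funext hf'
    rw [this]
    exact (DifferentiableAt.comp z hz (by fun_prop)).const_mul _
  · have := (h2.comp ht).const_mul μ⁻¹
    rw [mul_zero] at this
    refine this.congr fun z => ?_
    simp only [Function.comp]
    rw [hf' z]; ring

lemma norm_zmultiples {g : ℂ → ℂ} {w : ℂ} (h : ∀ v, ‖g (v + w)‖ = ‖g v‖) (n : ℤ) (v : ℂ) :
    ‖g (v + n * w)‖ = ‖g v‖ := by
  induction n using Int.induction_on with
  | zero => simp
  | succ k ih =>
    rw [← ih, ← h (v + (k : ℤ) * w)]; congr 2; push_cast; ring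
  | pred k ih =>
    rw [← ih, ← h (v + (-(k : ℤ) - 1 : ℤ) * w)]; congr 2; push_cast; ring

lemma exists_const_of_removable {f : ℂ → ℂ} {μ ν : ℂ} (hf : ∀ c, Removable f c)
    (h1 : ∀ v, f (v + 1) = μ * f v) (hI : ∀ v, f (v + I) = ν * f v)
    (hμ : ‖μ‖ = 1) (hν : ‖ν‖ = 1) :
    ∃ C, (∀ v, ContinuousAt f v → f v = C) ∧ (μ ≠ 1 ∨ ν ≠ 1 → C = 0) := by
  choose G hG hfG using fun c => (hf c).exists_tendsto
  set g : ℂ → ℂ := fun c => G c c with hg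
  have hlim : ∀ c, Tendsto f (𝓝[≠] c) (𝓝 (g c)) := fun c =>
    (((hG c).continuousAt.tendsto).mono_left nhdsWithin_le_nhds).congr' (hfG c).symm
  have hcont : ∀ v, ContinuousAt f v → f v = g v := fun v hv =>
    tendsto_nhds_unique (hv.tendsto.mono_left nhdsWithin_le_nhds) (hlim v)
  have hgG : ∀ c, g =ᶠ[𝓝 c] G c := by
    intro c
    have h2 : ∀ᶠ z in 𝓝[≠] c, g z = G c z := by
      filter_upwards [(hf c).1, hfG c] with z hz hz2
      rw [← hcont z hz.continuousAt, hz2]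
    rw [eventually_nhdsWithin_iff] at h2
    filter_upwards [h2] with z hz
    by_cases hzc : z = c
    · subst hzc; rfl
    · exact hz hzc
  have hgd : Differentiable ℂ g := fun c => (hG c).congr_of_eventuallyEq (hgG c)
  have hshift : ∀ (w m : ℂ), (∀ v, f (v + w) = m * f v) → ∀ v, g (v + w) = m * g v := by
    intro w m h v
    have a1 := (hlim (v + w)).comp (tendsto_add_punctured v w)
    have a2 := (hlim v).const_mul m
    exact tendsto_nhds_unique a1 (a2.congr fun z => (h z).symm)
  have g1 := hshift _ _ h1
  have gI := hshift _ _ hI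
  have n1 : ∀ v, ‖g (v + 1)‖ = ‖g v‖ := fun v => by rw [g1, norm_mul, hμ, one_mul]
  have nI : ∀ v, ‖g (v + I)‖ = ‖g v‖ := fun v => by rw [gI, norm_mul, hν, one_mul]
  obtain ⟨B, hB⟩ := (isCompact_closedBall (0 : ℂ) 2).exists_bound_of_continuousOn
    hgd.continuous.continuousOn
  have hbd : Bornology.IsBounded (Set.range g) := by
    refine (Metric.isBounded_closedBall (x := (0 : ℂ)) (r := B)).subset ?_
    rintro _ ⟨v, rfl⟩
    rw [mem_closedBall_zero_iff]
    have e1 := norm_zmultiples n1 (-⌊v.re⌋) v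
    have e2 := norm_zmultiples nI (-⌊v.im⌋) (v + (-⌊v.re⌋ : ℤ) * 1)
    rw [← e1, ← e2]
    refine hB _ ?_
    rw [mem_closedBall_zero_iff]
    refine (Complex.norm_le_abs_re_add_abs_im _).trans ?_
    have r1 : (v + (-⌊v.re⌋ : ℤ) * 1 + (-⌊v.im⌋ : ℤ) * I).re = Int.fract v.re := by
      rw [← Int.self_sub_floor, sub_eq_add_neg]; simp
    have r2 : (v + (-⌊v.re⌋ : ℤ) * 1 + (-⌊v.im⌋ : ℤ) * I).im = Int.fract v.im := by
      rw [← Int.self_sub_floor, sub_eq_add_neg]; simp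
    rw [r1, r2, abs_of_nonneg (Int.fract_nonneg _), abs_of_nonneg (Int.fract_nonneg _)]
    have := Int.fract_lt_one v.re
    have := Int.fract_lt_one v.im
    linarith
  have hconst := hgd.apply_eq_apply_of_bounded hbd
  refine ⟨g 0, fun v hv => (hcont v hv).trans (hconst v 0), ?_⟩
  rintro (h | h)
  · have := g1 0
    rw [hconst (0 + 1) 0] at this
    by_contra h0
    exact h (mul_right_cancel₀ h0 (by rw [← this, one_mul]))
  · have := gI 0
    rw [hconst (0 + I) 0] at this
    by_contra h0
    exact h (mul_right_cancel₀ h0 (by rw [← this, one_mul]))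

end

section

open Filter Topology

lemma exists_eq_mul_of_analyticAt {h : ℂ → ℂ} (hh : AnalyticAt ℂ h 0) (h0 : h 0 = 0) :
    ∃ k, AnalyticAt ℂ k 0 ∧ (∀ z, h z = z * k z) ∧ k 0 = deriv h 0 := by
  refine ⟨dslope h 0, ?_, fun z => ?_, dslope_same _ _⟩
  · obtain ⟨p, hp⟩ := hh
    exact ⟨_, hp.has_fpower_series_dslope_fslope⟩
  · have := sub_smul_dslope h 0 z
    simpa [h0] using this.symm

/-- The building block `2πi e^{2πiβv}/(e^{2πiv} - 1)`. -/
def gK (β : ℝ) (v : ℂ) : ℂ :=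
  2 * Real.pi * I * exp (2 * Real.pi * I * β * v) / (exp (2 * Real.pi * I * v) - 1)

/-- The Kronecker-type function with multipliers `e^{2πiβ}` and `e^{2πiα}` along `1` and `i`. -/
def KF (α β : ℝ) (v : ℂ) : ℂ := ∑' n : ℤ, exp (-(2 * Real.pi * I * α * n)) * gK β (v + n * I)

lemma exp_two_pi_I_add_one (v : ℂ) :
    exp (2 * Real.pi * I * (v + 1)) = exp (2 * Real.pi * I * v) := by
  rw [mul_add, exp_add, mul_one, exp_two_pi_mul_I, mul_one]

lemma gK_add_one (β : ℝ) (v : ℂ) : gK β (v + 1) = exp (2 * Real.pi * I * β) * gK β v := by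
  unfold gK
  rw [exp_two_pi_I_add_one, mul_add (2 * Real.pi * I * β : ℂ), mul_one, exp_add]
  ring

lemma KF_add_one (α β : ℝ) (v : ℂ) :
    KF α β (v + 1) = exp (2 * Real.pi * I * β) * KF α β v := by
  unfold KF
  rw [← tsum_mul_left]
  refine tsum_congr fun n => ?_
  rw [add_right_comm, gK_add_one]; ring

lemma KF_add_I (α β : ℝ) (v : ℂ) :
    KF α β (v + I) = exp (2 * Real.pi * I * α) * KF α β v := by
  unfold KF
  rw [← tsum_mul_left, ← (Equiv.addRight (1 : ℤ)).tsum_eq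
    (fun n : ℤ => exp (2 * Real.pi * I * α) *
      (exp (-(2 * Real.pi * I * α * n)) * gK β (v + n * I)))]
  refine tsum_congr fun n => ?_
  simp only [Equiv.coe_addRight]
  rw [← mul_assoc, ← exp_add]
  congr 2
  · push_cast; ring
  · push_cast; ring

lemma exp_two_pi_I_eq_one {v : ℂ} (h : exp (2 * Real.pi * I * v) = 1) : ∃ m : ℤ, v = m := by
  obtain ⟨n, hn⟩ := Complex.exp_eq_one_iff.1 h
  refine ⟨n, ?_⟩
  have h2 : (2 * Real.pi * I : ℂ) ≠ 0 := two_pi_I_ne_zero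
  apply mul_left_cancel₀ h2
  rw [hn]; ring

lemma differentiableAt_gK (β : ℝ) {v : ℂ} (h : exp (2 * Real.pi * I * v) ≠ 1) :
    DifferentiableAt ℂ (gK β) v := by
  unfold gK
  exact DifferentiableAt.div (by fun_prop) (by fun_prop) (sub_ne_zero.2 h)

lemma norm_exp_two_pi_I (β : ℝ) (v : ℂ) :
    ‖exp (2 * Real.pi * I * β * v)‖ = Real.exp (-(2 * Real.pi * β * v.im)) := by
  rw [Complex.norm_exp]; congr 1; simp

lemma norm_exp_two_pi_I' (v : ℂ) :
    ‖exp (2 * Real.pi * I * v)‖ = Real.exp (-(2 * Real.pi * v.im)) := by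
  rw [Complex.norm_exp]; congr 1; simp

lemma norm_gK_le {β : ℝ} {δ : ℝ} (hδ : δ ≤ β) (hδ' : δ ≤ 1 - β) {v : ℂ}
    (hv : 1 / 4 ≤ |v.im|) :
    ‖gK β v‖ ≤ 2 * Real.pi / (1 - Real.exp (-(Real.pi / 2))) *
      Real.exp (-(2 * Real.pi * δ * |v.im|)) := by
  have hpi := Real.pi_pos
  have hD : 0 < 1 - Real.exp (-(Real.pi / 2)) := by
    rw [sub_pos]; exact Real.exp_lt_one_iff.2 (by linarith)
  have hn : ‖gK β v‖ = 2 * Real.pi * Real.exp (-(2 * Real.pi * β * v.im)) /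
      ‖exp (2 * Real.pi * I * v) - 1‖ := by
    unfold gK
    rw [norm_div, norm_mul, norm_exp_two_pi_I]
    congr 2
    simp [abs_of_pos hpi]
  have key : ∀ E : ℝ, 0 < E → (1 - Real.exp (-(Real.pi / 2))) * E ≤
      ‖exp (2 * Real.pi * I * v) - 1‖ →
      Real.exp (-(2 * Real.pi * β * v.im)) ≤ E * Real.exp (-(2 * Real.pi * δ * |v.im|)) →
      ‖gK β v‖ ≤ 2 * Real.pi / (1 - Real.exp (-(Real.pi / 2))) *
      Real.exp (-(2 * Real.pi * δ * |v.im|)) := by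
    intro E hE h1 h2
    have h3 : 0 < ‖exp (2 * Real.pi * I * v) - 1‖ := lt_of_lt_of_le (by positivity) h1
    rw [hn, div_le_iff₀ h3, div_mul_eq_mul_div, div_mul_eq_mul_div, le_div_iff₀ hD]
    calc _ ≤ 2 * Real.pi * (E * Real.exp (-(2 * Real.pi * δ * |v.im|))) *
          (1 - Real.exp (-(Real.pi / 2))) := by gcongr
      _ = 2 * Real.pi * Real.exp (-(2 * Real.pi * δ * |v.im|)) *
          ((1 - Real.exp (-(Real.pi / 2))) * E) := by ring
      _ ≤ _ := by gcongr
  rcases le_abs'.1 hv with h | h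
  · have habs : |v.im| = -v.im := abs_of_neg (by linarith)
    refine key (Real.exp (-(2 * Real.pi * v.im))) (Real.exp_pos _) ?_ ?_
    · have := norm_sub_norm_le (exp (2 * Real.pi * I * v)) 1
      rw [norm_exp_two_pi_I', norm_one] at this
      refine le_trans ?_ this
      rw [sub_mul, one_mul]
      have : 1 ≤ Real.exp (-(Real.pi / 2)) * Real.exp (-(2 * Real.pi * v.im)) := by
        rw [← Real.exp_add]; exact Real.one_le_exp (by nlinarith)
      linarith
    · rw [← Real.exp_add, habs]
      apply Real.exp_le_exp.2
      nlinarith [mul_nonneg hpi.le (mul_nonneg (sub_nonneg.2 hδ') (by linarith : 0 ≤ -v.im))]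
  · have habs : |v.im| = v.im := abs_of_pos (by linarith)
    refine key 1 one_pos ?_ ?_
    · have := norm_sub_norm_le (1 : ℂ) (exp (2 * Real.pi * I * v))
      rw [norm_exp_two_pi_I', norm_one, norm_sub_rev] at this
      refine le_trans ?_ this
      have : Real.exp (-(2 * Real.pi * v.im)) ≤ Real.exp (-(Real.pi / 2)) :=
        Real.exp_le_exp.2 (by nlinarith)
      linarith
    · rw [one_mul, habs]
      apply Real.exp_le_exp.2
      nlinarith [mul_nonneg hpi.le (mul_nonneg (sub_nonneg.2 hδ) (by linarith : 0 ≤ v.im))]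

lemma summable_exp_neg_abs {c : ℝ} (hc : 0 < c) :
    Summable fun n : ℤ => Real.exp (-(c * |(n : ℝ)|)) := by
  have h : Summable fun n : ℕ => Real.exp (-(c * |((n : ℤ) : ℝ)|)) := by
    have := Real.summable_exp_nat_mul_iff.2 (show -c < 0 by linarith)
    refine this.congr fun n => ?_
    simp; ring
  exact Summable.of_nat_of_neg h (h.congr fun n => by simp)

lemma exists_KF_eq {α β : ℝ} (h0 : 0 < β) (h1 : β < 1) :
    ∃ R : ℂ → ℂ, DifferentiableOn ℂ R {v | |v.im| < 3 / 4} ∧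
      (∀ v ∈ {v : ℂ | |v.im| < 3 / 4}, KF α β v = gK β v + R v) ∧
      (∀ v ∈ {v : ℂ | |v.im| < 3 / 4},
        Summable fun n : ℤ => exp (-(2 * Real.pi * I * α * n)) * gK β (v + n * I)) := by
  obtain ⟨δ, hδ0, hδ, hδ'⟩ : ∃ δ : ℝ, 0 < δ ∧ δ ≤ β ∧ δ ≤ 1 - β :=
    ⟨min β (1 - β), lt_min h0 (by linarith), min_le_left _ _, min_le_right _ _⟩
  have hpi := Real.pi_pos
  set D := 2 * Real.pi / (1 - Real.exp (-(Real.pi / 2)))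
  have hD0 : 0 ≤ D := by
    refine div_nonneg (by positivity) ?_
    rw [sub_nonneg]; exact Real.exp_le_one_iff.2 (by linarith)
  have hU : IsOpen {v : ℂ | |v.im| < 3 / 4} :=
    isOpen_lt (continuous_abs.comp Complex.continuous_im) continuous_const
  set F : ℤ → ℂ → ℂ := fun n v => exp (-(2 * Real.pi * I * α * n)) * gK β (v + n * I) with hF
  set u : ℤ → ℝ := fun n => D * Real.exp (2 * Real.pi * δ) *
    Real.exp (-(2 * Real.pi * δ * |(n : ℝ)|))
  have hu : Summable u := (summable_exp_neg_abs (by positivity)).mul_left _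
  have him : ∀ n : ℤ, n ≠ 0 → ∀ v : ℂ, |v.im| < 3 / 4 →
      1 / 4 ≤ |(v + n * I).im| ∧ |(n : ℝ)| - 1 ≤ |(v + n * I).im| := by
    intro n hn v hv
    have e : (v + n * I).im = v.im + n := by simp
    have h2 : (1 : ℝ) ≤ |(n : ℝ)| := by exact_mod_cast Int.one_le_abs hn
    have h3 : |(n : ℝ)| ≤ |v.im + n| + |v.im| := by
      have := abs_sub (v.im + n) v.im
      simpa using this
    rw [e]
    constructor <;> linarith
  have hb : ∀ n : ℤ, n ≠ 0 → ∀ v ∈ {v : ℂ | |v.im| < 3 / 4}, ‖F n v‖ ≤ u n := by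
    intro n hn v hv
    obtain ⟨i1, i2⟩ := him n hn v hv
    have e1 : ‖exp (-(2 * Real.pi * I * α * n))‖ = 1 := by
      rw [Complex.norm_exp]; simp
    rw [hF]; simp only
    rw [norm_mul, e1, one_mul]
    refine (norm_gK_le hδ hδ' i1).trans ?_
    simp only [u, D]
    rw [mul_assoc (2 * Real.pi / _), ← Real.exp_add]
    refine mul_le_mul_of_nonneg_left (Real.exp_le_exp.2 ?_) hD0
    nlinarith [mul_nonneg (mul_nonneg hpi.le hδ0.le) (sub_nonneg.2 i2)]
  refine ⟨fun v => ∑' n : ℤ, if n = 0 then 0 else F n v, ?_, ?_, ?_⟩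
  · refine differentiableOn_tsum_of_summable_norm hu ?_ hU ?_
    · intro n
      by_cases hn : n = 0
      · simp [hn]
      · simp only [hn, if_false]
        intro v hv
        refine DifferentiableAt.differentiableWithinAt ?_
        refine DifferentiableAt.const_mul ?_ _
        refine DifferentiableAt.comp (f := fun v : ℂ => v + n * I) v
          (differentiableAt_gK β ?_) (by fun_prop)
        intro h
        obtain ⟨m, hm⟩ := exp_two_pi_I_eq_one h
        obtain ⟨i1, -⟩ := him n hn v hv
        rw [hm] at i1
        norm_num at i1
    · intro n v hv
      by_cases hn : n = 0
      · simp only [hn, if_true, norm_zero]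
        positivity
      · simp only [hn, if_false]
        exact hb n hn v hv
  all_goals
    intro v hv
    have hs : Summable fun n => F n v := by
      refine Summable.of_norm_bounded_eventually hu ?_
      refine (Set.finite_singleton (0 : ℤ)).subset ?_
      intro n hn
      by_contra h
      exact hn (hb n h v hv)
  · unfold KF
    rw [hs.tsum_eq_add_tsum_ite 0]
    simp [hF]
  · exact hs

lemma exists_gK_eq (β : ℝ) :
    ∃ h : ℂ → ℂ, AnalyticAt ℂ h 0 ∧ ∀ᶠ v in 𝓝[≠] 0, gK β v = v⁻¹ + h v := by
  obtain ⟨k, hk, hk2, hk3⟩ := exists_eq_mul_of_analyticAt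
    (h := fun v => exp (2 * Real.pi * I * v) - 1) (by fun_prop) (by simp)
  have hd : deriv (fun v => exp (2 * Real.pi * I * v) - 1) 0 = 2 * Real.pi * I := by
    have : HasDerivAt (fun v => exp (2 * Real.pi * I * v) - 1)
        (exp (2 * Real.pi * I * 0) * (2 * Real.pi * I * 1)) 0 :=
      (((hasDerivAt_id (0 : ℂ)).const_mul (2 * Real.pi * I : ℂ)).cexp).sub_const 1
    simpa using this.deriv
  rw [hd] at hk3
  have hk0 : k 0 ≠ 0 := by rw [hk3]; exact two_pi_I_ne_zero
  obtain ⟨l, hl, hl2, -⟩ := exists_eq_mul_of_analyticAt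
    (h := fun v => 2 * Real.pi * I * exp (2 * Real.pi * I * β * v) - k v)
    (by fun_prop) (by simp [hk3])
  refine ⟨fun v => l v / k v, hl.div hk hk0, ?_⟩
  have h1 : ∀ᶠ v in 𝓝[≠] 0, k v ≠ 0 :=
    (hk.continuousAt.eventually_ne hk0).filter_mono nhdsWithin_le_nhds
  filter_upwards [h1, self_mem_nhdsWithin] with v hv hv0
  have hv0 : v ≠ 0 := hv0
  have e1 := hk2 v
  have e2 := hl2 v
  unfold gK
  rw [e1, show 2 * Real.pi * I * exp (2 * Real.pi * I * β * v) = k v + v * l v by rw [← e2]; ring]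
  field_simp

lemma exists_KF_eq_inv_add {α β : ℝ} (h0 : 0 < β) (h1 : β < 1) :
    ∃ h : ℂ → ℂ, AnalyticAt ℂ h 0 ∧ ∀ᶠ v in 𝓝[≠] 0, KF α β v = v⁻¹ + h v := by
  obtain ⟨R, hR, hK, -⟩ := exists_KF_eq (α := α) h0 h1
  obtain ⟨h, hh, he⟩ := exists_gK_eq β
  have hU : {v : ℂ | |v.im| < 3 / 4} ∈ 𝓝 (0 : ℂ) :=
    (isOpen_lt (continuous_abs.comp Complex.continuous_im) continuous_const).mem_nhds (by simp)
  refine ⟨fun v => h v + R v, hh.add (hR.analyticAt hU), ?_⟩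
  filter_upwards [he, nhdsWithin_le_nhds hU] with v hv hvU
  rw [hK v hvU, hv]; ring

/-- The lattice `ℤ[i]`. -/
def Lat : Set ℂ := {v | ∃ m n : ℤ, v = m + n * I}

lemma quasi_zmultiples {f : ℂ → ℂ} {w μ : ℂ} (hμ : μ ≠ 0) (h : ∀ v, f (v + w) = μ * f v) (n : ℤ)
    (v : ℂ) : f (v + n * w) = μ ^ n * f v := by
  induction n using Int.induction_on with
  | zero => simp
  | succ k ih =>
    rw [zpow_add_one₀ hμ, mul_right_comm, ← ih, mul_comm _ μ, ← h (v + (k : ℤ) * w)]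
    congr 1; push_cast; ring
  | pred k ih =>
    have := h (v + (-(k : ℤ) - 1 : ℤ) * w)
    rw [show v + (-(k : ℤ) - 1 : ℤ) * w + w = v + (-(k : ℤ) : ℤ) * w by push_cast; ring] at this
    rw [zpow_sub_one₀ hμ, mul_right_comm, ← ih, this]
    field_simp

lemma differentiableAt_shift {f : ℂ → ℂ} {w μ c : ℂ} (hμ : μ ≠ 0)
    (h : ∀ v, f (v + w) = μ * f v) (hd : DifferentiableAt ℂ f (c + w)) :
    DifferentiableAt ℂ f c := by
  have : f = fun v => μ⁻¹ * f (v + w) := funext fun v => by rw [h]; field_simp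
  rw [this]
  exact (DifferentiableAt.comp (f := fun v : ℂ => v + w) c hd (by fun_prop)).const_mul _

lemma differentiableAt_KF {α β : ℝ} (h0 : 0 < β) (h1 : β < 1) {v : ℂ} (hv : v ∉ Lat) :
    DifferentiableAt ℂ (KF α β) v := by
  obtain ⟨R, hR, hK, -⟩ := exists_KF_eq (α := α) h0 h1
  have hU : IsOpen {v : ℂ | |v.im| < 3 / 4} :=
    isOpen_lt (continuous_abs.comp Complex.continuous_im) continuous_const
  refine differentiableAt_shift (w := (-round v.im : ℤ) * I)
    (zpow_ne_zero (-round v.im) (exp_ne_zero (2 * Real.pi * I * α)))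
    (quasi_zmultiples (exp_ne_zero _) (KF_add_I α β) _) ?_
  set v' := v + (-round v.im : ℤ) * I with hv'
  have hm : v' ∈ {v : ℂ | |v.im| < 3 / 4} := by
    have : v'.im = v.im - round v.im := by simp [hv', sub_eq_add_neg]
    change |v'.im| < 3 / 4
    rw [this]
    exact (abs_sub_round _).trans_lt (by norm_num)
  have hd : DifferentiableAt ℂ (fun v => gK β v + R v) v' := by
    refine (differentiableAt_gK β fun h => hv ?_).add (hR.differentiableAt (hU.mem_nhds hm))
    obtain ⟨m, hm⟩ := exp_two_pi_I_eq_one h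
    refine ⟨m, round v.im, ?_⟩
    rw [← hm, hv']; push_cast; ring
  refine hd.congr_of_eventuallyEq ?_
  filter_upwards [hU.mem_nhds hm] with z hz using hK z hz

end

section

open Filter Topology

lemma lat_sep {z w : ℂ} (hz : z ∈ Lat) (hw : w ∈ Lat) (h : ‖z - w‖ < 1) : z = w := by
  obtain ⟨m, n, rfl⟩ := hz
  obtain ⟨m', n', rfl⟩ := hw
  have h1 := (Complex.abs_re_le_norm _).trans_lt h
  have h2 := (Complex.abs_im_le_norm _).trans_lt h
  simp only [sub_re, add_re, intCast_re, mul_re, I_re, mul_zero, intCast_im, I_im, mul_one,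
    sub_self, add_zero, sub_im, add_im, mul_im, zero_add] at h1 h2
  have e1 : m = m' := by
    have : |m - m'| < 1 := by exact_mod_cast h1
    linarith [Int.abs_lt_one_iff.1 this]
  have e2 : n = n' := by
    have : |n - n'| < 1 := by exact_mod_cast h2
    linarith [Int.abs_lt_one_iff.1 this]
  rw [e1, e2]

lemma eventually_notMem_Lat (c : ℂ) : ∀ᶠ z in 𝓝[≠] c, z ∉ Lat := by
  by_cases h : ∃ w ∈ Lat, w ∈ Metric.ball c (1 / 2)
  · obtain ⟨w, hw, hwc⟩ := h
    have hball : ∀ᶠ z in 𝓝[≠] c, z ∈ Metric.ball c (1 / 2) :=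
      nhdsWithin_le_nhds (Metric.ball_mem_nhds c (by norm_num))
    have hne : ∀ᶠ z in 𝓝[≠] c, z ≠ w := by
      by_cases hcw : c = w
      · subst hcw; exact self_mem_nhdsWithin
      · exact nhdsWithin_le_nhds (isOpen_ne.mem_nhds hcw)
    filter_upwards [hball, hne] with z hz hzw hzL
    refine hzw (lat_sep hzL hw ?_)
    rw [← dist_eq_norm]
    have h1 : dist z c < 1 / 2 := hz
    have h2 : dist w c < 1 / 2 := hwc
    linarith [dist_triangle_right z w c]
  · push Not at h
    have hball : ∀ᶠ z in 𝓝[≠] c, z ∈ Metric.ball c (1 / 2) :=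
      nhdsWithin_le_nhds (Metric.ball_mem_nhds c (by norm_num))
    filter_upwards [hball] with z hz hzL using h z hzL hz

lemma eventually_notMem_Lat' {c : ℂ} (hc : c ∉ Lat) : ∀ᶠ z in 𝓝 c, z ∉ Lat := by
  have := eventually_notMem_Lat c
  rw [eventually_nhdsWithin_iff] at this
  filter_upwards [this] with z hz
  by_cases h : z = c
  · rwa [h]
  · exact hz h

lemma I_mem_Lat : I ∈ Lat := ⟨0, 1, by simp⟩

lemma one_mem_Lat : (1 : ℂ) ∈ Lat := ⟨1, 0, by simp⟩

lemma add_mem_Lat {z w : ℂ} (hz : z ∈ Lat) (hw : w ∈ Lat) : z + w ∈ Lat := by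
  obtain ⟨m, n, rfl⟩ := hz
  obtain ⟨m', n', rfl⟩ := hw
  exact ⟨m + m', n + n', by push_cast; ring⟩

lemma neg_mem_Lat {z : ℂ} (hz : z ∈ Lat) : -z ∈ Lat := by
  obtain ⟨m, n, rfl⟩ := hz
  exact ⟨-m, -n, by push_cast; ring⟩

lemma sub_mem_Lat {z w : ℂ} (hz : z ∈ Lat) (hw : w ∈ Lat) : z - w ∈ Lat := by
  rw [sub_eq_add_neg]; exact add_mem_Lat hz (neg_mem_Lat hw)

lemma mul_mem_Lat {z w : ℂ} (hz : z ∈ Lat) (hw : w ∈ Lat) : z * w ∈ Lat := by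
  obtain ⟨m, n, rfl⟩ := hz
  obtain ⟨m', n', rfl⟩ := hw
  refine ⟨m * m' - n * n', m * n' + n * m', ?_⟩
  push_cast; linear_combination (n * n' : ℂ) * I_sq

lemma removable_of_lat {f : ℂ → ℂ} {μ ν : ℂ} (hd : ∀ v ∉ Lat, DifferentiableAt ℂ f v)
    (h0 : Tendsto (fun z => z * f z) (𝓝[≠] 0) (𝓝 0))
    (h1 : ∀ v, f (v + 1) = μ * f v) (hI : ∀ v, f (v + I) = ν * f v)
    (hμ : μ ≠ 0) (hν : ν ≠ 0) (c : ℂ) : Removable f c := by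
  by_cases hc : c ∈ Lat
  · have hR : Removable f 0 :=
      ⟨(eventually_notMem_Lat 0).mono hd, by simpa using h0⟩
    obtain ⟨m, n, rfl⟩ := hc
    have a1 := Removable.shift (quasi_zmultiples hμ h1 (-m)) hR
    have a2 := Removable.shift (quasi_zmultiples hν hI (-n)) a1
    convert a2 using 1
    push_cast; ring
  · exact Removable.of_differentiableAt ((eventually_notMem_Lat' hc).mono hd)

/-- The function `Σ (-1)ⁿ π / sin (π (v + n i))`. -/
def EF : ℂ → ℂ := KF (1 / 2) (1 / 2)

lemma EF_add_one (v : ℂ) : EF (v + 1) = (-1) * EF v := by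
  unfold EF
  rw [KF_add_one]
  congr 1
  rw [← exp_pi_mul_I]; congr 1; push_cast; ring

lemma EF_add_I (v : ℂ) : EF (v + I) = (-1) * EF v := by
  unfold EF
  rw [KF_add_I]
  congr 1
  rw [← exp_pi_mul_I]; congr 1; push_cast; ring

lemma EF_add_lat (v : ℂ) (m n : ℤ) : EF (v + (m + n * I)) = (-1) ^ (m + n) * EF v := by
  have h1 := quasi_zmultiples (by norm_num) EF_add_one m v
  have h2 := quasi_zmultiples (by norm_num) EF_add_I n (v + m * 1)
  rw [h1] at h2
  rw [zpow_add₀ (by norm_num), mul_comm ((-1 : ℂ) ^ m), mul_assoc, ← h2]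
  congr 1; ring

lemma differentiableAt_EF {v : ℂ} (hv : v ∉ Lat) : DifferentiableAt ℂ EF v :=
  differentiableAt_KF (by norm_num) (by norm_num) hv

lemma gK_half_neg (v : ℂ) : gK (1 / 2) (-v) = -gK (1 / 2) v := by
  unfold gK
  have e : exp (2 * Real.pi * I * v) = exp (Real.pi * I * v) ^ 2 := by
    rw [← exp_nat_mul]; congr 1; push_cast; ring
  have e1 : exp (2 * Real.pi * I * -v) = (exp (Real.pi * I * v) ^ 2)⁻¹ := by
    rw [← e, ← exp_neg]; congr 1; ring
  have e2 : exp (2 * Real.pi * I * ((1 / 2 : ℝ) : ℂ) * v) = exp (Real.pi * I * v) := by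
    congr 1; push_cast; ring
  have e3 : exp (2 * Real.pi * I * ((1 / 2 : ℝ) : ℂ) * -v) = (exp (Real.pi * I * v))⁻¹ := by
    rw [← exp_neg]; congr 1; push_cast; ring
  rw [e, e1, e2, e3]
  have hx : exp (Real.pi * I * v) ≠ 0 := exp_ne_zero _
  generalize exp (Real.pi * I * v) = x at hx ⊢
  by_cases h : x ^ 2 - 1 = 0
  · have : x ^ 2 = 1 := by linear_combination h
    simp [this]
  · have h2 : (x ^ 2)⁻¹ - 1 ≠ 0 := by
      intro h3; apply h; field_simp at h3; linear_combination -h3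
    field_simp
    ring_nf
    rw [← sub_eq_zero] 
    have h4 : (1 - x ^ 2) ≠ 0 := by intro h3; apply h; linear_combination -h3
    have h5 : (-1 + x ^ 2) ≠ 0 := by intro h3; apply h; linear_combination h3
    field_simp
    ring

lemma exp_neg_half_int (n : ℤ) :
    exp (-(2 * Real.pi * I * ((1 / 2 : ℝ) : ℂ) * n)) = (-1) ^ n := by
  rw [show -(2 * Real.pi * I * ((1 / 2 : ℝ) : ℂ) * n) = ((-n : ℤ) : ℂ) * (Real.pi * I) by
    push_cast; ring, exp_int_mul, exp_pi_mul_I, zpow_neg, ← inv_zpow]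
  norm_num

lemma EF_eq (v : ℂ) : EF v = ∑' n : ℤ, (-1) ^ n * gK (1 / 2) (v + n * I) := by
  unfold EF KF
  exact tsum_congr fun n => by rw [exp_neg_half_int]

lemma EF_neg (v : ℂ) : EF (-v) = -EF v := by
  rw [EF_eq, EF_eq, ← tsum_neg, ← (Equiv.neg ℤ).tsum_eq]
  refine tsum_congr fun n => ?_
  simp only [Equiv.neg_apply]
  rw [show -v + ((-n : ℤ) : ℂ) * I = -(v + n * I) by push_cast; ring, gK_half_neg, zpow_neg,
    ← inv_zpow]
  norm_num

lemma conj_gK_half (v : ℂ) :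
    (starRingEnd ℂ) (gK (1 / 2) ((starRingEnd ℂ) v)) = gK (1 / 2) v := by
  have h := gK_half_neg v
  rw [← neg_inj, ← h]
  unfold gK
  simp only [map_div₀, map_mul, map_sub, map_one, ← exp_conj, conj_I, conj_ofReal, conj_conj,
    map_ofNat]
  rw [← neg_div]
  congr 1
  · simp
  · congr 2; ring

lemma conj_EF (v : ℂ) : (starRingEnd ℂ) (EF ((starRingEnd ℂ) v)) = EF v := by
  rw [EF_eq, EF_eq, conj_tsum, ← (Equiv.neg ℤ).tsum_eq]
  refine tsum_congr fun n => ?_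
  simp only [Equiv.neg_apply]
  rw [map_mul, show (starRingEnd ℂ) v + ((-n : ℤ) : ℂ) * I = (starRingEnd ℂ) (v + n * I) by simp,
    conj_gK_half]
  congr 1
  simp [← inv_zpow]

lemma exists_EF_eq_inv_add : ∃ h : ℂ → ℂ, AnalyticAt ℂ h 0 ∧ ∀ᶠ v in 𝓝[≠] 0, EF v = v⁻¹ + h v :=
  exists_KF_eq_inv_add (by norm_num) (by norm_num)

lemma tendsto_of_inv_add {f h : ℂ → ℂ} (hh : AnalyticAt ℂ h 0)
    (hf : ∀ᶠ v in 𝓝[≠] 0, f v = v⁻¹ + h v) : Tendsto (fun z => z * f z) (𝓝[≠] 0) (𝓝 1) := by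
  have h1 : Tendsto (fun z => 1 + z * h z) (𝓝[≠] 0) (𝓝 (1 + 0 * h 0)) :=
    ((continuousAt_const.add (continuousAt_id.mul hh.continuousAt)).tendsto).mono_left
      nhdsWithin_le_nhds
  rw [zero_mul, add_zero] at h1
  refine h1.congr' ?_
  filter_upwards [hf, self_mem_nhdsWithin] with z hz hz0
  rw [hz, mul_add, mul_inv_cancel₀ hz0]

lemma tendsto_mul_EF : Tendsto (fun z => z * EF z) (𝓝[≠] 0) (𝓝 1) := by
  obtain ⟨h, hh, hf⟩ := exists_EF_eq_inv_add
  exact tendsto_of_inv_add hh hf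

lemma EF_lat {v : ℂ} (hv : v ∈ Lat) : EF v = 0 := by
  obtain ⟨m, n, rfl⟩ := hv
  have := EF_add_lat 0 m n
  have h0 : EF 0 = 0 := by
    have := EF_neg 0
    rw [neg_zero] at this
    exact self_eq_neg.1 this
  rw [zero_add] at this
  rw [this, h0, mul_zero]

lemma I_mul_mem_Lat {v : ℂ} : I * v ∈ Lat ↔ v ∈ Lat := by
  refine ⟨fun h => ?_, mul_mem_Lat I_mem_Lat⟩
  have := mul_mem_Lat (neg_mem_Lat I_mem_Lat) h
  rwa [← mul_assoc, neg_mul, I_mul_I, neg_neg, one_mul] at this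

lemma EF_I_mul (v : ℂ) : EF (I * v) = -I * EF v := by
  by_cases hv : v ∈ Lat
  · rw [EF_lat hv, EF_lat (mul_mem_Lat I_mem_Lat hv), mul_zero]
  set f : ℂ → ℂ := fun v => EF (I * v) + I * EF v with hf
  have hd : ∀ v ∉ Lat, DifferentiableAt ℂ f v := by
    intro v hv
    have hv' : I * v ∉ Lat := fun h => hv (I_mul_mem_Lat.1 h)
    exact (DifferentiableAt.comp (f := fun v : ℂ => I * v) v (differentiableAt_EF hv')
      (by fun_prop)).add ((differentiableAt_EF hv).const_mul _)
  have h0 : Tendsto (fun z => z * f z) (𝓝[≠] 0) (𝓝 0) := by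
    have t1 : Tendsto (fun z => I * z) (𝓝[≠] (0 : ℂ)) (𝓝[≠] 0) := by
      simpa using tendsto_mul_punctured 0 I I_ne_zero
    have t2 := ((tendsto_mul_EF.comp t1).const_mul (-I)).add (tendsto_mul_EF.const_mul I)
    simp only [mul_one, neg_add_cancel] at t2
    refine t2.congr fun z => ?_
    simp only [Function.comp, hf]
    linear_combination -z * EF (I * z) * I_sq
  have h1 : ∀ v, f (v + 1) = (-1) * f v := fun v => by
    simp only [hf]
    rw [mul_add, mul_one, EF_add_I, EF_add_one]; ring
  have hI : ∀ v, f (v + I) = (-1) * f v := fun v => by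
    simp only [hf]
    have := EF_add_one (I * (v + I))
    rw [show I * (v + I) + 1 = I * v by linear_combination I_sq] at this
    rw [EF_add_I, this]; ring
  obtain ⟨C, hC, hC0⟩ := exists_const_of_removable
    (removable_of_lat hd h0 h1 hI (by norm_num) (by norm_num)) h1 hI (by simp) (by simp)
  have := hC v (hd v hv).continuousAt
  rw [hC0 (Or.inl (by norm_num))] at this
  simp only [hf] at this
  linear_combination this

/-- The 2-torsion point `(1+i)/2`. -/
def T0 : ℂ := (1 + I) / 2

lemma EF_T0 : EF T0 = 0 := by
  have h1 := EF_I_mul T0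
  have h2 := EF_add_one (I * T0)
  rw [show I * T0 + 1 = T0 by unfold T0; linear_combination I_sq / 2] at h2
  have h3 : (1 - I) * EF T0 = 0 := by linear_combination h2 - h1
  rcases mul_eq_zero.1 h3 with h | h
  · exfalso
    have := congrArg Complex.re h
    simp at this
  · exact h

lemma T0_notMem : T0 ∉ Lat := by
  rintro ⟨m, n, h⟩
  have := congrArg Complex.re h
  simp [T0] at this
  have h2 : (1 : ℝ) = 2 * m := by linarith
  have h3 : (1 : ℤ) = 2 * m := by exact_mod_cast h2
  omega

lemma eq_zero_of_rotate {k : ℂ → ℂ} (hk : ContinuousAt k 0) {c : ℂ} (hc : c ≠ 1)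
    (h : ∀ᶠ z in 𝓝[≠] 0, k (I * z) = c * k z) : k 0 = 0 := by
  have t1 : Tendsto (fun z => I * z) (𝓝[≠] (0 : ℂ)) (𝓝[≠] 0) := by
    simpa using tendsto_mul_punctured 0 I I_ne_zero
  have hk' : Tendsto k (𝓝[≠] 0) (𝓝 (k 0)) := hk.tendsto.mono_left nhdsWithin_le_nhds
  have h1 := tendsto_nhds_unique ((hk'.comp t1).congr' h) (hk'.const_mul c)
  have h2 : (1 - c) * k 0 = 0 := by linear_combination h1
  exact (mul_eq_zero.1 h2).resolve_left (sub_ne_zero.2 hc.symm)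

lemma exists_EF_eq : ∃ k : ℂ → ℂ, AnalyticAt ℂ k 0 ∧ ∀ᶠ v in 𝓝[≠] 0, EF v = v⁻¹ + v ^ 3 * k v := by
  obtain ⟨h, hh, hf⟩ := exists_EF_eq_inv_add
  have t1 : Tendsto (fun z => I * z) (𝓝[≠] (0 : ℂ)) (𝓝[≠] 0) := by
    simpa using tendsto_mul_punctured 0 I I_ne_zero
  have hne : ∀ᶠ z : ℂ in 𝓝[≠] 0, z ≠ 0 := self_mem_nhdsWithin
  have r0 : ∀ᶠ z in 𝓝[≠] 0, h (I * z) = -I * h z := by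
    filter_upwards [hf, t1.eventually hf, hne] with z h1 h2 h0
    have h3 := EF_I_mul z
    rw [h1, h2, mul_inv, inv_I] at h3
    linear_combination h3
  have hI1 : -I ≠ 1 := fun h => by simpa using congrArg Complex.re h
  have hI2 : I ≠ 1 := fun h => by simpa using congrArg Complex.re h
  obtain ⟨k1, a1, e1, -⟩ := exists_eq_mul_of_analyticAt hh (eq_zero_of_rotate hh.continuousAt hI1 r0)
  have r1 : ∀ᶠ z in 𝓝[≠] 0, k1 (I * z) = -1 * k1 z := by
    filter_upwards [r0, hne] with z h1 h0
    rw [e1, e1] at h1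
    apply mul_left_cancel₀ (mul_ne_zero I_ne_zero h0)
    linear_combination h1
  obtain ⟨k2, a2, e2, -⟩ := exists_eq_mul_of_analyticAt a1
    (eq_zero_of_rotate a1.continuousAt (by norm_num) r1)
  have r2 : ∀ᶠ z in 𝓝[≠] 0, k2 (I * z) = I * k2 z := by
    filter_upwards [r1, hne] with z h1 h0
    rw [e2, e2] at h1
    apply mul_left_cancel₀ (mul_ne_zero I_ne_zero h0)
    linear_combination h1 - z * k2 z * I_sq
  obtain ⟨k3, a3, e3, -⟩ := exists_eq_mul_of_analyticAt a2
    (eq_zero_of_rotate a2.continuousAt hI2 r2)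
  refine ⟨k3, a3, ?_⟩
  filter_upwards [hf] with z hz
  rw [hz, e1, e2, e3]; ring

end

section

open Filter Topology

lemma eventually_nhds_of_punctured {P : ℂ → Prop} (h : ∀ᶠ z in 𝓝[≠] (0 : ℂ), P z) :
    ∀ᶠ z in 𝓝[≠] (0 : ℂ), ∀ᶠ w in 𝓝 z, P w := by
  rw [← eventually_eventually_nhdsWithin] at h
  filter_upwards [h, self_mem_nhdsWithin] with z hz hz0
  rwa [isOpen_compl_singleton.nhdsWithin_eq hz0] at hz

lemma exists_EF_expansion : ∃ k m : ℂ → ℂ, ContinuousAt k 0 ∧ ContinuousAt m 0 ∧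
    ∀ᶠ v in 𝓝[≠] 0, v ≠ 0 ∧ EF v = (1 + v ^ 4 * k v) / v ∧
      deriv EF v = (-1 + v ^ 4 * m v) / v ^ 2 := by
  obtain ⟨k, hk, hE⟩ := exists_EF_eq
  refine ⟨k, fun v => 3 * k v + v * deriv k v, hk.continuousAt,
    (continuousAt_const.mul hk.continuousAt).add (continuousAt_id.mul hk.deriv.continuousAt), ?_⟩
  have ha : ∀ᶠ v in 𝓝[≠] (0 : ℂ), AnalyticAt ℂ k v :=
    hk.eventually_analyticAt.filter_mono nhdsWithin_le_nhds
  filter_upwards [hE, eventually_nhds_of_punctured hE, self_mem_nhdsWithin, ha] with v h1 h2 h0 hav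
  have h0 : v ≠ 0 := h0
  refine ⟨h0, ?_, ?_⟩
  · rw [h1]; field_simp
  · rw [Filter.EventuallyEq.deriv_eq h2]
    have hd : HasDerivAt (fun v => v⁻¹ + v ^ 3 * k v)
        (-(v ^ 2)⁻¹ + ((3 : ℕ) * v ^ (3 - 1) * k v + v ^ 3 * deriv k v)) v :=
      (hasDerivAt_inv h0).add ((hasDerivAt_pow 3 v).mul hav.differentiableAt.hasDerivAt)
    rw [hd.deriv]
    field_simp
    push_cast
    ring

lemma deriv_EF_add_one (v : ℂ) : deriv EF (v + 1) = (-1) * deriv EF v := by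
  rw [← deriv_comp_add_const]
  simp_rw [EF_add_one]
  simp

lemma deriv_EF_add_I (v : ℂ) : deriv EF (v + I) = (-1) * deriv EF v := by
  rw [← deriv_comp_add_const]
  simp_rw [EF_add_I]
  simp

lemma isOpen_compl_Lat : IsOpen Latᶜ :=
  isOpen_iff_mem_nhds.2 fun _ hc => eventually_notMem_Lat' hc

lemma analyticOnNhd_EF : AnalyticOnNhd ℂ EF Latᶜ :=
  DifferentiableOn.analyticOnNhd
    (fun _ hv => (differentiableAt_EF hv).differentiableWithinAt) isOpen_compl_Lat

lemma differentiableAt_deriv_EF {v : ℂ} (hv : v ∉ Lat) : DifferentiableAt ℂ (deriv EF) v :=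
  (analyticOnNhd_EF v hv).deriv.differentiableAt

/-- The derivative of `EF` at the zero `T0`. -/
def c0 : ℂ := deriv EF T0

lemma tendsto_EF_T0_div : Tendsto (fun z => EF (z + T0) / z) (𝓝[≠] 0) (𝓝 c0) := by
  have h := hasDerivAt_iff_tendsto_slope_zero.1 (differentiableAt_EF T0_notMem).hasDerivAt
  refine h.congr fun z => ?_
  rw [EF_T0, sub_zero, smul_eq_mul, div_eq_inv_mul, add_comm]

lemma two_T0_add (v : ℂ) : EF (v + T0 + T0) = EF v := by
  rw [show v + T0 + T0 = v + 1 + I by unfold T0; ring, EF_add_I, EF_add_one]; ring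

lemma two_T0_mem : T0 + T0 ∈ Lat := ⟨1, 1, by unfold T0; push_cast; ring⟩

lemma removable_of_lat_T0 {f : ℂ → ℂ} {μ ν ρ : ℂ}
    (hd : ∀ v ∉ Lat, v + T0 ∉ Lat → DifferentiableAt ℂ f v)
    (h0 : Tendsto (fun z => z * f z) (𝓝[≠] 0) (𝓝 0))
    (h1 : ∀ v, f (v + 1) = μ * f v) (hI : ∀ v, f (v + I) = ν * f v)
    (hT : ∀ v, f (v + T0) = ρ * f v)
    (hμ : μ ≠ 0) (hν : ν ≠ 0) (c : ℂ) : Removable f c := by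
  have hlat : ∀ c ∈ Lat, Removable f c := by
    intro c hc
    have hR : Removable f 0 := by
      refine ⟨?_, by simpa using h0⟩
      have : ∀ᶠ z in 𝓝[≠] (0 : ℂ), z + T0 ∉ Lat :=
        ((tendsto_add_punctured 0 T0).eventually (eventually_notMem_Lat _))
      filter_upwards [eventually_notMem_Lat 0, this] with z hz hz2 using hd z hz hz2
    obtain ⟨m, n, rfl⟩ := hc
    have a1 := Removable.shift (quasi_zmultiples hμ h1 (-m)) hR
    have a2 := Removable.shift (quasi_zmultiples hν hI (-n)) a1
    convert a2 using 1
    push_cast; ring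
  by_cases hc : c ∈ Lat
  · exact hlat c hc
  by_cases hc2 : c + T0 ∈ Lat
  · have := Removable.shift hT (hlat _ hc2)
    rwa [add_sub_cancel_right] at this
  · refine Removable.of_differentiableAt ?_
    have : ∀ᶠ z in 𝓝 c, z + T0 ∉ Lat :=
      ((continuous_id.add continuous_const).tendsto c).eventually (eventually_notMem_Lat' hc2)
    filter_upwards [eventually_notMem_Lat' hc, this] with z hz hz2 using hd z hz hz2

lemma eventually_add_T0_notMem : ∀ᶠ z in 𝓝[≠] (0 : ℂ), z + T0 ∉ Lat :=
  ((tendsto_add_punctured 0 T0).eventually (eventually_notMem_Lat _))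

lemma differentiableAt_EF_add {v w : ℂ} (h : v + w ∉ Lat) :
    DifferentiableAt ℂ (fun v => EF (v + w)) v :=
  DifferentiableAt.comp (f := fun v : ℂ => v + w) v (differentiableAt_EF h) (by fun_prop)

lemma EF_mul_EF_add_T0 {v : ℂ} (hv : v ∉ Lat) (hv2 : v + T0 ∉ Lat) : EF v * EF (v + T0) = c0 := by
  set f : ℂ → ℂ := fun v => EF v * EF (v + T0) with hf
  have hd : ∀ v ∉ Lat, v + T0 ∉ Lat → DifferentiableAt ℂ f v := fun v hv hv2 =>
    (differentiableAt_EF hv).mul (differentiableAt_EF_add hv2)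
  have h0 : Tendsto (fun z => z * f z) (𝓝[≠] 0) (𝓝 0) := by
    have hc : Tendsto (fun z => EF (z + T0)) (𝓝[≠] 0) (𝓝 (EF (0 + T0))) := by
      have : DifferentiableAt ℂ (fun z => EF (z + T0)) 0 :=
        differentiableAt_EF_add (by rw [zero_add]; exact T0_notMem)
      exact this.continuousAt.tendsto.mono_left nhdsWithin_le_nhds
    have := tendsto_mul_EF.mul hc
    rw [zero_add, EF_T0, mul_zero] at this
    exact this.congr fun z => by simp only [hf]; ring
  have h1 : ∀ v, f (v + 1) = 1 * f v := fun v => by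
    simp only [hf]; rw [add_right_comm, EF_add_one, EF_add_one]; ring
  have hI : ∀ v, f (v + I) = 1 * f v := fun v => by
    simp only [hf]; rw [add_right_comm, EF_add_I, EF_add_I]; ring
  have hT : ∀ v, f (v + T0) = 1 * f v := fun v => by
    simp only [hf]; rw [two_T0_add]; ring
  obtain ⟨C, hC, -⟩ := exists_const_of_removable
    (removable_of_lat_T0 hd h0 h1 hI hT one_ne_zero one_ne_zero) h1 hI (by simp) (by simp)
  have hCc : C = c0 := by
    have t1 := tendsto_mul_EF.mul tendsto_EF_T0_div
    rw [one_mul] at t1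
    refine tendsto_nhds_unique (tendsto_const_nhds.congr' ?_) t1
    filter_upwards [eventually_notMem_Lat 0, eventually_add_T0_notMem, self_mem_nhdsWithin]
      with z h1 h2 h0
    have h0 : z ≠ 0 := h0
    rw [← hC z (hd z h1 h2).continuousAt]
    simp only [hf]; field_simp
  rw [← hCc]
  exact hC v (hd v hv hv2).continuousAt

lemma countable_Lat : Lat.Countable := by
  have : Lat ⊆ Set.range fun x : ℤ × ℤ => (x.1 : ℂ) + x.2 * I := by
    rintro _ ⟨m, n, rfl⟩; exact ⟨(m, n), rfl⟩
  exact (Set.countable_range _).mono this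

lemma isPreconnected_compl {s : Set ℂ} (hs : s.Countable) : IsPreconnected sᶜ :=
  (hs.isPathConnected_compl_of_one_lt_rank
    (by rw [Complex.rank_real_complex]; norm_num)).isConnected.isPreconnected

lemma c0_ne_zero : c0 ≠ 0 := by
  intro hc
  have hE : ∀ᶠ z in 𝓝[≠] (0 : ℂ), EF z ≠ 0 := by
    filter_upwards [tendsto_mul_EF.eventually_ne one_ne_zero] with z hz h
    exact hz (by rw [h, mul_zero])
  have h1 : ∀ᶠ z in 𝓝[≠] (0 : ℂ), EF (z + T0) = 0 := by
    filter_upwards [hE, eventually_notMem_Lat 0, eventually_add_T0_notMem] with z h1 h2 h3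
    have := EF_mul_EF_add_T0 h2 h3
    rw [hc] at this
    exact (mul_eq_zero.1 this).resolve_left h1
  have h2 : ∀ᶠ z in 𝓝 (0 : ℂ), EF (z + T0) = 0 := by
    rw [eventually_nhdsWithin_iff] at h1
    filter_upwards [h1] with z hz
    by_cases h : z = 0
    · rw [h, zero_add, EF_T0]
    · exact hz h
  have h3 : EF =ᶠ[𝓝 T0] 0 := by
    have : Tendsto (fun z => z - T0) (𝓝 T0) (𝓝 0) := by
      have h : Continuous fun z : ℂ => z - T0 := by fun_prop
      simpa using h.tendsto T0
    filter_upwards [this.eventually h2] with z hz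
    simpa using hz
  have h4 := analyticOnNhd_EF.eqOn_zero_of_preconnected_of_eventuallyEq_zero
    (isPreconnected_compl countable_Lat) T0_notMem h3
  obtain ⟨z, hz1, hz2⟩ := (hE.and (eventually_notMem_Lat 0)).exists
  exact hz1 (h4 hz2)

lemma EF_ne_zero {v : ℂ} (hv : v ∉ Lat) (hv2 : v + T0 ∉ Lat) : EF v ≠ 0 := by
  intro h
  have := EF_mul_EF_add_T0 hv hv2
  rw [h, zero_mul] at this
  exact c0_ne_zero this.symm

lemma EF_eq_zero {v : ℂ} (hv : v + T0 ∈ Lat) : EF v = 0 := by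
  have h : v - T0 ∈ Lat := by
    have := sub_mem_Lat hv two_T0_mem
    rwa [show v + T0 - (T0 + T0) = v - T0 by ring] at this
  obtain ⟨m, n, h⟩ := h
  have := EF_add_lat T0 m n
  rw [← h, EF_T0, mul_zero] at this
  rw [← this]; congr 1; ring

lemma deriv_EF_sq {v : ℂ} (hv : v ∉ Lat) : deriv EF v ^ 2 = EF v ^ 4 + c0 ^ 2 := by
  set f : ℂ → ℂ := fun v => deriv EF v ^ 2 - EF v ^ 4 with hf
  have hd : ∀ v ∉ Lat, DifferentiableAt ℂ f v := fun v hv =>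
    ((differentiableAt_deriv_EF hv).pow 2).sub ((differentiableAt_EF hv).pow 4)
  have h0 : Tendsto (fun z => z * f z) (𝓝[≠] 0) (𝓝 0) := by
    obtain ⟨k, m, hk, hm, he⟩ := exists_EF_expansion
    have hc : ContinuousAt (fun z => z * ((-2 * m z + z ^ 4 * m z ^ 2) - (4 * k z + 6 * z ^ 4 * k z ^ 2 +
      4 * z ^ 8 * k z ^ 3 + z ^ 12 * k z ^ 4))) 0 := by fun_prop
    have := hc.tendsto.mono_left (nhdsWithin_le_nhds (s := {0}ᶜ))
    simp only [zero_mul] at this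
    refine this.congr' ?_
    filter_upwards [he] with z hz
    obtain ⟨hz0, h1, h2⟩ := hz
    simp only [hf]
    rw [h1, h2]; field_simp; ring
  have h1 : ∀ v, f (v + 1) = 1 * f v := fun v => by
    simp only [hf]; rw [EF_add_one, deriv_EF_add_one]; ring
  have hI : ∀ v, f (v + I) = 1 * f v := fun v => by
    simp only [hf]; rw [EF_add_I, deriv_EF_add_I]; ring
  obtain ⟨C, hC, -⟩ := exists_const_of_removable
    (removable_of_lat hd h0 h1 hI one_ne_zero one_ne_zero) h1 hI (by simp) (by simp)
  have e1 := hC v (hd v hv).continuousAt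
  have e2 := hC T0 (hd T0 T0_notMem).continuousAt
  simp only [hf] at e1 e2
  rw [EF_T0] at e2
  unfold c0
  linear_combination e1 - e2

lemma one_sub_I_ne : (1 - I : ℂ) ≠ 0 := fun h => by simpa using congrArg Complex.re h

lemma one_sub_I_mul_T0 : (1 - I) * T0 = 1 := by unfold T0; linear_combination -I_sq / 2

lemma one_sub_I_mem : (1 - I) ∈ Lat := sub_mem_Lat one_mem_Lat I_mem_Lat

lemma deriv_EF_eq {v : ℂ} (hv2 : (1 - I) * v ∉ Lat) :
    deriv EF v = -(1 - I) * EF v * EF ((1 - I) * v) := by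
  set f : ℂ → ℂ := fun v => deriv EF v + (1 - I) * EF v * EF ((1 - I) * v) with hf
  have hmul : ∀ v ∈ Lat, (1 - I) * v ∈ Lat := fun v hv => mul_mem_Lat one_sub_I_mem hv
  have hcomp : ∀ v, (1 - I) * v ∉ Lat → DifferentiableAt ℂ (fun v => EF ((1 - I) * v)) v :=
    fun v hv => DifferentiableAt.comp (f := fun v : ℂ => (1 - I) * v) v (differentiableAt_EF hv)
      (by fun_prop)
  have hd : ∀ v, (1 - I) * v ∉ Lat → DifferentiableAt ℂ f v := fun v hv =>
    (differentiableAt_deriv_EF fun h => hv (hmul v h)).add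
      (((differentiableAt_EF fun h => hv (hmul v h)).const_mul _).mul (hcomp v hv))
  have t1 : Tendsto (fun z => (1 - I) * z) (𝓝[≠] (0 : ℂ)) (𝓝[≠] 0) := by
    simpa using tendsto_mul_punctured 0 (1 - I) one_sub_I_ne
  have h0 : Tendsto (fun z => z * f z) (𝓝[≠] 0) (𝓝 0) := by
    obtain ⟨k, m, hk, hm, he⟩ := exists_EF_expansion
    have hk' : ContinuousAt (fun z => k ((1 - I) * z)) 0 := by
      refine ContinuousAt.comp (f := fun z : ℂ => (1 - I) * z) ?_ (by fun_prop)
      simpa using hk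
    have hc : ContinuousAt (fun z => z ^ 3 * (m z + k z + (1 - I) ^ 4 * k ((1 - I) * z) +
        z ^ 4 * k z * (1 - I) ^ 4 * k ((1 - I) * z))) 0 := by
      generalize hk2 : (fun z => k ((1 - I) * z)) = k2 at hk'
      simp only [fun z => show k ((1 - I) * z) = k2 z from congrFun hk2 z]
      fun_prop
    have := hc.tendsto.mono_left (nhdsWithin_le_nhds (s := {0}ᶜ))
    simp only [zero_pow (three_ne_zero), zero_mul] at this
    refine this.congr' ?_
    filter_upwards [he, t1.eventually he] with z hz hz'
    obtain ⟨hz0, h1, h2⟩ := hz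
    obtain ⟨-, h3, -⟩ := hz'
    simp only [hf]
    rw [h1, h2, h3]
    have := one_sub_I_ne
    field_simp; ring
  have h1 : ∀ v, f (v + 1) = (-1) * f v := fun v => by
    simp only [hf]
    have := EF_add_lat ((1 - I) * v) 1 (-1)
    rw [show (1 - I) * v + (((1 : ℤ) : ℂ) + ((-1 : ℤ) : ℂ) * I) = (1 - I) * (v + 1) by
      push_cast; ring] at this
    rw [this, EF_add_one, deriv_EF_add_one]; norm_num; ring
  have hI : ∀ v, f (v + I) = (-1) * f v := fun v => by
    simp only [hf]
    have := EF_add_lat ((1 - I) * v) 1 1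
    rw [show (1 - I) * v + (((1 : ℤ) : ℂ) + ((1 : ℤ) : ℂ) * I) = (1 - I) * (v + I) by
      push_cast; linear_combination I_sq] at this
    rw [this, EF_add_I, deriv_EF_add_I]; norm_num; ring
  have hz0 : Removable f 0 := by
    refine ⟨?_, by simpa using h0⟩
    filter_upwards [t1.eventually (eventually_notMem_Lat 0)] with z hz using hd z hz
  have hzT : Removable f T0 := by
    have tT : Tendsto (fun z => (1 - I) * z) (𝓝[≠] T0) (𝓝[≠] 1) := by
      simpa [one_sub_I_mul_T0] using tendsto_mul_punctured T0 (1 - I) one_sub_I_ne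
    refine ⟨?_, ?_⟩
    · filter_upwards [tT.eventually (eventually_notMem_Lat 1)] with z hz using hd z hz
    · have a1 : Tendsto (fun z => (z - T0) * deriv EF z) (𝓝[≠] T0) (𝓝 ((T0 - T0) * deriv EF T0)) :=
        (((continuousAt_id.sub continuousAt_const).mul
          (differentiableAt_deriv_EF T0_notMem).continuousAt).tendsto).mono_left nhdsWithin_le_nhds
      have a2 : Tendsto EF (𝓝[≠] T0) (𝓝 0) := by
        have := (differentiableAt_EF T0_notMem).continuousAt.tendsto.mono_left
          (nhdsWithin_le_nhds (s := {T0}ᶜ))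
        rwa [EF_T0] at this
      have tT' : Tendsto (fun z => (1 - I) * z + -1) (𝓝[≠] T0) (𝓝[≠] 0) := by
        simpa [Function.comp_def] using (tendsto_add_punctured 1 (-1)).comp tT
      have a3 := (tendsto_mul_EF.comp tT').mul a2
      have a4 := a1.sub a3
      rw [sub_self, zero_mul, mul_zero, sub_zero] at a4
      refine a4.congr fun z => ?_
      simp only [Function.comp, hf]
      have := EF_add_one ((1 - I) * z + -1)
      rw [neg_add_cancel_right] at this
      rw [this]
      linear_combination ((-EF z * EF ((1 - I) * z + -1))) * one_sub_I_mul_T0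
  have hshift : ∀ c, Removable f c → ∀ l ∈ Lat, Removable f (c + l) := by
    rintro c hc _ ⟨m, n, rfl⟩
    have a1 := Removable.shift (quasi_zmultiples (by norm_num) h1 (-m)) hc
    have a2 := Removable.shift (quasi_zmultiples (by norm_num) hI (-n)) a1
    convert a2 using 1
    push_cast; ring
  have hrem : ∀ c, Removable f c := by
    intro c
    by_cases hc : (1 - I) * c ∈ Lat
    · have hcases : c ∈ Lat ∨ c - T0 ∈ Lat := by
        obtain ⟨m, n, h⟩ := hc
        have e : c = T0 * (m + n * I) := by
          rw [← h, ← mul_assoc, mul_comm T0, one_sub_I_mul_T0, one_mul]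
        rcases Int.even_or_odd' (m + n) with ⟨k, hk | hk⟩
        · left
          refine ⟨m - k, k, ?_⟩
          have : (m : ℂ) + n = 2 * k := by exact_mod_cast hk
          rw [e]; unfold T0; push_cast
          linear_combination (n : ℂ) / 2 * I_sq + (-1/2 + I / 2) * this 
        · right
          refine ⟨m - k - 1, k, ?_⟩
          have : (m : ℂ) + n = 2 * k + 1 := by exact_mod_cast hk
          rw [e]; unfold T0; push_cast
          linear_combination (n : ℂ) / 2 * I_sq + (-1/2 + I / 2) * this
      rcases hcases with h | h
      · simpa using hshift 0 hz0 c h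
      · simpa using hshift T0 hzT _ h
    · refine Removable.of_differentiableAt ?_
      have : Tendsto (fun z => (1 - I) * z) (𝓝 c) (𝓝 ((1 - I) * c)) :=
        (continuous_const.mul continuous_id).tendsto c
      filter_upwards [this.eventually (eventually_notMem_Lat' hc)] with z hz using hd z hz
  obtain ⟨C, hC, hC0⟩ := exists_const_of_removable hrem h1 hI (by simp) (by simp)
  have e1 := hC v (hd v hv2).continuousAt
  rw [hC0 (Or.inl (by norm_num))] at e1
  simp only [hf] at e1
  linear_combination e1

end

section

open Filter Topology

/-- The square lattice. -/
def Lsq : PeriodPair where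
  ω₁ := 1
  ω₂ := I
  indep := by
    rw [LinearIndependent.pair_iff]
    intro s t h
    have h1 := congrArg Complex.re h
    have h2 := congrArg Complex.im h
    simp at h1 h2
    exact ⟨h1, h2⟩

lemma mem_Lsq {z : ℂ} : z ∈ Lsq.lattice ↔ z ∈ Lat := by
  rw [PeriodPair.mem_lattice]
  constructor
  · rintro ⟨m, n, h⟩; exact ⟨m, n, by rw [← h]; simp [Lsq]⟩
  · rintro ⟨m, n, h⟩; exact ⟨m, n, by rw [h]; simp [Lsq]⟩

lemma Lsq_symm (x : ℤ × ℤ) :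
    ((Lsq.latticeEquivProd.symm x : Lsq.lattice) : ℂ) = x.1 + x.2 * I := by
  rw [PeriodPair.latticeEquiv_symm_apply]; simp [Lsq]

lemma weierstrassP_Lsq (z : ℂ) : Lsq.weierstrassP z =
    ∑' x : ℤ × ℤ, (1 / (z - (x.1 + x.2 * I)) ^ 2 - 1 / ((x.1 : ℂ) + x.2 * I) ^ 2) := by
  unfold PeriodPair.weierstrassP
  rw [← Lsq.latticeEquivProd.symm.toEquiv.tsum_eq]
  refine tsum_congr fun x => ?_
  simp only [LinearEquiv.coe_toEquiv, Lsq_symm]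

lemma summable_weierstrassP_Lsq (z : ℂ) : Summable fun x : ℤ × ℤ =>
    (1 / (z - (x.1 + x.2 * I)) ^ 2 - 1 / ((x.1 : ℂ) + x.2 * I) ^ 2) := by
  have := (Lsq.latticeEquivProd.symm.toEquiv.summable_iff).2 (Lsq.hasSum_weierstrassP z).summable
  refine this.congr fun x => ?_
  simp only [LinearEquiv.coe_toEquiv, Lsq_symm, Function.comp]

lemma derivWeierstrassP_Lsq (z : ℂ) : Lsq.derivWeierstrassP z =
    - ∑' x : ℤ × ℤ, 2 / (z - (x.1 + x.2 * I)) ^ 3 := by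
  unfold PeriodPair.derivWeierstrassP
  rw [← Lsq.latticeEquivProd.symm.toEquiv.tsum_eq]
  congr 1
  refine tsum_congr fun x => ?_
  simp only [LinearEquiv.coe_toEquiv, Lsq_symm]

/-- Multiplication by `I` on pairs of coordinates. -/
def rotEquiv : ℤ × ℤ ≃ ℤ × ℤ where
  toFun x := (-x.2, x.1)
  invFun x := (x.2, -x.1)
  left_inv x := by simp
  right_inv x := by simp

lemma weierstrassP_Lsq_I_mul (z : ℂ) : Lsq.weierstrassP (I * z) = -Lsq.weierstrassP z := by
  rw [weierstrassP_Lsq, weierstrassP_Lsq, ← rotEquiv.tsum_eq, ← tsum_neg]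
  refine tsum_congr fun x => ?_
  have e : (((rotEquiv x).1 : ℂ) + (rotEquiv x).2 * I) = I * (x.1 + x.2 * I) := by
    simp only [rotEquiv, Equiv.coe_fn_mk]; push_cast
    linear_combination -(x.2 : ℂ) * I_sq
  rw [e, ← mul_sub, mul_pow, mul_pow, I_sq]
  simp only [one_div, mul_inv]
  norm_num
  ring

lemma EF_sq {v : ℂ} (hv : v ∉ Lat) : EF v ^ 2 = Lsq.weierstrassP v := by
  set f : ℂ → ℂ := fun v => EF v ^ 2 - Lsq.weierstrassP v with hf
  have hW : ∀ v ∉ Lat, DifferentiableAt ℂ Lsq.weierstrassP v := fun v hv =>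
    (Lsq.analyticOnNhd_weierstrassP v (fun h => hv (mem_Lsq.1 h))).differentiableAt
  have hd : ∀ v ∉ Lat, DifferentiableAt ℂ f v := fun v hv =>
    ((differentiableAt_EF hv).pow 2).sub (hW v hv)
  have h0 : Tendsto (fun z => z * f z) (𝓝[≠] 0) (𝓝 0) := by
    obtain ⟨k, m, hk, hm, he⟩ := exists_EF_expansion
    have hx : ContinuousAt (Lsq.weierstrassPExcept 0) 0 :=
      (Lsq.analyticAt_weierstrassPExcept 0).continuousAt
    have hc : ContinuousAt (fun z => z * (2 * z ^ 2 * k z + z ^ 6 * k z ^ 2 -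
      Lsq.weierstrassPExcept 0 z)) 0 := by fun_prop
    have := hc.tendsto.mono_left (nhdsWithin_le_nhds (s := {0}ᶜ))
    simp only [zero_mul] at this
    refine this.congr' ?_
    filter_upwards [he] with z hz
    obtain ⟨hz0, h1, h2⟩ := hz
    have h3 := Lsq.weierstrassPExcept_add 0 z
    simp only [Submodule.coe_zero, sub_zero] at h3
    simp only [hf]
    rw [h1, ← h3]; field_simp; ring
  have h1 : ∀ v, f (v + 1) = 1 * f v := fun v => by
    have := Lsq.weierstrassP_add_coe v ⟨1, mem_Lsq.2 one_mem_Lat⟩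
    simp only [hf]; rw [EF_add_one, this]; ring
  have hI : ∀ v, f (v + I) = 1 * f v := fun v => by
    have := Lsq.weierstrassP_add_coe v ⟨I, mem_Lsq.2 I_mem_Lat⟩
    simp only [hf]; rw [EF_add_I, this]; ring
  obtain ⟨C, hC, -⟩ := exists_const_of_removable
    (removable_of_lat hd h0 h1 hI one_ne_zero one_ne_zero) h1 hI (by simp) (by simp)
  have hC0 : C = 0 := by
    have hIT : I * T0 ∉ Lat := fun h => T0_notMem (I_mul_mem_Lat.1 h)
    have e1 := hC T0 (hd T0 T0_notMem).continuousAt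
    have e2 := hC (I * T0) (hd _ hIT).continuousAt
    simp only [hf] at e1 e2
    rw [EF_I_mul, weierstrassP_Lsq_I_mul, EF_T0] at e2
    rw [EF_T0] at e1
    linear_combination (-e1 - e2) / 2
  have := hC v (hd v hv).continuousAt
  simp only [hf] at this
  linear_combination this + hC0

lemma derivWeierstrassP_eq {v : ℂ} (hv : v ∉ Lat) :
    Lsq.derivWeierstrassP v = 2 * EF v * deriv EF v := by
  rw [← Lsq.deriv_weierstrassP]
  have : Lsq.weierstrassP =ᶠ[𝓝 v] fun v => EF v ^ 2 := by
    filter_upwards [eventually_notMem_Lat' hv] with z hz using (EF_sq hz).symm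
  rw [this.deriv_eq]
  have := (differentiableAt_EF hv).hasDerivAt.pow 2
  rw [HasDerivAt.deriv (f := fun v => EF v ^ 2) this]
  push_cast; ring

lemma wp4_varpi_mul (u : ℂ) :
    wp4 (varpi * u) = ((varpi : ℂ) ^ 2)⁻¹ * Lsq.weierstrassP u := by
  rw [weierstrassP_Lsq, (summable_weierstrassP_Lsq u).tsum_eq_add_tsum_ite (0 : ℤ × ℤ)]
  unfold wp4 ω4
  rw [mul_add, ← tsum_mul_left]
  congr 1
  · simp [mul_pow, mul_comm]
  · refine tsum_congr fun m => ?_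
    split_ifs with hm
    · simp
    · rw [← mul_sub, mul_pow, mul_pow, mul_inv, mul_inv]; ring

lemma wp4'_varpi_mul (u : ℂ) :
    wp4' (varpi * u) = ((varpi : ℂ) ^ 3)⁻¹ * Lsq.derivWeierstrassP u := by
  rw [derivWeierstrassP_Lsq, ← tsum_neg]
  unfold wp4' ω4
  rw [← tsum_mul_left]
  refine tsum_congr fun m => ?_
  rw [← mul_sub, mul_pow, mul_inv]; ring

lemma one_sub_I_mul_T0_mem {u : ℂ} (h : u + T0 ∈ Lat) : (1 - I) * u ∈ Lat := by
  have := mul_mem_Lat one_sub_I_mem h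
  rw [mul_add, one_sub_I_mul_T0] at this
  simpa using sub_mem_Lat this one_mem_Lat

lemma phi4_eq (h : (varpi : ℂ) ≠ 0) {u : ℂ} (hu : (1 - I) * u ∉ Lat) :
    phi4 u = varpi / EF ((1 - I) * u) := by
  have hu1 : u ∉ Lat := fun hh => hu (mul_mem_Lat one_sub_I_mem hh)
  have hE : EF u ≠ 0 := EF_ne_zero hu1 fun hh => hu (one_sub_I_mul_T0_mem hh)
  unfold phi4
  rw [wp4_varpi_mul, wp4'_varpi_mul, ← EF_sq hu1, derivWeierstrassP_eq hu1, deriv_EF_eq hu]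
  have := one_sub_I_ne
  by_cases h0 : EF ((1 - I) * u) = 0
  · simp [h0]
  · field_simp

end

section

open Filter Topology

/-- The real-analytic function `x ↦ -i E(x + T0)` on the real line. -/
def realE (x : ℝ) : ℝ := (-I * EF (x + T0)).re

lemma notMem_Lat_of_im {v : ℂ} (n : ℤ) (h1 : (n : ℝ) < v.im) (h2 : v.im < n + 1) : v ∉ Lat := by
  rintro ⟨m, k, rfl⟩
  simp at h1 h2
  norm_cast at h1 h2
  omega

lemma notMem_Lat_of_re {v : ℂ} (n : ℤ) (h1 : (n : ℝ) < v.re) (h2 : v.re < n + 1) : v ∉ Lat := by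
  rintro ⟨m, k, rfl⟩
  simp at h1 h2
  norm_cast at h1 h2
  omega

lemma real_add_T0_notMem (x : ℝ) : (x : ℂ) + T0 ∉ Lat := by
  refine notMem_Lat_of_im 0 ?_ ?_ <;> norm_num [T0]

lemma realE_eq (x : ℝ) : ((realE x : ℝ) : ℂ) = -I * EF (x + T0) := by
  unfold realE
  rw [← conj_eq_iff_re, map_mul]
  have h := conj_EF (x + T0 - I)
  have e : (starRingEnd ℂ) ((x : ℂ) + T0 - I) = x + T0 := by
    simp only [T0, map_sub, map_add, map_div₀, conj_I, map_one, conj_ofReal, map_ofNat]; ring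
  rw [e] at h
  rw [h, map_neg, conj_I]
  have h2 := EF_add_I (x + T0 - I)
  rw [sub_add_cancel] at h2
  rw [h2]; ring

lemma hasDerivAt_realE (x : ℝ) :
    HasDerivAt realE (-I * deriv EF (x + T0)).re x ∧
      (((-I * deriv EF (x + T0)).re : ℝ) : ℂ) = -I * deriv EF (x + T0) := by
  have h0 : HasDerivAt (fun z : ℂ => -I * EF (z + T0)) (-I * deriv EF (x + T0)) x := by
    have := ((differentiableAt_EF (real_add_T0_notMem x)).hasDerivAt.comp_add_const (x : ℂ) T0)
    exact this.const_mul _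
  have h1 : HasDerivAt realE (-I * deriv EF (x + T0)).re x := h0.real_of_complex
  refine ⟨h1, ?_⟩
  have h2 := h0.comp_ofReal
  have h3 := h1.ofReal_comp
  refine h3.unique (h2.congr_deriv rfl |>.congr_of_eventuallyEq ?_)
  filter_upwards with y using realE_eq y

lemma realE_symm (x : ℝ) : realE (1 - x) = realE x := by
  have : (((realE (1 - x) : ℝ)) : ℂ) = realE x := by
    rw [realE_eq, realE_eq]
    have h1 := EF_add_one (-x + T0)
    have h2 := EF_neg (x - T0)
    have h3 := EF_add_lat (x - T0) 1 1
    rw [show ((1 - x : ℝ) : ℂ) + T0 = -x + T0 + 1 by push_cast; ring, h1,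
      show -(x : ℂ) + T0 = -(x - T0) by ring, h2,
      show (x : ℂ) + T0 = x - T0 + (((1 : ℤ) : ℂ) + ((1 : ℤ) : ℂ) * I) by
        unfold T0; push_cast; ring, h3]
    norm_num
  exact_mod_cast this

lemma deriv_realE_half : deriv realE (1 / 2) = 0 := by
  have h1 := (hasDerivAt_realE (1 / 2)).1
  have h2 : HasDerivAt (fun x : ℝ => realE (1 - x)) (-(-I * deriv EF ((1/2 : ℝ) + T0)).re) (1/2) := by
    have := HasDerivAt.comp_const_sub (f := realE) (1 : ℝ) (1 / 2)
      (by rw [show (1 : ℝ) - 1/2 = 1/2 by norm_num]; exact h1)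
    exact this
  have h3 : (fun x : ℝ => realE (1 - x)) = realE := funext realE_symm
  rw [h3] at h2
  have := h1.unique h2
  rw [h1.deriv]; linarith

lemma deriv_realE_sq' (x : ℝ) : ((deriv realE x : ℝ) : ℂ) ^ 2 = -c0 ^ 2 - (realE x : ℂ) ^ 4 := by
  obtain ⟨h1, h2⟩ := hasDerivAt_realE x
  rw [h1.deriv, h2, realE_eq]
  have := deriv_EF_sq (real_add_T0_notMem x)
  have h4 : I ^ 4 = 1 := I_pow_four
  linear_combination (I ^ 2) * this + (EF (x + T0) ^ 4 + c0 ^ 2) * I_sq + EF (x + T0) ^ 4 * h4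

lemma realE_half_pow : ((realE (1 / 2) : ℝ) : ℂ) ^ 4 = -c0 ^ 2 := by
  have := deriv_realE_sq' (1 / 2)
  rw [deriv_realE_half] at this
  push_cast at this ⊢
  linear_combination this

lemma realE_half_ne_zero : realE (1 / 2) ≠ 0 := by
  intro h
  have := realE_half_pow
  rw [h] at this
  exact c0_ne_zero (by simpa using this)

lemma deriv_realE_sq (x : ℝ) : deriv realE x ^ 2 = realE (1 / 2) ^ 4 - realE x ^ 4 := by
  have := deriv_realE_sq' x
  rw [← realE_half_pow] at this
  exact_mod_cast this

lemma realE_zero : realE 0 = 0 := by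
  have := realE_eq 0
  rw [ofReal_zero, zero_add, EF_T0, mul_zero] at this
  exact_mod_cast this

lemma deriv_realE_ne_zero {x : ℝ} (h0 : 0 < x) (h1 : x < 1 / 2) : deriv realE x ≠ 0 := by
  intro h
  obtain ⟨e1, e2⟩ := hasDerivAt_realE x
  rw [e1.deriv] at h
  rw [h, ofReal_zero] at e2
  have a0 : (1 - I) * x ∉ Lat := by
    refine notMem_Lat_of_re 0 ?_ ?_ <;> simp <;> linarith
  have a1 : (1 - I) * (x + T0) ∉ Lat := by
    rw [mul_add, one_sub_I_mul_T0]
    intro hh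
    exact a0 (by simpa using sub_mem_Lat hh one_mem_Lat)
  rw [deriv_EF_eq a1] at e2
  have a2 : EF (x + T0) ≠ 0 := by
    refine EF_ne_zero (real_add_T0_notMem x) ?_
    refine notMem_Lat_of_re 1 ?_ ?_ <;> simp [T0] <;> linarith
  have a3 : EF ((1 - I) * (x + T0)) ≠ 0 := by
    refine EF_ne_zero a1 ?_
    rw [mul_add, one_sub_I_mul_T0]
    refine notMem_Lat_of_re 1 ?_ ?_ <;> simp [T0] <;> linarith
  have := one_sub_I_ne
  have := mul_ne_zero (neg_ne_zero.2 I_ne_zero) (mul_ne_zero (mul_ne_zero (neg_ne_zero.2 this) a2) a3)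
  exact this e2.symm

lemma varpi_eq : varpi = |realE (1 / 2)| := by
  set M := realE (1 / 2) with hM
  have hM0 : M ≠ 0 := realE_half_ne_zero
  set z : ℝ → ℝ := fun x => realE x / M with hz
  have hd : ∀ x, HasDerivAt z (deriv realE x / M) x := fun x =>
    (hasDerivAt_realE x).1.differentiableAt.hasDerivAt.div_const M
  have hcont : Continuous z := continuous_iff_continuousAt.2 fun x => (hd x).continuousAt
  have hz0 : z 0 = 0 := by simp [hz, realE_zero]
  have hz1 : z (1 / 2) = 1 := by simp only [hz]; rw [← hM]; exact div_self hM0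
  have hinj : Set.InjOn z (Set.Icc 0 (1 / 2)) := by
    have key : ∀ a b, 0 ≤ a → b ≤ 1 / 2 → a < b → z a ≠ z b := by
      intro a b ha hb hab he
      obtain ⟨c, hc, hc0⟩ := exists_deriv_eq_zero hab hcont.continuousOn he
      rw [(hd c).deriv] at hc0
      exact deriv_realE_ne_zero (by linarith [hc.1]) (by linarith [hc.2])
        ((div_eq_zero_iff.1 hc0).resolve_right hM0)
    intro a ha b hb he
    rcases lt_trichotomy a b with h | h | h
    · exact absurd he (key a b ha.1 hb.2 h)
    · exact h
    · exact absurd he.symm (key b a hb.1 ha.2 h)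
  have hmono : StrictMonoOn z (Set.Icc 0 (1 / 2)) :=
    hcont.continuousOn.strictMonoOn_of_injOn_Icc (by norm_num) (by rw [hz0, hz1]; norm_num) hinj
  have himg : z '' Set.Ioo 0 (1 / 2) = Set.Ioo 0 1 := by
    refine Set.Subset.antisymm ?_ ?_
    · rintro _ ⟨x, hx, rfl⟩
      refine ⟨?_, ?_⟩
      · rw [← hz0]
        exact hmono (by constructor <;> norm_num) ⟨hx.1.le, hx.2.le⟩ hx.1
      · rw [← hz1]
        exact hmono ⟨hx.1.le, hx.2.le⟩ (by constructor <;> norm_num) hx.2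
    · have := intermediate_value_Ioo (f := z) (by norm_num : (0 : ℝ) ≤ 1 / 2) hcont.continuousOn
      rwa [hz0, hz1] at this
  have hcv := MeasureTheory.integral_image_eq_integral_abs_deriv_smul
    (measurableSet_Ioo (a := (0 : ℝ)) (b := 1 / 2)) (fun x _ => (hd x).hasDerivWithinAt)
    (hinj.mono Set.Ioo_subset_Icc_self) (fun x => (1 - x ^ 4) ^ (-(1 : ℝ) / 2))
  rw [himg] at hcv
  have hval : ∀ x ∈ Set.Ioo (0 : ℝ) (1 / 2),
      |deriv realE x / M| • (1 - z x ^ 4) ^ (-(1 : ℝ) / 2) = |M| := by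
    intro x hx
    have h1 := deriv_realE_sq x
    rw [← hM] at h1
    have hM4 : 0 < M ^ 4 := by positivity
    have h2 : 1 - z x ^ 4 = (deriv realE x / M ^ 2) ^ 2 := by
      simp only [hz, div_pow]; rw [h1]; field_simp
    have h3 : |deriv realE x| ≠ 0 := abs_ne_zero.2 (deriv_realE_ne_zero hx.1 hx.2)
    rw [h2, ← sq_abs, ← Real.rpow_natCast, ← Real.rpow_mul (abs_nonneg _)]
    norm_num [Real.rpow_neg_one]
    rw [abs_div, abs_div, abs_pow]
    have : |M| ≠ 0 := abs_ne_zero.2 hM0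
    field_simp
  rw [MeasureTheory.setIntegral_congr_fun measurableSet_Ioo hval] at hcv
  unfold varpi
  rw [intervalIntegral.integral_of_le zero_le_one, MeasureTheory.integral_Ioc_eq_integral_Ioo, hcv]
  simp

lemma varpi_pos : 0 < varpi := by
  rw [varpi_eq]; exact abs_pos.2 realE_half_ne_zero

lemma varpi_ne_zero : (varpi : ℂ) ≠ 0 := by exact_mod_cast varpi_pos.ne'

lemma c0_sq : c0 ^ 2 = -(varpi : ℂ) ^ 4 := by
  have h : (varpi : ℂ) ^ 4 = (realE (1 / 2) : ℂ) ^ 4 := by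
    rw [varpi_eq]
    have : |realE (1 / 2)| ^ 4 = realE (1 / 2) ^ 4 := by
      rw [show 4 = 2 * 2 by norm_num, pow_mul, pow_mul, sq_abs]
    exact_mod_cast this
  rw [h, realE_half_pow]; ring

end

section

open Filter Topology

/-- The lemniscatic sine `v ↦ sl(ϖ v)`. -/
def sF (v : ℂ) : ℂ := varpi / c0 * EF (v + T0)

/-- The normalized derivative of `sF`. -/
def cF (v : ℂ) : ℂ := deriv EF (v + T0) / c0

lemma sF_eq (v : ℂ) : sF v = varpi / EF v := by
  unfold sF
  have h0 := c0_ne_zero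
  by_cases h1 : v ∈ Lat
  · obtain ⟨m, n, rfl⟩ := h1
    have := EF_add_lat T0 m n
    rw [add_comm T0] at this
    rw [this, EF_T0, EF_lat ⟨m, n, rfl⟩]; simp
  by_cases h2 : v + T0 ∈ Lat
  · rw [EF_lat h2, EF_eq_zero h2]; simp
  have h3 := EF_ne_zero h1 h2
  rw [← EF_mul_EF_add_T0 h1 h2] at h0 ⊢
  have := right_ne_zero_of_mul h0
  field_simp

lemma phi4_eq_sF {u : ℂ} (hu : (1 - I) * u ∉ Lat) : phi4 u = sF ((1 - I) * u) := by
  rw [phi4_eq varpi_ne_zero hu, sF_eq]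

lemma hasDerivAt_sF {v : ℂ} (hv : v + T0 ∉ Lat) : HasDerivAt sF (varpi * cF v) v := by
  have := ((differentiableAt_EF hv).hasDerivAt.comp_add_const v T0).const_mul ((varpi : ℂ) / c0)
  exact this.congr_deriv (by unfold cF; ring)

lemma analyticAt_sF {v : ℂ} (hv : v + T0 ∉ Lat) : AnalyticAt ℂ sF v := by
  have h : AnalyticAt ℂ (fun v => EF (v + T0)) v :=
    AnalyticAt.comp (g := EF) (f := fun v => v + T0) (analyticOnNhd_EF _ hv) (by fun_prop)
  exact analyticAt_const.mul h

lemma analyticAt_cF {v : ℂ} (hv : v + T0 ∉ Lat) : AnalyticAt ℂ cF v := by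
  have h : AnalyticAt ℂ (fun v => deriv EF (v + T0)) v :=
    AnalyticAt.comp (g := deriv EF) (f := fun v => v + T0) (analyticOnNhd_EF _ hv).deriv
      (by fun_prop)
  exact h.div_const

lemma cF_sq {v : ℂ} (hv : v + T0 ∉ Lat) : cF v ^ 2 = 1 - sF v ^ 4 := by
  unfold cF sF
  have h0 := c0_ne_zero
  rw [div_pow, deriv_EF_sq hv, mul_pow, div_pow,
    show (varpi : ℂ) ^ 4 = -c0 ^ 2 by rw [c0_sq]; ring]
  field_simp; ring

lemma sF_zero : sF 0 = 0 := by unfold sF; rw [zero_add, EF_T0, mul_zero]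

lemma cF_zero : cF 0 = 1 := by
  unfold cF; rw [zero_add]; exact div_self c0_ne_zero

lemma sF_neg (v : ℂ) : sF (-v) = -sF v := by
  rw [sF_eq, sF_eq, EF_neg, div_neg]

lemma EF_add_lat_fun (m n : ℤ) : (fun v => EF (v + (m + n * I))) = fun v => (-1) ^ (m + n) * EF v :=
  funext fun v => EF_add_lat v m n

lemma cF_add_lat (v : ℂ) (m n : ℤ) : cF (v + (m + n * I)) = (-1) ^ (m + n) * cF v := by
  unfold cF
  have := deriv_comp_add_const (f := EF) (m + n * I : ℂ) (v + T0)
  rw [add_right_comm, ← this, EF_add_lat_fun, deriv_const_mul_field]; ring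

lemma deriv_deriv_EF {v : ℂ} (hv : v ∉ Lat) : deriv (deriv EF) v = 2 * EF v ^ 3 := by
  have han : AnalyticOnNhd ℂ (fun v => deriv (deriv EF) v - 2 * EF v ^ 3) Latᶜ := fun v hv =>
    (analyticOnNhd_EF v hv).deriv.deriv.sub (analyticAt_const.mul ((analyticOnNhd_EF v hv).pow 3))
  have hne : ∀ᶠ v in 𝓝 T0, deriv EF v ≠ 0 :=
    (differentiableAt_deriv_EF T0_notMem).continuousAt.eventually_ne c0_ne_zero
  have hev : (fun v => deriv (deriv EF) v - 2 * EF v ^ 3) =ᶠ[𝓝 T0] 0 := by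
    filter_upwards [hne, eventually_notMem_Lat' T0_notMem] with v h1 h2
    have e : (fun v => deriv EF v ^ 2) =ᶠ[𝓝 v] fun v => EF v ^ 4 + c0 ^ 2 := by
      filter_upwards [eventually_notMem_Lat' h2] with z hz using deriv_EF_sq hz
    have d1 := (differentiableAt_deriv_EF h2).hasDerivAt.pow 2
    have d2 := ((differentiableAt_EF h2).hasDerivAt.pow 4).add_const (c0 ^ 2)
    have := d1.unique (d2.congr_of_eventuallyEq e)
    push_cast at this
    simp only [Pi.zero_apply]
    refine mul_left_cancel₀ h1 ?_
    rw [mul_zero]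
    linear_combination this / 2
  have := han.eqOn_zero_of_preconnected_of_eventuallyEq_zero
    (isPreconnected_compl countable_Lat) T0_notMem hev hv
  exact sub_eq_zero.1 this

lemma hasDerivAt_cF {v : ℂ} (hv : v + T0 ∉ Lat) : HasDerivAt cF (-2 * varpi * sF v ^ 3) v := by
  have := ((differentiableAt_deriv_EF hv).hasDerivAt.comp_add_const v T0).div_const c0
  refine this.congr_deriv ?_
  rw [deriv_deriv_EF hv]
  unfold sF
  have h0 := c0_ne_zero
  rw [mul_pow, div_pow]
  field_simp
  rw [c0_sq]; ring

/-- The set where `sF` has its poles. -/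
def Poles : Set ℂ := {v | v + T0 ∈ Lat}

lemma countable_Poles : Poles.Countable :=
  countable_Lat.preimage (add_left_injective T0)

lemma sF_add {u v : ℂ} (hu : u + T0 ∉ Lat) (hv : v + T0 ∉ Lat) (huv : u + v + T0 ∉ Lat) :
    sF (u + v) * (1 + sF u ^ 2 * sF v ^ 2) = sF u * cF v + sF v * cF u := by
  set w := u + v with hw
  set N : ℂ → ℂ := fun x => sF x * cF (w - x) + sF (w - x) * cF x with hN
  set D : ℂ → ℂ := fun x => 1 + sF x ^ 2 * sF (w - x) ^ 2 with hD
  set U : Set ℂ := (Poles ∪ (fun x => w - x) ⁻¹' Poles)ᶜ with hU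
  have hUc : (Poles ∪ (fun x => w - x) ⁻¹' Poles).Countable :=
    countable_Poles.union (countable_Poles.preimage sub_right_injective)
  have hUmem : ∀ x, x ∈ U ↔ x + T0 ∉ Lat ∧ w - x + T0 ∉ Lat := fun x => by
    simp [hU, Poles]
  have hs2 : ∀ x ∈ U, AnalyticAt ℂ (fun x => sF (w - x)) x := fun x hx =>
    AnalyticAt.comp (g := sF) (f := fun x => w - x) (analyticAt_sF ((hUmem x).1 hx).2) (by fun_prop)
  have hc2 : ∀ x ∈ U, AnalyticAt ℂ (fun x => cF (w - x)) x := fun x hx =>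
    AnalyticAt.comp (g := cF) (f := fun x => w - x) (analyticAt_cF ((hUmem x).1 hx).2) (by fun_prop)
  have hNa : AnalyticOnNhd ℂ N U := fun x hx =>
    ((analyticAt_sF ((hUmem x).1 hx).1).mul (hc2 x hx)).add
      ((hs2 x hx).mul (analyticAt_cF ((hUmem x).1 hx).1))
  have hDa : AnalyticOnNhd ℂ D U := fun x hx =>
    analyticAt_const.add (((analyticAt_sF ((hUmem x).1 hx).1).pow 2).mul ((hs2 x hx).pow 2))
  have hUo : IsOpen U := by
    have h1 : IsOpen {x : ℂ | x + T0 ∉ Lat} :=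
      isOpen_compl_Lat.preimage (continuous_id.add continuous_const)
    have h2 : IsOpen {x : ℂ | w - x + T0 ∉ Lat} :=
      isOpen_compl_Lat.preimage ((continuous_const.sub continuous_id).add continuous_const)
    have : U = {x : ℂ | x + T0 ∉ Lat} ∩ {x : ℂ | w - x + T0 ∉ Lat} := by
      ext x; exact hUmem x
    rw [this]; exact h1.inter h2
  have h0U : (0 : ℂ) ∈ U := (hUmem 0).2 ⟨by rw [zero_add]; exact T0_notMem, by rwa [sub_zero]⟩
  have hD0 : D 0 = 1 := by simp [hD, sF_zero]
  have hN0 : N 0 = sF w := by simp [hN, sF_zero, cF_zero]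
  have hDne : ∀ᶠ x in 𝓝 0, D x ≠ 0 :=
    (hDa 0 h0U).continuousAt.eventually_ne (by rw [hD0]; exact one_ne_zero)
  obtain ⟨ε, hε, hball⟩ := Metric.eventually_nhds_iff_ball.1 (hDne.and (hUo.mem_nhds h0U))
  have hderiv : ∀ x ∈ Metric.ball (0 : ℂ) ε, HasDerivAt (fun x => N x / D x) 0 x := by
    intro x hx
    obtain ⟨hDx, hxU⟩ := hball x hx
    obtain ⟨a1, a2⟩ := (hUmem x).1 hxU
    have ds := hasDerivAt_sF a1
    have dc := hasDerivAt_cF a1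
    have ds2 := (hasDerivAt_sF a2).comp_const_sub w x
    have dc2 := (hasDerivAt_cF a2).comp_const_sub w x
    have dN := (ds.mul dc2).add (ds2.mul dc)
    have dD := ((ds.pow 2).mul (ds2.pow 2)).const_add 1
    have := dN.div dD hDx
    refine this.congr_deriv ?_
    simp only [Pi.mul_apply, Pi.pow_apply, Pi.add_apply]
    rw [div_eq_zero_iff]; left
    have q1 := cF_sq a1
    have q2 := cF_sq a2
    push_cast
    linear_combination (-2 * varpi * sF x * sF (w - x) ^ 3) * q1 + (2 * varpi * sF x ^ 3 * sF (w - x)) * q2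
  have hconst : ∀ x ∈ Metric.ball (0 : ℂ) ε, N x / D x = sF w := by
    intro x hx
    have := Metric.isOpen_ball.is_const_of_deriv_eq_zero
      (Metric.isPreconnected_ball (x := (0 : ℂ)) (r := ε))
      (fun y hy => (hderiv y hy).differentiableAt.differentiableWithinAt)
      (fun y hy => (hderiv y hy).deriv) hx (Metric.mem_ball_self hε)
    rw [this, hN0, hD0, div_one]
  have hev : N =ᶠ[𝓝 0] fun x => sF w * D x := by
    filter_upwards [Metric.ball_mem_nhds 0 hε] with x hx
    rw [← hconst x hx, div_mul_cancel₀ _ (hball x hx).1]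
  have := hNa.eqOn_of_preconnected_of_eventuallyEq
    (fun x hx => analyticAt_const.mul (hDa x hx)) (isPreconnected_compl hUc) h0U hev
    ((hUmem u).2 ⟨hu, by rw [hw, add_sub_cancel_left]; exact hv⟩)
  simp only [hN, hD, Pi.mul_apply] at this
  rw [show w - u = v by rw [hw, add_sub_cancel_left]] at this
  exact this.symm

lemma cF_add {u v : ℂ} (hu : u + T0 ∉ Lat) (hv : v + T0 ∉ Lat) (huv : u + v + T0 ∉ Lat) :
    cF (u + v) * (1 + sF u ^ 2 * sF v ^ 2) =
      cF u * cF v - 2 * sF u ^ 3 * sF v - 2 * sF (u + v) * sF u * cF u * sF v ^ 2 := by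
  have o1 : ∀ᶠ x in 𝓝 u, x + T0 ∉ Lat :=
    ((continuous_id.add continuous_const).tendsto u).eventually (eventually_notMem_Lat' hu)
  have o2 : ∀ᶠ x in 𝓝 u, x + v + T0 ∉ Lat :=
    (((continuous_id.add continuous_const).add continuous_const).tendsto u).eventually
      (eventually_notMem_Lat' huv)
  have e : (fun x => sF (x + v) * (1 + sF x ^ 2 * sF v ^ 2)) =ᶠ[𝓝 u]
      fun x => sF x * cF v + sF v * cF x := by
    filter_upwards [o1, o2] with x h1 h2 using sF_add h1 hv h2
  have ds := hasDerivAt_sF hu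
  have dc := hasDerivAt_cF hu
  have d1 := ((hasDerivAt_sF huv).comp_add_const u v).mul
    (((ds.pow 2).mul_const (sF v ^ 2)).const_add 1)
  have d2 := (ds.mul_const (cF v)).add (dc.const_mul (sF v))
  have := d1.unique (d2.congr_of_eventuallyEq e)
  simp only [Pi.pow_apply] at this
  push_cast at this
  refine mul_left_cancel₀ varpi_ne_zero ?_
  linear_combination this

end

section

open Filter Topology

lemma mem_O4 {z : ℂ} : z ∈ O4 ↔ ∃ m n : ℤ, z = m + n * I := by
  constructor
  · intro h
    induction h using Subring.closure_induction with
    | mem x hx => rw [Set.mem_singleton_iff] at hx; exact ⟨0, 1, by simp [hx]⟩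
    | zero => exact ⟨0, 0, by simp⟩
    | one => exact ⟨1, 0, by simp⟩
    | add x y _ _ hx hy =>
      obtain ⟨m, n, rfl⟩ := hx; obtain ⟨k, l, rfl⟩ := hy
      exact ⟨m + k, n + l, by push_cast; ring⟩
    | neg x _ hx => obtain ⟨m, n, rfl⟩ := hx; exact ⟨-m, -n, by push_cast; ring⟩
    | mul x y _ _ hx hy =>
      obtain ⟨m, n, rfl⟩ := hx; obtain ⟨k, l, rfl⟩ := hy
      exact ⟨m * k - n * l, m * l + n * k, by push_cast; linear_combination (n * l : ℂ) * I_sq⟩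
  · rintro ⟨m, n, rfl⟩
    exact O4.add_mem (intCast_mem _ m) (O4.mul_mem (intCast_mem _ n)
      (Subring.subset_closure rfl))

lemma I_mem_O4 : I ∈ O4 := Subring.subset_closure rfl

lemma conj_mem_O4 {z : ℂ} (h : z ∈ O4) : (starRingEnd ℂ) z ∈ O4 := by
  obtain ⟨m, n, rfl⟩ := mem_O4.1 h
  exact mem_O4.2 ⟨m, -n, by simp⟩

lemma int_mem_O4 (m : ℤ) : (m : ℂ) ∈ O4 := intCast_mem _ m

lemma nat_mem_O4 (m : ℕ) : (m : ℂ) ∈ O4 := natCast_mem _ m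

lemma add_mul_I_inj {m n k l : ℤ} (h : (m : ℂ) + n * I = k + l * I) : m = k ∧ n = l := by
  have h1 := congrArg Complex.re h
  have h2 := congrArg Complex.im h
  simp at h1 h2
  exact ⟨by exact_mod_cast h1, by exact_mod_cast h2⟩

section GCong

variable {x y z w c : ℂ}

lemma _root_.GCong.refl (x c : ℂ) : GCong x x c := ⟨0, O4.zero_mem, by simp⟩

lemma _root_.GCong.symm (h : GCong x y c) : GCong y x c := by
  obtain ⟨d, hd, h⟩ := h
  exact ⟨-d, O4.neg_mem hd, by linear_combination -h⟩

lemma _root_.GCong.trans (h : GCong x y c) (h' : GCong y z c) : GCong x z c := by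
  obtain ⟨d, hd, h⟩ := h
  obtain ⟨e, he, h'⟩ := h'
  exact ⟨d + e, O4.add_mem hd he, by linear_combination h + h'⟩

lemma _root_.GCong.mul_left (h : GCong x y c) (hw : w ∈ O4) : GCong (w * x) (w * y) c := by
  obtain ⟨d, hd, h⟩ := h
  exact ⟨w * d, O4.mul_mem hw hd, by linear_combination w * h⟩

lemma _root_.GCong.mul (h : GCong x y c) (h' : GCong z w c) (hx : x ∈ O4) (hw : w ∈ O4) :
    GCong (x * z) (y * w) c := by
  have := h.mul_left hw
  rw [mul_comm w, mul_comm w] at this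
  exact (h'.mul_left hx).trans this

lemma _root_.GCong.add (h : GCong x y c) (h' : GCong z w c) : GCong (x + z) (y + w) c := by
  obtain ⟨d, hd, h⟩ := h
  obtain ⟨e, he, h'⟩ := h'
  exact ⟨d + e, O4.add_mem hd he, by linear_combination h + h'⟩

lemma _root_.GCong.pow (h : GCong x y c) (hx : x ∈ O4) (hy : y ∈ O4) (n : ℕ) :
    GCong (x ^ n) (y ^ n) c := by
  induction n with
  | zero => simpa using GCong.refl _ _
  | succ n ih => rw [pow_succ, pow_succ]; exact ih.mul h (O4.pow_mem hx n) hy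

end GCong

/-- A Gaussian prime `π = a + bi` of norm the odd prime `p`, which is `1` modulo `(1+i)³`. -/
structure Data (p : ℕ) (a b : ℤ) (π : ℂ) : Prop where
  prime : p.Prime
  mod4 : p % 4 = 1
  eq : π = a + b * I
  norm : (p : ℤ) = a ^ 2 + b ^ 2
  even : 2 ∣ b
  primary : 4 ∣ a + b - 1

lemma exists_data {p : ℕ} (hp : p.Prime) (hp4 : p % 4 = 1) {π : ℂ} (hπ : π ∈ O4)
    (hprimary : GCong π 1 ((1 + I) ^ 3)) (hnorm : (p : ℂ) = π * (starRingEnd ℂ) π) :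
    ∃ a b : ℤ, Data p a b π := by
  obtain ⟨a, b, h⟩ := mem_O4.1 hπ
  refine ⟨a, b, hp, hp4, h, ?_, ?_, ?_⟩
  · rw [h] at hnorm
    simp only [map_add, map_mul, conj_I, map_intCast] at hnorm
    have : (p : ℂ) = a ^ 2 + b ^ 2 := by rw [hnorm]; linear_combination (-(b : ℂ) ^ 2) * I_sq
    exact_mod_cast this
  all_goals
    obtain ⟨d, hd, e⟩ := hprimary
    obtain ⟨m, n, rfl⟩ := mem_O4.1 hd
    have e2 : ((a - 1 : ℤ) : ℂ) + b * I = ((-2 * m - 2 * n : ℤ) : ℂ) + ((2 * m - 2 * n : ℤ) : ℂ) * I := by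
      push_cast
      rw [h] at e
      linear_combination e + (3 * m + m * I + 3 * n * I + n * I ^ 2 + 2 * n) * I_sq
    obtain ⟨e3, e4⟩ := add_mul_I_inj e2
    omega

namespace Data

variable {p : ℕ} {a b : ℤ} {π : ℂ} (h : Data p a b π)
include h

lemma odd : a % 2 = 1 := by have := h.even; have := h.primary; omega

lemma mem : π ∈ O4 := mem_O4.2 ⟨a, b, h.eq⟩

lemma conj_eq : (starRingEnd ℂ) π = a - b * I := by rw [h.eq]; simp; ring

lemma mul_conj : π * (starRingEnd ℂ) π = p := by
  rw [h.conj_eq, h.eq]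
  have : (p : ℂ) = a ^ 2 + b ^ 2 := by exact_mod_cast h.norm
  rw [this]; linear_combination (-(b : ℂ) ^ 2) * I_sq

lemma p_ne_zero : (p : ℂ) ≠ 0 := by exact_mod_cast h.prime.ne_zero

lemma ne_zero : π ≠ 0 := by
  intro h0; apply h.p_ne_zero; rw [← h.mul_conj, h0, zero_mul]

lemma conj_ne_zero : (starRingEnd ℂ) π ≠ 0 := by
  intro h0; apply h.p_ne_zero; rw [← h.mul_conj, h0, mul_zero]

lemma prime_int : Prime (p : ℤ) := Nat.prime_iff_prime_int.1 h.prime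

lemma not_dvd_b : ¬ (p : ℤ) ∣ b := by
  intro hb
  have h1 : (p : ℤ) ∣ a ^ 2 := by
    rw [show a ^ 2 = p - b * b by rw [h.norm]; ring]
    exact dvd_sub dvd_rfl (hb.mul_right _)
  have h2 := h.prime_int.dvd_of_dvd_pow h1
  obtain ⟨k, hk⟩ := hb
  obtain ⟨l, hl⟩ := h2
  have e := h.norm
  have hp := h.prime.two_le
  have : (p : ℤ) * (p * (l ^ 2 + k ^ 2)) = p * 1 := by rw [hl, hk] at e; linear_combination -e
  have hp0 : (p : ℤ) ≠ 0 := by exact_mod_cast h.prime.ne_zero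
  have h1 := mul_left_cancel₀ hp0 this
  exact h.prime_int.not_dvd_one ⟨_, h1.symm⟩

lemma gcong_int {r s : ℤ} : GCong (r : ℂ) (s : ℂ) π ↔ (p : ℤ) ∣ r - s := by
  constructor
  · rintro ⟨d, hd, e⟩
    obtain ⟨m, n, rfl⟩ := mem_O4.1 hd
    have e2 : ((r - s : ℤ) : ℂ) + (0 : ℤ) * I =
        ((a * m - b * n : ℤ) : ℂ) + ((a * n + b * m : ℤ) : ℂ) * I := by
      push_cast; rw [e, h.eq]; linear_combination (b * n : ℂ) * I_sq
    obtain ⟨e3, e4⟩ := add_mul_I_inj e2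
    have : (r - s) * (r - s) = p * (m ^ 2 + n ^ 2) := by
      rw [e3, h.norm]; linear_combination (a * n + b * m) * e4
    exact (h.prime_int.dvd_or_dvd ⟨_, this⟩).elim id id
  · rintro ⟨k, hk⟩
    refine ⟨(starRingEnd ℂ) π * k, O4.mul_mem (conj_mem_O4 h.mem) (int_mem_O4 k), ?_⟩
    rw [← mul_assoc, h.mul_conj]; exact_mod_cast hk

lemma exists_inv {r : ℤ} (hr : ¬ (p : ℤ) ∣ r) : ∃ s t : ℤ, r * s + p * t = 1 := by
  have := (h.prime_int.irreducible.coprime_iff_not_dvd).2 hr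
  obtain ⟨x, y, hxy⟩ := this
  exact ⟨y, x, by linear_combination hxy⟩

lemma exists_I_cong : ∃ K : ℤ, GCong I K π := by
  obtain ⟨s, t, e⟩ := h.exists_inv h.not_dvd_b
  refine ⟨-a * s, s + (starRingEnd ℂ) π * (t * I), O4.add_mem (int_mem_O4 _)
    (O4.mul_mem (conj_mem_O4 h.mem) (O4.mul_mem (int_mem_O4 _) I_mem_O4)), ?_⟩
  have e' : (b : ℂ) * s + p * t = 1 := by exact_mod_cast e
  rw [mul_add, ← mul_assoc, h.mul_conj]
  push_cast
  rw [h.eq]; linear_combination (-I) * e'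

lemma exists_int_cong {x : ℂ} (hx : x ∈ O4) : ∃ r : ℤ, GCong x r π := by
  obtain ⟨m, n, rfl⟩ := mem_O4.1 hx
  obtain ⟨K, hK⟩ := h.exists_I_cong
  refine ⟨m + n * K, ?_⟩
  push_cast
  exact (GCong.refl _ _).add (hK.mul_left (int_mem_O4 n))

lemma exists_nat_cong {x : ℂ} (hx : x ∈ O4) : ∃ r : ℕ, r < p ∧ GCong x r π := by
  obtain ⟨r, hr⟩ := h.exists_int_cong hx
  have hp : (0 : ℤ) < p := by exact_mod_cast h.prime.pos
  refine ⟨(r % p).toNat, ?_, hr.trans ?_⟩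
  · have h1 := Int.emod_lt_of_pos r hp
    have h2 := Int.emod_nonneg r hp.ne'
    omega
  · have h2 := Int.emod_nonneg r hp.ne'
    have e : (((r % p).toNat : ℕ) : ℂ) = ((r % p : ℤ) : ℂ) := by
      have : (((r % p).toNat : ℕ) : ℤ) = r % p := Int.toNat_of_nonneg h2
      exact_mod_cast congrArg (fun z : ℤ => (z : ℂ)) this
    rw [e, h.gcong_int]
    exact Int.dvd_self_sub_emod

lemma not_cong_one_zero : ¬ GCong 1 0 π := by
  intro hh
  have : GCong ((1 : ℤ) : ℂ) ((0 : ℤ) : ℂ) π := by simpa using hh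
  rw [h.gcong_int] at this
  exact h.prime_int.not_dvd_one (by simpa using this)

lemma gcoprime_int {r : ℤ} : GCoprime (r : ℂ) π ↔ ¬ (p : ℤ) ∣ r := by
  constructor
  · rintro ⟨u, hu, v, hv, e⟩ hd
    have h1 : GCong ((r : ℤ) : ℂ) ((0 : ℤ) : ℂ) π := h.gcong_int.2 (by simpa using hd)
    have h2 := h1.mul_left hu
    refine h.not_cong_one_zero (GCong.trans (y := u * r) ⟨v, hv, ?_⟩ (by simpa using h2))
    linear_combination -e
  · intro hr
    obtain ⟨s, t, e⟩ := h.exists_inv hr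
    refine ⟨s, int_mem_O4 s, (starRingEnd ℂ) π * t,
      O4.mul_mem (conj_mem_O4 h.mem) (int_mem_O4 t), ?_⟩
    have e' : (r : ℂ) * s + p * t = 1 := by exact_mod_cast e
    rw [← e', ← h.mul_conj]; ring

omit h in
lemma gcoprime_congr {x y : ℂ} (hxy : GCong x y π) (hx : GCoprime x π) : GCoprime y π := by
  obtain ⟨u, hu, v, hv, e⟩ := hx
  obtain ⟨d, hd, e2⟩ := hxy
  exact ⟨u, hu, v + u * d, O4.add_mem hv (O4.mul_mem hu hd), by linear_combination e - u * e2⟩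

lemma gcoprime_mul {x y : ℂ} (hx : x ∈ O4) (hy : y ∈ O4) (h1 : GCoprime x π)
    (h2 : GCoprime y π) : GCoprime (x * y) π := by
  obtain ⟨u, hu, v, hv, e⟩ := h1
  obtain ⟨u', hu', v', hv', e'⟩ := h2
  have hπ := h.mem
  refine ⟨u * u', O4.mul_mem hu hu', v * (u' * y + v' * π) + u * x * v',
    O4.add_mem (O4.mul_mem hv (O4.add_mem (O4.mul_mem hu' hy) (O4.mul_mem hv' hπ)))
      (O4.mul_mem (O4.mul_mem hu hx) hv'), ?_⟩
  linear_combination (u' * y + v' * π) * e + e'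

omit h in
lemma gcoprime_of_mul {x y : ℂ} (hy : y ∈ O4) (h1 : GCoprime (x * y) π) : GCoprime x π := by
  obtain ⟨u, hu, v, hv, e⟩ := h1
  exact ⟨u * y, O4.mul_mem hu hy, v, hv, by linear_combination e⟩

lemma gcoprime_nat {r : ℕ} (h1 : 1 ≤ r) (h2 : r ≤ p - 1) : GCoprime (r : ℂ) π := by
  have := (h.gcoprime_int (r := r)).2 (by
    intro hd
    have := Nat.le_of_dvd (by omega) (Int.natCast_dvd_natCast.1 hd)
    have := h.prime.two_le
    omega)
  simpa using this

lemma exists_rep {x : ℂ} (hx : x ∈ O4) (hc : GCoprime x π) :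
    ∃ r ∈ Finset.Icc 1 (p - 1), GCong x (r : ℕ) π := by
  obtain ⟨r, hr, hxr⟩ := h.exists_nat_cong hx
  refine ⟨r, Finset.mem_Icc.2 ⟨?_, by omega⟩, hxr⟩
  rcases Nat.eq_zero_or_pos r with h0 | h0
  · exfalso
    have := gcoprime_congr hxr hc
    rw [h0] at this
    have := (h.gcoprime_int (r := 0)).1 (by simpa using this)
    simp at this
  · exact h0

lemma nat_cong_unique {r s : ℕ} (hr : r < p) (hs : s < p) (hc : GCong (r : ℂ) (s : ℂ) π) :
    r = s := by
  have := (h.gcong_int (r := r) (s := s)).1 (by simpa using hc)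
  have h1 : (r : ℤ) % p = s % p := Int.emod_eq_emod_iff_emod_sub_eq_zero.2 (Int.emod_eq_zero_of_dvd this)
  rw [Int.emod_eq_of_lt (by omega) (by omega), Int.emod_eq_of_lt (by omega) (by omega)] at h1
  exact_mod_cast h1

end Data

end

section

open Filter Topology

lemma I_pow_mem (k : ℕ) : I ^ k ∈ ({1, -1, I, -I} : Set ℂ) := by
  rw [I_pow_eq_pow_mod]
  have : k % 4 < 4 := Nat.mod_lt _ (by norm_num)
  interval_cases k % 4 <;> simp [pow_succ]

lemma exists_I_pow {ε : ℂ} (h : ε ∈ ({1, -1, I, -I} : Set ℂ)) :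
    ∃ k ∈ Finset.range 4, ε = I ^ k := by
  simp only [Set.mem_insert_iff, Set.mem_singleton_iff] at h
  rcases h with rfl | rfl | rfl | rfl
  · exact ⟨0, by simp, by simp⟩
  · exact ⟨2, by simp, by simp⟩
  · exact ⟨1, by simp, by simp⟩
  · exact ⟨3, by simp, by simp⟩

lemma I_pow_inj {k l : ℕ} (hk : k < 4) (hl : l < 4) (h : I ^ k = I ^ l) : k = l := by
  have hi := congrArg Complex.im h
  have hr := congrArg Complex.re h
  interval_cases k <;> interval_cases l <;> first | rfl | (exfalso; revert hi hr; norm_num [pow_succ])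

lemma I_pow_mem_O4 (k : ℕ) : I ^ k ∈ O4 := O4.pow_mem I_mem_O4 k

lemma prod_range_four (g : ℂ → ℂ) (ν : ℂ) :
    ∏ k ∈ Finset.range 4, g (I ^ k * ν) = g ν * g (-ν) * (g (I * ν) * g (I * -ν)) := by
  simp only [Finset.prod_range_succ, Finset.prod_range_zero, one_mul, pow_zero, pow_one, I_sq,
    I_pow_three, neg_mul, mul_neg]
  ring

namespace Data

variable {p : ℕ} {a b : ℤ} {π : ℂ} (h : Data p a b π)
include h

lemma gcoprime_I_pow_mul {ν : ℂ} (hν : ν ∈ O4) (hc : GCoprime ν π) (k : ℕ) :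
    GCoprime (I ^ k * ν) π := by
  refine h.gcoprime_mul (I_pow_mem_O4 k) hν ⟨(-I) ^ k, O4.pow_mem (O4.neg_mem I_mem_O4) k, 0,
    O4.zero_mem, ?_⟩ hc
  rw [← mul_pow, neg_mul, I_mul_I]; simp

theorem prod_quarter {S : Finset ℂ} (hS : IsQuarterSet π S) (g : ℂ → ℂ)
    (hg : ∀ x ∈ O4, ∀ y ∈ O4, GCong x y π → g x = g y) :
    ∏ r ∈ Finset.Icc 1 (p - 1), g (r : ℕ) =
      ∏ ν ∈ S, (g ν * g (-ν) * (g (I * ν) * g (I * -ν))) := by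
  obtain ⟨hS1, hS2, hS3⟩ := hS
  simp_rw [← prod_range_four]
  rw [← Finset.prod_product']
  have hx : ∀ x ∈ S ×ˢ Finset.range 4,
      I ^ x.2 * x.1 ∈ O4 ∧ GCoprime (I ^ x.2 * x.1) π := by
    intro x hx
    obtain ⟨h1, h2⟩ := hS1 _ (Finset.mem_product.1 hx).1
    exact ⟨O4.mul_mem (I_pow_mem_O4 _) h1, h.gcoprime_I_pow_mul h1 h2 _⟩
  have hrep : ∀ x ∈ S ×ˢ Finset.range 4,
      ∃ r ∈ Finset.Icc 1 (p - 1), GCong (I ^ x.2 * x.1) (r : ℕ) π := fun x h' =>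
    h.exists_rep (hx x h').1 (hx x h').2
  choose! ρ hρ1 hρ2 using hrep
  symm
  refine Finset.prod_bij (fun x _ => ρ x) (fun x hx => hρ1 x hx) ?_ ?_ ?_
  · intro x hx y hy he
    have h1 := (hρ2 x hx)
    rw [he] at h1
    have h2 := h1.trans (hρ2 y hy).symm
    rw [Finset.mem_product] at hx hy
    obtain ⟨e1, e2⟩ := hS3 _ hx.1 _ hy.1 _ (I_pow_mem _) _ (I_pow_mem _) h2
    exact Prod.ext e1 (I_pow_inj (Finset.mem_range.1 hx.2) (Finset.mem_range.1 hy.2) e2)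
  · intro r hr
    have hr' := Finset.mem_Icc.1 hr
    obtain ⟨ν, hν, ε, hε, hc⟩ := hS2 r (nat_mem_O4 r) (h.gcoprime_nat hr'.1 hr'.2)
    obtain ⟨k, hk, rfl⟩ := exists_I_pow hε
    have hm : (ν, k) ∈ S ×ˢ Finset.range 4 := Finset.mem_product.2 ⟨hν, hk⟩
    refine ⟨(ν, k), hm, ?_⟩
    have h1 := hρ1 _ hm
    rw [Finset.mem_Icc] at h1
    have := h.prime.two_le
    exact h.nat_cong_unique (by omega) (by omega) ((hc.trans (hρ2 _ hm)).symm)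
  · intro x hx'
    exact hg _ (hx x hx').1 _ (nat_mem_O4 _) (hρ2 x hx')

lemma card_quarter {S : Finset ℂ} (hS : IsQuarterSet π S) : p = 4 * S.card + 1 := by
  have h1 := h.prod_quarter hS (fun _ => 2) (fun _ _ _ _ _ => rfl)
  simp only [Finset.prod_const, Nat.card_Icc] at h1
  have h2 : (2 : ℂ) ^ (p - 1) = 2 ^ (4 * S.card) := by
    rw [pow_mul]
    convert h1 using 2 <;> norm_num
  have h3 : (2 : ℕ) ^ (p - 1) = 2 ^ (4 * S.card) := by exact_mod_cast h2
  have := Nat.pow_right_injective (le_refl 2) h3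
  have := h.prime.two_le
  omega

end Data

end

section

open Filter Topology

lemma mem_O4_iff_Lat {z : ℂ} : z ∈ O4 ↔ z ∈ Lat := mem_O4

lemma EF_add_one_sub_I_mul (v : ℂ) {δ : ℂ} (hδ : δ ∈ O4) : EF (v + (1 - I) * δ) = EF v := by
  obtain ⟨m, n, rfl⟩ := mem_O4.1 hδ
  have := EF_add_lat v (m + n) (n - m)
  rw [show v + (1 - I) * (m + n * I) = v + (((m + n : ℤ) : ℂ) + ((n - m : ℤ) : ℂ) * I) by
    push_cast; linear_combination (-(n : ℂ)) * I_sq, this,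
    show m + n + (n - m) = 2 * n by ring, zpow_mul]
  norm_num

lemma cF_add_one_sub_I_mul (v : ℂ) {δ : ℂ} (hδ : δ ∈ O4) : cF (v + (1 - I) * δ) = cF v := by
  obtain ⟨m, n, rfl⟩ := mem_O4.1 hδ
  have := cF_add_lat v (m + n) (n - m)
  rw [show v + (1 - I) * (m + n * I) = v + (((m + n : ℤ) : ℂ) + ((n - m : ℤ) : ℂ) * I) by
    push_cast; linear_combination (-(n : ℂ)) * I_sq, this,
    show m + n + (n - m) = 2 * n by ring, zpow_mul]
  norm_num

lemma exists_tendsto_mul_EF {k w c : ℂ} (hk : k ≠ 0) (hc : k * c + w ∈ Lat) :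
    ∃ L, Tendsto (fun z => (z - c) * EF (k * z + w)) (𝓝[≠] c) (𝓝 L) := by
  obtain ⟨m, n, e⟩ := hc
  have t1 : Tendsto (fun z => k * (z + -c)) (𝓝[≠] c) (𝓝[≠] 0) := by
    have h1 := tendsto_add_punctured c (-c)
    have h2 := tendsto_mul_punctured (c + -c) k hk
    have := h2.comp h1
    simpa [Function.comp_def] using this
  have t2 := ((tendsto_mul_EF.comp t1).const_mul (k⁻¹ * (-1) ^ (m + n)))
  refine ⟨_, t2.congr fun z => ?_⟩
  have := EF_add_lat (k * (z + -c)) m n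
  rw [← e, show k * (z + -c) + (k * c + w) = k * z + w by ring] at this
  rw [this]
  simp only [Function.comp]
  field_simp
  ring

namespace Data

variable {p : ℕ} {a b : ℤ} {π : ℂ} (h : Data p a b π)
include h

lemma ne_one_sub_I_mul {δ : ℂ} (hδ : δ ∈ O4) : π ≠ (1 - I) * δ := by
  intro e
  obtain ⟨m, n, rfl⟩ := mem_O4.1 hδ
  have e2 : (a : ℂ) + b * I = ((m + n : ℤ) : ℂ) + ((n - m : ℤ) : ℂ) * I := by
    rw [← h.eq, e]; push_cast; linear_combination (-(n : ℂ)) * I_sq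
  obtain ⟨e3, e4⟩ := add_mul_I_inj e2
  have := h.odd
  have := h.even
  omega

lemma two_inv : ∃ k : ℤ, 2 * k = p + 1 := ⟨(p + 1) / 2, by have := h.mod4; omega⟩

lemma div_mem_Lat_iff {α : ℂ} (hα : α ∈ O4) : (1 - I) * α / π ∈ Lat ↔ GCong α 0 π := by
  have h0 := h.ne_zero
  constructor
  · intro hl
    obtain ⟨k, hk⟩ := h.two_inv
    have hk' : (2 : ℂ) * k = p + 1 := by exact_mod_cast hk
    set l := (1 - I) * α / π with hl'
    have e : (1 - I) * α = π * l := by rw [hl']; field_simp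
    have hl := mem_O4_iff_Lat.2 hl
    refine ⟨-(starRingEnd ℂ π) * α + (1 + I) * k * l, O4.add_mem (O4.mul_mem
      (O4.neg_mem (conj_mem_O4 h.mem)) hα) (O4.mul_mem (O4.mul_mem
      (O4.add_mem O4.one_mem I_mem_O4) (int_mem_O4 k)) hl), ?_⟩
    linear_combination α * h.mul_conj - α * hk' + (1 + I) * k * e + k * α * I_sq
  · rintro ⟨d, hd, e⟩
    rw [sub_zero] at e
    rw [e, show (1 - I) * (π * d) / π = (1 - I) * d by field_simp]
    exact mul_mem_Lat one_sub_I_mem (mem_O4_iff_Lat.1 hd)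

lemma div_add_T0_notMem {α : ℂ} (hα : α ∈ O4) : (1 - I) * α / π + T0 ∉ Lat := by
  intro hl
  have h0 := h.ne_zero
  rw [← mem_O4_iff_Lat] at hl
  refine h.ne_one_sub_I_mul (O4.sub_mem (O4.mul_mem hl h.mem)
    (O4.mul_mem (mem_O4_iff_Lat.2 one_sub_I_mem) hα)) ?_
  have := one_sub_I_mul_T0
  field_simp
  linear_combination -π * this

lemma half_add_div_notMem {α : ℂ} (hα : α ∈ O4) : 1 / 2 + (1 - I) * α / π ∉ Lat := by
  intro hl
  have h0 := h.ne_zero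
  rw [← mem_O4_iff_Lat] at hl
  refine h.ne_one_sub_I_mul (O4.sub_mem (O4.mul_mem (O4.add_mem O4.one_mem I_mem_O4)
    (O4.mul_mem hl h.mem)) (O4.mul_mem (int_mem_O4 2) hα)) ?_
  push_cast
  field_simp
  linear_combination (π + 2 * (1 - I) * α) * I_sq

lemma half_add_div_add_T0_notMem {α : ℂ} (hα : α ∈ O4) :
    1 / 2 + (1 - I) * α / π + T0 ∉ Lat := by
  intro hl
  have h0 := h.ne_zero
  have : I * (1 / 2 + (1 - I) * α / π + T0) - I ∈ Lat :=
    sub_mem_Lat (mul_mem_Lat I_mem_Lat hl) I_mem_Lat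
  have h2 := h.half_add_div_notMem (α := -I * α) (O4.mul_mem (O4.neg_mem I_mem_O4) hα)
  refine h2 ?_
  have h3 := neg_mem_Lat this
  convert h3 using 1
  unfold T0
  linear_combination (1 / 2 : ℂ) * I_sq

lemma EF_congr (w : ℂ) {α β : ℂ} (hc : GCong α β π) :
    EF (w + (1 - I) * α / π) = EF (w + (1 - I) * β / π) := by
  obtain ⟨d, hd, e⟩ := hc
  have h0 := h.ne_zero
  rw [← EF_add_one_sub_I_mul (w + (1 - I) * β / π) hd]
  congr 1
  field_simp
  linear_combination (1 - I) * e

lemma sF_congr {α β : ℂ} (hc : GCong α β π) :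
    sF ((1 - I) * α / π) = sF ((1 - I) * β / π) := by
  have := h.EF_congr 0 hc
  simp only [zero_add] at this
  rw [sF_eq, sF_eq, this]

lemma cF_congr {α β : ℂ} (hc : GCong α β π) :
    cF ((1 - I) * α / π) = cF ((1 - I) * β / π) := by
  obtain ⟨d, hd, e⟩ := hc
  have h0 := h.ne_zero
  rw [← cF_add_one_sub_I_mul ((1 - I) * β / π) hd]
  congr 1
  field_simp
  linear_combination (1 - I) * e

lemma exists_add_mem {c : ℂ} (hc : π * c ∈ Lat) :
    ∃ r ∈ Finset.range p, c + (1 - I) * (r : ℕ) / π ∈ Lat := by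
  have h0 := h.ne_zero
  obtain ⟨k, hk⟩ := h.two_inv
  have hk' : (2 : ℂ) * k = p + 1 := by exact_mod_cast hk
  have hl := mem_O4_iff_Lat.2 hc
  have hα : -(1 + I) * k * (π * c) ∈ O4 := O4.mul_mem (O4.mul_mem
    (O4.neg_mem (O4.add_mem O4.one_mem I_mem_O4)) (int_mem_O4 k)) hl
  obtain ⟨r, hr, d, hd, e⟩ := h.exists_nat_cong hα
  refine ⟨r, Finset.mem_range.2 hr, ?_⟩
  have : c + (1 - I) * (r : ℕ) / π = -(starRingEnd ℂ π) * (π * c) - (1 - I) * d := by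
    field_simp
    linear_combination (-(1 - I)) * e + π * c * h.mul_conj - π * c * hk' + k * π * c * I_sq
  rw [this, ← mem_O4_iff_Lat]
  exact O4.sub_mem (O4.mul_mem (O4.neg_mem (conj_mem_O4 h.mem)) hl)
    (O4.mul_mem (mem_O4_iff_Lat.2 one_sub_I_mem) hd)

lemma add_mem_unique {c : ℂ} {r s : ℕ} (hr : r < p) (hs : s < p)
    (h1 : c + (1 - I) * (r : ℕ) / π ∈ Lat) (h2 : c + (1 - I) * (s : ℕ) / π ∈ Lat) : r = s := by
  have h3 := sub_mem_Lat h1 h2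
  rw [show c + (1 - I) * (r : ℕ) / π - (c + (1 - I) * (s : ℕ) / π) =
    (1 - I) * ((r : ℂ) - s) / π by ring,
    h.div_mem_Lat_iff (O4.sub_mem (nat_mem_O4 r) (nat_mem_O4 s))] at h3
  obtain ⟨d, hd, e⟩ := h3
  exact h.nat_cong_unique hr hs ⟨d, hd, by rw [← e, sub_zero]⟩

lemma sub_one_T0_mem : (π - 1) * T0 ∈ Lat := by
  have h1 := h.odd
  have h2 := h.even
  obtain ⟨k, hk⟩ : (2 : ℤ) ∣ a - 1 := by omega
  obtain ⟨l, hl⟩ := h2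
  refine ⟨k - l, k + l, ?_⟩
  have hk' : (a : ℂ) = 2 * k + 1 := by exact_mod_cast (show a = 2 * k + 1 by omega)
  have hl' : (b : ℂ) = 2 * l := by exact_mod_cast hl
  rw [h.eq, hk', hl']; unfold T0; push_cast
  linear_combination (l : ℂ) * I_sq

end Data

end

section

open Filter Topology

lemma differentiableAt_EF_affine {k w z : ℂ} (h : k * z + w ∉ Lat) :
    DifferentiableAt ℂ (fun v => EF (k * v + w)) z :=
  DifferentiableAt.comp (f := fun v : ℂ => k * v + w) z (differentiableAt_EF h) (by fun_prop)

lemma tendsto_affine_punctured {k : ℂ} (hk : k ≠ 0) (w c : ℂ) :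
    Tendsto (fun z => k * z + w) (𝓝[≠] c) (𝓝[≠] (k * c + w)) :=
  (tendsto_add_punctured (k * c) w).comp (tendsto_mul_punctured c k hk)

lemma eventually_affine_notMem {k : ℂ} (hk : k ≠ 0) (w c : ℂ) :
    ∀ᶠ z in 𝓝[≠] c, k * z + w ∉ Lat :=
  (tendsto_affine_punctured hk w c).eventually (eventually_notMem_Lat _)

lemma EF_half_mul {x : ℂ} (h1 : 1 / 2 + x ∉ Lat) (h2 : 1 / 2 + x + T0 ∉ Lat) :
    EF (1 / 2 + x) * EF (1 / 2 + I * x) = -I * c0 := by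
  have e : EF (1 / 2 + I * x) = -I * EF (1 / 2 + x + T0) := by
    have h3 := EF_add_lat (x - I / 2) 1 1
    rw [show 1 / 2 + x + T0 = x - I / 2 + (((1 : ℤ) : ℂ) + ((1 : ℤ) : ℂ) * I) by
      unfold T0; push_cast; ring, h3]
    rw [show (1 : ℂ) / 2 + I * x = I * (x - I / 2) by linear_combination (1 / 2 : ℂ) * I_sq,
      EF_I_mul]
    norm_num
  rw [e, ← EF_mul_EF_add_T0 h1 h2]; ring

/-- The product of the translates of `EF` by the `π`-division points, times a reciprocal factor. -/
def divProd (p : ℕ) (π : ℂ) (v : ℂ) : ℂ :=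
  (∏ r ∈ Finset.range p, EF (v + (1 - I) * (r : ℕ) / π)) * EF (π * v + T0)

namespace Data

variable {p : ℕ} {a b : ℤ} {π : ℂ} (h : Data p a b π)
include h

lemma odd_p : Odd p := by
  have := h.mod4
  exact Nat.odd_iff.2 (by omega)

lemma odd_add : Odd (a + b) := by
  have := h.odd
  have := h.even
  exact Int.odd_iff.2 (by omega)

lemma EF_pi_add_one (v : ℂ) : EF (π * (v + 1) + T0) = -EF (π * v + T0) := by
  rw [show π * (v + 1) + T0 = π * v + T0 + (a + b * I) by rw [mul_add, ← h.eq]; ring,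
    EF_add_lat, h.odd_add.neg_one_zpow]; ring

lemma EF_pi_add_I (v : ℂ) : EF (π * (v + I) + T0) = -EF (π * v + T0) := by
  have := EF_add_lat (π * v + T0) (-b) a
  rw [show π * (v + I) + T0 = π * v + T0 + (((-b : ℤ) : ℂ) + a * I) by
    rw [mul_add]; nth_rw 2 [h.eq]; push_cast; linear_combination (b : ℂ) * I_sq, this,
    Odd.neg_one_zpow]
  · ring
  · have := h.odd_add
    rw [Int.odd_iff] at this ⊢; omega

lemma divProd_add_one (v : ℂ) : divProd p π (v + 1) = 1 * divProd p π v := by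
  unfold divProd
  rw [h.EF_pi_add_one, Finset.prod_congr rfl (fun r _ => by
    rw [show v + 1 + (1 - I) * (r : ℕ) / π = v + (1 - I) * (r : ℕ) / π + 1 by ring, EF_add_one]),
    Finset.prod_mul_distrib, Finset.prod_const, Finset.card_range, h.odd_p.neg_one_pow]
  ring

lemma divProd_add_I (v : ℂ) : divProd p π (v + I) = 1 * divProd p π v := by
  unfold divProd
  rw [h.EF_pi_add_I, Finset.prod_congr rfl (fun r _ => by
    rw [show v + I + (1 - I) * (r : ℕ) / π = v + (1 - I) * (r : ℕ) / π + I by ring, EF_add_I]),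
    Finset.prod_mul_distrib, Finset.prod_const, Finset.card_range, h.odd_p.neg_one_pow]
  ring

omit h in
lemma differentiableAt_divProd {z : ℂ} (h1 : ∀ r ∈ Finset.range p, z + (1 - I) * (r : ℕ) / π ∉ Lat)
    (h2 : π * z + T0 ∉ Lat) : DifferentiableAt ℂ (divProd p π) z := by
  unfold divProd
  refine DifferentiableAt.mul ?_ (differentiableAt_EF_affine h2)
  exact DifferentiableAt.fun_finsetProd fun r hr => differentiableAt_EF_add (h1 r hr)

lemma eventually_differentiableAt_divProd (c : ℂ) :
    ∀ᶠ z in 𝓝[≠] c, DifferentiableAt ℂ (divProd p π) z := by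
  have h1 : ∀ᶠ z in 𝓝[≠] c, ∀ r ∈ Finset.range p, z + (1 - I) * (r : ℕ) / π ∉ Lat := by
    rw [Filter.eventually_all_finset]
    intro r _
    have := eventually_affine_notMem one_ne_zero ((1 - I) * (r : ℕ) / π) c
    simpa using this
  filter_upwards [h1, eventually_affine_notMem h.ne_zero T0 c] with z h1 h2
  exact differentiableAt_divProd h1 h2

omit h in
lemma tendsto_prod_EF {s : Finset ℕ} {c : ℂ}
    (hs : ∀ r ∈ s, c + (1 - I) * (r : ℕ) / π ∉ Lat) :
    Tendsto (fun z => ∏ r ∈ s, EF (z + (1 - I) * (r : ℕ) / π)) (𝓝[≠] c)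
      (𝓝 (∏ r ∈ s, EF (c + (1 - I) * (r : ℕ) / π))) :=
  tendsto_finsetProd _ fun r hr =>
    (differentiableAt_EF_add (hs r hr)).continuousAt.tendsto.mono_left nhdsWithin_le_nhds

lemma removable_divProd (c : ℂ) : Removable (divProd p π) c := by
  refine ⟨h.eventually_differentiableAt_divProd c, ?_⟩
  have h0 := h.ne_zero
  by_cases hc : ∀ r ∈ Finset.range p, c + (1 - I) * (r : ℕ) / π ∉ Lat
  · have t1 := tendsto_prod_EF hc
    by_cases h2 : π * c + T0 ∈ Lat
    · obtain ⟨L, t2⟩ := exists_tendsto_mul_EF h0 h2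
      have e : π * (c + T0) ∈ Lat := by
        have := add_mem_Lat h2 h.sub_one_T0_mem
        rwa [show π * c + T0 + (π - 1) * T0 = π * (c + T0) by ring] at this
      obtain ⟨r, hr, hr2⟩ := h.exists_add_mem e
      have e2 : ∏ r ∈ Finset.range p, EF (c + (1 - I) * (r : ℕ) / π) = 0 :=
        Finset.prod_eq_zero hr (EF_eq_zero (by convert hr2 using 1; ring))
      rw [e2] at t1
      have := t1.mul t2
      rw [zero_mul] at this
      refine this.congr fun z => ?_
      unfold divProd; ring
    · have := (differentiableAt_divProd hc h2).continuousAt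
      have t3 : ContinuousAt (fun z => (z - c) * divProd p π z) c := by fun_prop
      have := t3.tendsto.mono_left (nhdsWithin_le_nhds (s := {c}ᶜ))
      simpa using this
  · push Not at hc
    obtain ⟨r, hr, hr2⟩ := hc
    have hs : ∀ s ∈ (Finset.range p).erase r, c + (1 - I) * (s : ℕ) / π ∉ Lat := by
      intro s hs hs2
      rw [Finset.mem_erase, Finset.mem_range] at hs
      exact hs.1 (h.add_mem_unique hs.2 (Finset.mem_range.1 hr) hs2 hr2)
    have hpc : π * c ∈ Lat := by
      have h1 := sub_mem_Lat (mul_mem_Lat (mem_O4_iff_Lat.1 h.mem) hr2)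
        (mul_mem_Lat one_sub_I_mem (mem_O4_iff_Lat.1 (nat_mem_O4 r)))
      rwa [show π * (c + (1 - I) * (r : ℕ) / π) - (1 - I) * r = π * c by field_simp; ring] at h1
    have hpc2 : π * c + T0 ∉ Lat := fun h3 => T0_notMem (by
      have := sub_mem_Lat h3 hpc
      rwa [add_sub_cancel_left] at this)
    have hz : EF (π * c + T0) = 0 := EF_eq_zero (by
      have := add_mem_Lat hpc two_T0_mem
      rwa [← add_assoc] at this)
    have t1 := tendsto_prod_EF hs
    have t2 : Tendsto (fun z => EF (π * z + T0)) (𝓝[≠] c) (𝓝 (EF (π * c + T0))) :=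
      (differentiableAt_EF_affine hpc2).continuousAt.tendsto.mono_left nhdsWithin_le_nhds
    rw [hz] at t2
    obtain ⟨L, t3⟩ := exists_tendsto_mul_EF (k := 1) (w := (1 - I) * (r : ℕ) / π) (c := c)
      one_ne_zero (by rwa [one_mul])
    have := (t1.mul t2).mul t3
    rw [mul_zero, zero_mul] at this
    refine this.congr fun z => ?_
    unfold divProd
    rw [← Finset.mul_prod_erase _ _ hr, one_mul]; ring

lemma pi_div_notMem {r : ℕ} (hr : r ∈ Finset.Icc 1 (p - 1)) : (1 - I) * (r : ℕ) / π ∉ Lat := by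
  rw [h.div_mem_Lat_iff (nat_mem_O4 r)]
  intro hc
  have := h.prime.two_le
  rw [Finset.mem_Icc] at hr
  have := h.nat_cong_unique (r := r) (s := 0) (by omega) (by omega) (by simpa using hc)
  omega

lemma prod_range_p (f : ℕ → ℂ) :
    ∏ r ∈ Finset.range p, f r = f 0 * ∏ r ∈ Finset.Icc 1 (p - 1), f r := by
  have h2 := h.prime.two_le
  have : Finset.range p = insert 0 (Finset.Icc 1 (p - 1)) := by
    ext r; simp only [Finset.mem_range, Finset.mem_insert, Finset.mem_Icc]; omega
  rw [this, Finset.prod_insert (by simp)]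

lemma tendsto_divProd_zero : Tendsto (divProd p π) (𝓝[≠] 0)
    (𝓝 (π * c0 * ∏ r ∈ Finset.Icc 1 (p - 1), EF ((1 - I) * (r : ℕ) / π))) := by
  have h0 := h.ne_zero
  have t1 := tendsto_prod_EF (s := Finset.Icc 1 (p - 1)) (c := 0)
    (fun r hr => by rw [zero_add]; exact h.pi_div_notMem hr)
  have t2 := tendsto_EF_T0_div.comp (f := fun z => π * z)
    (by simpa using tendsto_mul_punctured 0 π h0)
  have t3 := ((t2.const_mul π).mul tendsto_mul_EF).mul t1
  simp only [zero_add, mul_one] at t3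
  refine t3.congr' ?_
  filter_upwards [self_mem_nhdsWithin] with z hz
  have hz : z ≠ 0 := hz
  unfold divProd
  rw [h.prod_range_p]
  simp only [Function.comp, Nat.cast_zero, mul_zero, zero_div, add_zero]
  field_simp

lemma EF_pi_half : EF (π * (1 / 2) + T0) = EF (1 / 2 + T0) := by
  obtain ⟨l, hl⟩ := h.even
  obtain ⟨k, hk⟩ := h.primary
  have ha : a = 2 * (2 * k - l) + 1 := by omega
  have := EF_add_lat (1 / 2 + T0) (2 * k - l) l
  rw [show π * (1 / 2) + T0 = 1 / 2 + T0 + (((2 * k - l : ℤ) : ℂ) + (l : ℂ) * I) by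
    rw [h.eq, hl, ha]; push_cast; ring, this, show 2 * k - l + l = 2 * k by ring, zpow_mul]
  norm_num

lemma prod_EF_half {S : Finset ℂ} (hS : IsQuarterSet π S) :
    ∏ r ∈ Finset.Icc 1 (p - 1), EF (1 / 2 + (1 - I) * (r : ℕ) / π) = (varpi : ℂ) ^ (p - 1) := by
  have := h.prod_quarter hS (fun ν => EF (1 / 2 + (1 - I) * ν / π))
    (fun x _ y _ hc => h.EF_congr _ hc)
  rw [this]
  have hall : ∀ ν ∈ S, EF (1 / 2 + (1 - I) * ν / π) * EF (1 / 2 + (1 - I) * -ν / π) *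
      (EF (1 / 2 + (1 - I) * (I * ν) / π) * EF (1 / 2 + (1 - I) * (I * -ν) / π)) =
      (varpi : ℂ) ^ 4 := by
    intro ν hν
    have hO := (hS.1 ν hν).1
    have e1 := EF_half_mul (h.half_add_div_notMem hO) (h.half_add_div_add_T0_notMem hO)
    have e2 := EF_half_mul (h.half_add_div_notMem (O4.neg_mem hO))
      (h.half_add_div_add_T0_notMem (O4.neg_mem hO))
    rw [show I * ((1 - I) * ν / π) = (1 - I) * (I * ν) / π by ring] at e1
    rw [show I * ((1 - I) * -ν / π) = (1 - I) * (I * -ν) / π by ring] at e2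
    calc _ = (EF (1 / 2 + (1 - I) * ν / π) * EF (1 / 2 + (1 - I) * (I * ν) / π)) *
          (EF (1 / 2 + (1 - I) * -ν / π) * EF (1 / 2 + (1 - I) * (I * -ν) / π)) := by ring
      _ = _ := by rw [e1, e2]; linear_combination c0 ^ 2 * I_sq - c0_sq
  rw [Finset.prod_congr rfl hall, Finset.prod_const, ← pow_mul]
  congr 1
  have := h.card_quarter hS
  omega

lemma prod_EF {S : Finset ℂ} (hS : IsQuarterSet π S) :
    π * ∏ r ∈ Finset.Icc 1 (p - 1), EF ((1 - I) * (r : ℕ) / π) = (varpi : ℂ) ^ (p - 1) := by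
  obtain ⟨C, hC, -⟩ := exists_const_of_removable h.removable_divProd h.divProd_add_one
    h.divProd_add_I norm_one norm_one
  have e1 : π * c0 * ∏ r ∈ Finset.Icc 1 (p - 1), EF ((1 - I) * (r : ℕ) / π) = C := by
    refine tendsto_nhds_unique h.tendsto_divProd_zero (tendsto_const_nhds.congr' ?_)
    filter_upwards [h.eventually_differentiableAt_divProd 0] with z hz
    exact (hC z hz.continuousAt).symm
  have z1 : (1 / 2 : ℂ) ∉ Lat := by simpa using h.half_add_div_notMem O4.zero_mem
  have z2 : (1 / 2 : ℂ) + T0 ∉ Lat := by simpa using h.half_add_div_add_T0_notMem O4.zero_mem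
  have e2 : divProd p π (1 / 2) = C := by
    refine hC _ (differentiableAt_divProd (fun r _ => h.half_add_div_notMem (nat_mem_O4 r))
      fun hl => z2 ?_).continuousAt
    obtain ⟨l, hl2⟩ := h.even
    obtain ⟨k, hk⟩ := h.primary
    have ha : a = 2 * (2 * k - l) + 1 := by omega
    have := sub_mem_Lat hl ⟨2 * k - l, l, rfl⟩
    convert this using 1
    rw [h.eq, hl2, ha]; push_cast; ring
  have e3 : divProd p π (1 / 2) = c0 * (varpi : ℂ) ^ (p - 1) := by
    unfold divProd
    rw [h.EF_pi_half, h.prod_range_p, h.prod_EF_half hS, ← EF_mul_EF_add_T0 z1 z2]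
    simp only [Nat.cast_zero, mul_zero, zero_div, add_zero]; ring
  refine mul_left_cancel₀ c0_ne_zero ?_
  rw [← e3, e2, ← e1]; ring

/-- The product of the lemniscatic sine over the nonzero `π`-division points is `π`. -/
theorem prod_sF {S : Finset ℂ} (hS : IsQuarterSet π S) :
    ∏ r ∈ Finset.Icc 1 (p - 1), sF ((1 - I) * (r : ℕ) / π) = π := by
  have h1 := h.prod_EF hS
  have h2 : (varpi : ℂ) ^ (p - 1) ≠ 0 := pow_ne_zero _ varpi_ne_zero
  rw [Finset.prod_congr rfl fun r _ => sF_eq _, Finset.prod_div_distrib, Finset.prod_const,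
    Nat.card_Icc, show p - 1 + 1 - 1 = p - 1 by omega, ← h1]
  rw [← h1] at h2
  have h3 := right_ne_zero_of_mul h2
  field_simp

end Data

end

section

open Filter Topology

lemma hasSum_geometric_interchange {x : ℂ} (hx : ‖x‖ < 1) {q : ℝ} (hq0 : 0 ≤ q) (hq1 : q < 1) :
    ∃ D, HasSum (fun n : ℕ => (1 - x * ((q : ℂ) ^ 2) ^ n)⁻¹ * (-(q : ℂ)) ^ n) D ∧
      HasSum (fun k : ℕ => x ^ k * (1 + (q : ℂ) ^ (2 * k + 1))⁻¹) D := by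
  set f : ℕ × ℕ → ℂ := fun z => x ^ z.2 * (-(q : ℂ) ^ (2 * z.2 + 1)) ^ z.1 with hf
  have hs : Summable f := by
    have h1 : Summable fun n : ℕ => q ^ n := summable_geometric_of_lt_one hq0 hq1
    have h2 : Summable fun n : ℕ => ‖x‖ ^ n := summable_geometric_of_lt_one (norm_nonneg _) hx
    have h3 := h1.mul_of_nonneg h2 (fun n => pow_nonneg hq0 n) (fun n => pow_nonneg (norm_nonneg _) n)
    refine Summable.of_norm_bounded h3 fun z => ?_
    rw [hf]
    simp only [norm_mul, norm_pow, norm_neg, Complex.norm_real, Real.norm_of_nonneg hq0]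
    rw [mul_comm]
    refine mul_le_mul_of_nonneg_right ?_ (pow_nonneg (norm_nonneg _) _)
    refine pow_le_pow_left₀ (pow_nonneg hq0 _) ?_ _
    exact pow_le_of_le_one hq0 hq1.le (by omega)
  have hn : ‖(q : ℂ)‖ = q := by rw [Complex.norm_real, Real.norm_of_nonneg hq0]
  refine ⟨∑' z, f z, hs.hasSum.prod_fiberwise fun n => ?_,
    ((Equiv.prodComm ℕ ℕ).hasSum_iff.2 hs.hasSum).prod_fiberwise fun k => ?_⟩
  · have hl : ‖x * ((q : ℂ) ^ 2) ^ n‖ < 1 := by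
      rw [norm_mul, norm_pow, norm_pow, hn]
      exact mul_lt_one_of_nonneg_of_lt_one_left (norm_nonneg _) hx
        (pow_le_one₀ (by positivity) (pow_le_one₀ hq0 hq1.le))
    refine ((hasSum_geometric_of_norm_lt_one hl).mul_right ((-(q : ℂ)) ^ n)).congr_fun ?_
    intro k
    rw [hf]; simp only
    rw [neg_pow, neg_pow (q : ℂ)]; ring
  · have hl : ‖-(q : ℂ) ^ (2 * k + 1)‖ < 1 := by
      rw [norm_neg, norm_pow, hn]
      exact pow_lt_one₀ hq0 hq1 (by omega)
    have := (hasSum_geometric_of_norm_lt_one hl).mul_left (x ^ k)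
    rwa [sub_neg_eq_add] at this

/-- The general term of the Fourier expansion of `EF` in the upper half plane. -/
def fourierTerm (v : ℂ) (k : ℕ) : ℂ :=
  -(2 * Real.pi * I) * exp (Real.pi * I * v) *
    (exp (Real.pi * I * v) ^ 2) ^ k * (1 + ((Real.exp (-Real.pi) : ℝ) : ℂ) ^ (2 * k + 1))⁻¹

lemma norm_exp_sq_lt_one {v : ℂ} (hv : 0 < v.im) : ‖exp (Real.pi * I * v) ^ 2‖ < 1 := by
  rw [norm_pow, Complex.norm_exp]
  refine pow_lt_one₀ (Real.exp_pos _).le ?_ two_ne_zero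
  rw [Real.exp_lt_one_iff]
  simp
  positivity

lemma gK_half_add (v : ℂ) (n : ℕ) :
    (-1) ^ n * gK (1 / 2) (v + n * I) = -(2 * Real.pi * I) * exp (Real.pi * I * v) *
      ((1 - exp (Real.pi * I * v) ^ 2 * (((Real.exp (-Real.pi) : ℝ) : ℂ) ^ 2) ^ n)⁻¹ *
        (-((Real.exp (-Real.pi) : ℝ) : ℂ)) ^ n) := by
  have e1 : exp (2 * Real.pi * I * ((1 / 2 : ℝ) : ℂ) * (v + n * I)) =
      exp (Real.pi * I * v) * ((Real.exp (-Real.pi) : ℝ) : ℂ) ^ n := by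
    push_cast
    rw [← exp_nat_mul, ← exp_add]
    congr 1; linear_combination (Real.pi * n : ℂ) * I_sq
  have e2 : exp (2 * Real.pi * I * (v + n * I)) =
      exp (Real.pi * I * v) ^ 2 * (((Real.exp (-Real.pi) : ℝ) : ℂ) ^ 2) ^ n := by
    push_cast
    rw [← pow_mul, ← exp_nat_mul, ← exp_nat_mul, ← exp_add]
    congr 1; push_cast; linear_combination (2 * Real.pi * n : ℂ) * I_sq
  unfold gK
  rw [e1, e2, neg_pow (((Real.exp (-Real.pi) : ℝ) : ℂ)),
    ← neg_sub (1 : ℂ) (exp (Real.pi * I * v) ^ 2 * _), div_neg, div_eq_mul_inv]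
  ring

lemma exists_hasSum_fourierTerm {v : ℂ} (hv : 0 < v.im) :
    ∃ D, HasSum (fun n : ℕ => (-1) ^ n * gK (1 / 2) (v + n * I)) D ∧ HasSum (fourierTerm v) D := by
  obtain ⟨D, h1, h2⟩ := hasSum_geometric_interchange (norm_exp_sq_lt_one hv)
    (Real.exp_pos (-Real.pi)).le (Real.exp_lt_one_iff.2 (neg_lt_zero.2 Real.pi_pos))
  refine ⟨_, (h1.mul_left (-(2 * Real.pi * I) * exp (Real.pi * I * v))).congr_fun fun n => ?_,
    (h2.mul_left (-(2 * Real.pi * I) * exp (Real.pi * I * v))).congr_fun fun k => ?_⟩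
  · rw [gK_half_add]
  · unfold fourierTerm; ring

lemma exp_T0_add (n : ℕ) : exp (2 * Real.pi * I * (T0 + n * I)) =
    -((Real.exp (-Real.pi) : ℝ) : ℂ) ^ (2 * n + 1) := by
  push_cast
  rw [← exp_nat_mul, show 2 * Real.pi * I * (T0 + n * I) =
    Real.pi * I + ((2 * n + 1 : ℕ) : ℂ) * -Real.pi by
      unfold T0; push_cast; linear_combination (Real.pi + 2 * Real.pi * n : ℂ) * I_sq,
    exp_add, exp_pi_mul_I]
  push_cast; ring

lemma exp_T0_sub (n : ℕ) : exp (2 * Real.pi * I * (T0 + ((-(n + 1) : ℤ) : ℂ) * I)) =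
    -(((Real.exp (-Real.pi) : ℝ) : ℂ) ^ (2 * n + 1))⁻¹ := by
  push_cast
  rw [← exp_nat_mul, ← exp_neg, show 2 * Real.pi * I * (T0 + (-(n + 1)) * I) =
    Real.pi * I + -(((2 * n + 1 : ℕ) : ℂ) * -Real.pi) by
      unfold T0; push_cast; linear_combination (-Real.pi - 2 * Real.pi * n : ℂ) * I_sq,
    exp_add, exp_pi_mul_I]
  push_cast; ring

lemma KF_term_nat (α β : ℝ) (n : ℕ) :
    exp (-(2 * Real.pi * I * α * ((n : ℤ) : ℂ))) * gK β (T0 + ((n : ℤ) : ℂ) * I) =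
      exp (Real.pi * I * (α + β)) * fourierTerm (I * β - α) n := by
  unfold gK fourierTerm
  push_cast
  have e := exp_T0_add n
  push_cast at e
  rw [e, ← neg_add', div_neg, div_eq_mul_inv, add_comm (_ ^ (2 * n + 1)) (1 : ℂ)]
  have e2 : exp (-(2 * Real.pi * I * α * n)) * exp (2 * Real.pi * I * β * (T0 + n * I)) =
      exp (Real.pi * I * (α + β)) * exp (Real.pi * I * (I * β - α)) *
        (exp (Real.pi * I * (I * β - α)) ^ 2) ^ n := by
    rw [← pow_mul, ← exp_nat_mul, ← exp_add, ← exp_add, ← exp_add]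
    congr 1; unfold T0; push_cast; ring
  linear_combination (-(2 * Real.pi * I) *
    (1 + exp (-(Real.pi : ℂ)) ^ (2 * n + 1))⁻¹) * e2

lemma KF_term_neg (α β : ℝ) (n : ℕ) :
    exp (-(2 * Real.pi * I * α * ((-(n + 1) : ℤ) : ℂ))) * gK β (T0 + ((-(n + 1) : ℤ) : ℂ) * I) =
      exp (Real.pi * I * (α + β)) * fourierTerm (I - (I * β - α)) n := by
  unfold gK fourierTerm
  rw [exp_T0_sub]
  set q : ℂ := ((Real.exp (-Real.pi) : ℝ) : ℂ) with hq
  have hq0 : q ^ (2 * n + 1) ≠ 0 := pow_ne_zero _ (by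
    rw [hq]; exact_mod_cast (Real.exp_pos _).ne')
  have hq1 : 1 + q ^ (2 * n + 1) ≠ 0 := by
    rw [hq]
    have : 0 < 1 + (Real.exp (-Real.pi)) ^ (2 * n + 1) := by positivity
    exact_mod_cast this.ne'
  have e3 : (-(q ^ (2 * n + 1))⁻¹ - 1)⁻¹ = -(q ^ (2 * n + 1) * (1 + q ^ (2 * n + 1))⁻¹) := by
    have : -(q ^ (2 * n + 1))⁻¹ - 1 = -((1 + q ^ (2 * n + 1)) * (q ^ (2 * n + 1))⁻¹) := by
      field_simp; ring
    rw [this, inv_neg, mul_inv, inv_inv]; ring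
  rw [div_eq_mul_inv, e3]
  have e2 : exp (-(2 * Real.pi * I * α * ((-(n + 1) : ℤ) : ℂ))) *
      exp (2 * Real.pi * I * β * (T0 + ((-(n + 1) : ℤ) : ℂ) * I)) * q ^ (2 * n + 1) =
      exp (Real.pi * I * (α + β)) * exp (Real.pi * I * (I - (I * β - α))) *
        (exp (Real.pi * I * (I - (I * β - α))) ^ 2) ^ n := by
    rw [hq]; push_cast
    rw [← pow_mul, ← exp_nat_mul, ← exp_nat_mul, ← exp_add, ← exp_add, ← exp_add, ← exp_add]
    congr 1; unfold T0; push_cast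
    linear_combination (-(Real.pi : ℂ) * (2 * n + 1)) * I_sq
  linear_combination (-(2 * Real.pi * I) * (1 + q ^ (2 * n + 1))⁻¹) * e2

/-- Reciprocity between the argument and the characteristics of the Kronecker function. -/
theorem KF_T0 {α β : ℝ} (h0 : 0 < β) (h1 : β < 1) :
    KF α β T0 = exp (Real.pi * I * (α + β)) * EF (I * β - α) := by
  set u : ℂ := I * β - α with hu
  obtain ⟨D₁, a1, b1⟩ := exists_hasSum_fourierTerm (v := u) (by simp [hu, h0])
  obtain ⟨D₂, a2, b2⟩ := exists_hasSum_fourierTerm (v := I - u) (by simp [hu, h1])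
  have hE : EF u = D₁ + D₂ := by
    rw [EF_eq]
    refine HasSum.tsum_eq (HasSum.of_nat_of_neg_add_one ?_ ?_)
    · simpa using a1
    · refine a2.congr_fun fun n => ?_
      have e := gK_half_neg (I - u + n * I)
      rw [show u + ((-((n : ℤ) + 1) : ℤ) : ℂ) * I = -(I - u + n * I) by push_cast; ring, e,
        zpow_neg, ← inv_zpow, show (-1 : ℂ)⁻¹ = -1 by norm_num, zpow_add_one₀ (by norm_num), zpow_natCast]
      ring
  rw [hE, mul_add]
  refine HasSum.tsum_eq (HasSum.of_nat_of_neg_add_one ?_ ?_)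
  · exact (b1.mul_left _).congr_fun fun n => KF_term_nat α β n
  · exact (b2.mul_left _).congr_fun fun n => KF_term_neg α β n

end

section

open Filter Topology

/-- The additive character `t ↦ e^{2πit/p}` on the integers. -/
def ee (p : ℕ) (t : ℤ) : ℂ := exp (2 * Real.pi * I * t / p)

lemma ee_add (p : ℕ) (s t : ℤ) : ee p (s + t) = ee p s * ee p t := by
  unfold ee; rw [← exp_add]; congr 1; push_cast; ring

lemma ee_mul_self {p : ℕ} (hp : p ≠ 0) (t : ℤ) : ee p (p * t) = 1 := by
  unfold ee
  have : (p : ℂ) ≠ 0 := by exact_mod_cast hp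
  rw [show 2 * Real.pi * I * ((p * t : ℤ) : ℂ) / p = t * (2 * Real.pi * I) by
    push_cast; field_simp, exp_int_mul_two_pi_mul_I]

lemma ee_congr {p : ℕ} (hp : p ≠ 0) {s t : ℤ} (h : (p : ℤ) ∣ s - t) : ee p s = ee p t := by
  obtain ⟨k, hk⟩ := h
  rw [show s = t + p * k by omega, ee_add, ee_mul_self hp, mul_one]

lemma ee_zero (p : ℕ) : ee p 0 = 1 := by simp [ee]

lemma sum_range_add_int {M : Type*} [AddCommGroup M] {p : ℕ} {g : ℤ → M} (hg : ∀ t, g (t + p) = g t)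
    (c : ℤ) : ∑ r ∈ Finset.range p, g ((r : ℕ) + c) = ∑ r ∈ Finset.range p, g (r : ℕ) := by
  have step : ∀ c : ℤ, ∑ r ∈ Finset.range p, g ((r : ℕ) + (c + 1)) =
      ∑ r ∈ Finset.range p, g ((r : ℕ) + c) := by
    intro c
    have h1 := Finset.sum_range_succ (fun r : ℕ => g ((r : ℤ) + c)) p
    rw [Finset.sum_range_succ'] at h1
    rw [show (p : ℤ) + c = ((0 : ℕ) : ℤ) + c + p by push_cast; ring, hg] at h1
    rw [← add_right_cancel h1]
    refine Finset.sum_congr rfl fun r _ => ?_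
    congr 1; push_cast; ring
  induction c using Int.induction_on with
  | zero => simp
  | succ k ih => rw [step, ih]
  | pred k ih => rw [← step, sub_add_cancel, ih]

/-- The twisted sum over `π`-division points of the translates of `EF`. -/
def twistSum (p : ℕ) (π : ℂ) (B : ℤ) (w : ℂ) : ℂ :=
  ∑ r ∈ Finset.range p, ee p (B * (r : ℕ)) * EF (w / π + (1 - I) * (r : ℕ) / π)

namespace Data

variable {p : ℕ} {a b : ℤ} {π : ℂ} (h : Data p a b π)
include h

lemma twistSum_add (B k M N : ℤ) (hMN : Odd (M + N)) (w : ℂ) :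
    twistSum p π B (w + ((1 - I) * k + π * (M + N * I))) =
      -ee p (-(B * k)) * twistSum p π B w := by
  have h0 := h.ne_zero
  have hp := h.prime.ne_zero
  unfold twistSum
  have e1 : ∀ r ∈ Finset.range p,
      ee p (B * (r : ℕ)) * EF ((w + ((1 - I) * k + π * (M + N * I))) / π + (1 - I) * (r : ℕ) / π) =
      -ee p (-(B * k)) * (ee p (B * ((r : ℕ) + k)) *
        EF (w / π + (1 - I) * (((r : ℕ) + k : ℤ) : ℂ) / π)) := by
    intro r _
    rw [show (w + ((1 - I) * k + π * (M + N * I))) / π + (1 - I) * (r : ℕ) / π =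
      w / π + (1 - I) * (((r : ℕ) + k : ℤ) : ℂ) / π + (M + N * I) by
        push_cast; field_simp; ring, EF_add_lat, hMN.neg_one_zpow,
      show B * (r : ℕ) = -(B * k) + B * ((r : ℕ) + k) by ring, ee_add]
    ring
  rw [Finset.sum_congr rfl e1, ← Finset.mul_sum]
  congr 1
  refine sum_range_add_int (g := fun t : ℤ => ee p (B * t) * EF (w / π + (1 - I) * (t : ℂ) / π))
    (fun t => ?_) k
  rw [mul_add B, mul_comm B p, ee_add, ee_mul_self hp, mul_one]
  congr 1
  refine h.EF_congr _ (h.gcong_int.2 ?_)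
  simp

lemma not_dvd_add : ¬ (p : ℤ) ∣ a + b := by
  intro hd
  have h1 : (p : ℤ) ∣ 2 * (b * b) := by
    have : 2 * (b * b) = p - (a + b) * (a - b) := by rw [h.norm]; ring
    rw [this]
    exact dvd_sub (dvd_refl _) (hd.mul_right _)
  have hpp := h.prime_int
  rcases hpp.dvd_or_dvd h1 with h2 | h2
  · have := Int.le_of_dvd (by norm_num) h2
    have := h.mod4
    have := h.prime.two_le
    omega
  · rcases hpp.dvd_or_dvd h2 with h3 | h3 <;> exact h.not_dvd_b h3

lemma exists_bezout : ∃ x y : ℤ, (a + b) * x + p * y = 1 := by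
  have := (Int.isCoprime_iff_gcd_eq_one).2 (Int.isCoprime_iff_gcd_eq_one.1
    ((h.prime_int.coprime_iff_not_dvd).2 h.not_dvd_add))
  obtain ⟨u, v, e⟩ := this
  exact ⟨v, u, by linarith⟩

lemma differentiableAt_twistSum (B : ℤ) {v : ℂ} (hv : v ∉ Lat) :
    DifferentiableAt ℂ (twistSum p π B) v := by
  have h0 := h.ne_zero
  unfold twistSum
  refine DifferentiableAt.fun_sum fun r _ => DifferentiableAt.const_mul ?_ _
  have := differentiableAt_EF_affine (k := π⁻¹) (w := (1 - I) * (r : ℕ) / π) (z := v) (fun hl => hv (by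
    have h1 := sub_mem_Lat (mul_mem_Lat (mem_O4_iff_Lat.1 h.mem) hl)
      (mul_mem_Lat one_sub_I_mem (mem_O4_iff_Lat.1 (nat_mem_O4 r)))
    rwa [show π * (π⁻¹ * v + (1 - I) * (r : ℕ) / π) - (1 - I) * r = v by field_simp; ring] at h1))
  refine this.congr_of_eventuallyEq (Eventually.of_forall fun z => ?_)
  dsimp only
  congr 2
  field_simp

lemma tendsto_twistSum (B : ℤ) : Tendsto (fun w => w * twistSum p π B w) (𝓝[≠] 0) (𝓝 π) := by
  have h0 := h.ne_zero
  have t0 : Tendsto (fun w => w * EF (w / π)) (𝓝[≠] 0) (𝓝 π) := by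
    have t := (tendsto_mul_EF.comp (f := fun z => π⁻¹ * z)
      (by simpa using tendsto_mul_punctured 0 π⁻¹ (inv_ne_zero h0))).const_mul π
    rw [mul_one] at t
    refine t.congr fun z => ?_
    simp only [Function.comp]
    rw [show π⁻¹ * z = z / π by field_simp]; field_simp
  have t1 : ∀ r ∈ Finset.Icc 1 (p - 1), Tendsto
      (fun w => w * (ee p (B * (r : ℕ)) * EF (w / π + (1 - I) * (r : ℕ) / π))) (𝓝[≠] 0) (𝓝 0) := by
    intro r hr
    have hd := (differentiableAt_EF_affine (k := π⁻¹) (w := (1 - I) * (r : ℕ) / π) (z := 0)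
      (by simpa using h.pi_div_notMem hr)).continuousAt
    have hc : ContinuousAt (fun w => w * (ee p (B * (r : ℕ)) *
        EF (π⁻¹ * w + (1 - I) * (r : ℕ) / π))) 0 := by fun_prop
    have := hc.tendsto.mono_left (nhdsWithin_le_nhds (s := {0}ᶜ))
    rw [zero_mul] at this
    refine this.congr fun w => ?_
    rw [show π⁻¹ * w = w / π by field_simp]
  have t2 := t0.add (tendsto_finsetSum (Finset.Icc 1 (p - 1)) t1)
  rw [Finset.sum_const_zero, add_zero] at t2
  refine t2.congr fun w => ?_
  unfold twistSum
  have h2 := h.prime.two_le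
  have : Finset.range p = insert 0 (Finset.Icc 1 (p - 1)) := by
    ext r; simp only [Finset.mem_range, Finset.mem_insert, Finset.mem_Icc]; omega
  rw [this, Finset.sum_insert (by simp), mul_add, Finset.mul_sum]
  simp [ee_zero]

lemma pi_T0 : ∃ M N : ℤ, 2 * M + 1 = a - b ∧ 2 * N + 1 = a + b ∧ π * T0 = T0 + M * 1 + N * I := by
  have h1 := h.odd
  obtain ⟨l, hl⟩ := h.even
  obtain ⟨k, hk⟩ : ∃ k, a = 2 * k + 1 := ⟨(a - 1) / 2, by omega⟩
  refine ⟨k - l, k + l, by omega, by omega, ?_⟩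
  rw [h.eq, hl, hk]; unfold T0; push_cast
  linear_combination (l : ℂ) * I_sq

lemma twistSum_eq {B k₁ k₂ m l x y : ℤ} (hxy : (a + b) * x + p * y = 1)
    (hk₁ : k₁ = b * x) (hk₂ : k₂ = -a * x)
    (hm : (p : ℤ) ∣ m - B * k₁) (hl : (p : ℤ) ∣ l - B * k₂) (hm1 : -(p : ℤ) < 2 * m)
    (hm2 : 2 * m < p) {v : ℂ} (hv : v ∉ Lat) :
    twistSum p π B v = π * KF (1 / 2 - l / p) (1 / 2 - m / p) v := by
  have hp0 : (0 : ℝ) < p := by exact_mod_cast h.prime.pos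
  have hpc := h.p_ne_zero
  have hβ0 : (0 : ℝ) < 1 / 2 - m / p := by
    have : (2 * m : ℝ) < p := by exact_mod_cast hm2
    rw [sub_pos, div_lt_div_iff₀ hp0 two_pos]; linarith
  have hβ1 : (1 / 2 - m / p : ℝ) < 1 := by
    have : -(p : ℝ) < 2 * m := by exact_mod_cast hm1
    have h2 : -(1 / 2 : ℝ) < m / p := by rw [lt_div_iff₀ hp0]; linarith
    linarith
  have hmul : ∀ t k : ℤ, (p : ℤ) ∣ t - B * k →
      exp (2 * Real.pi * I * ((1 / 2 - t / p : ℝ) : ℂ)) = -ee p (-(B * k)) := by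
    intro t k hk
    rw [← ee_congr h.prime.ne_zero (s := -t) (t := -(B * k)) (by
      rw [show -t - -(B * k) = -(t - B * k) by ring]; exact hk.neg_right)]
    unfold ee
    rw [show 2 * Real.pi * I * ((1 / 2 - t / p : ℝ) : ℂ) =
      Real.pi * I + 2 * Real.pi * I * ((-t : ℤ) : ℂ) / p by push_cast; field_simp; ring, exp_add,
      exp_pi_mul_I]
    ring
  have hpar : Odd (x + y) := by
    have h1 := h.odd
    have h2 := h.even
    have h3 := h.odd_p
    by_contra hc
    rw [Int.not_odd_iff_even] at hc
    have e : Even ((a + b) * x + p * y) := by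
      have o1 := h.odd_add
      have o2 : Odd (p : ℤ) := by exact_mod_cast h3
      rw [Int.even_add, Int.even_mul, Int.even_mul] at *
      simp only [Int.not_even_iff_odd.2 o1, Int.not_even_iff_odd.2 o2, false_or]
      exact hc
    rw [hxy] at e
    exact absurd e (by decide)
  have hnorm : (p : ℂ) = a * a + b * b := by
    have := h.norm
    have h2 : (p : ℂ) = ((a ^ 2 + b ^ 2 : ℤ) : ℂ) := by rw [← this]; simp
    rw [h2]; push_cast; ring
  have hxyc : ((a : ℂ) + b) * x + p * y = 1 := by exact_mod_cast hxy
  have H1 : ∀ w, twistSum p π B (w + 1) =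
      exp (2 * Real.pi * I * ((1 / 2 - m / p : ℝ) : ℂ)) * twistSum p π B w := by
    intro w
    rw [hmul m k₁ hm, ← h.twistSum_add B k₁ (x + a * y) (-(b * y)) ?_ w]
    · congr 2
      rw [h.eq, hk₁]; push_cast
      linear_combination -hxyc + y * hnorm + (b * b * y : ℂ) * I_sq
    · have h1 := h.odd
      have h2 := h.even
      have ha : Odd a := Int.odd_iff.2 h1
      have hb : Even b := even_iff_two_dvd.2 h2
      rw [← Int.not_even_iff_odd] at hpar ha ⊢
      simp only [Int.even_add, even_neg, Int.even_mul] at hpar ⊢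
      tauto
  have HI : ∀ w, twistSum p π B (w + I) =
      exp (2 * Real.pi * I * ((1 / 2 - l / p : ℝ) : ℂ)) * twistSum p π B w := by
    intro w
    rw [hmul l k₂ hl, ← h.twistSum_add B k₂ (x + b * y) (a * y) ?_ w]
    · congr 2
      rw [h.eq, hk₂]; push_cast
      linear_combination -I * hxyc + I * y * hnorm - (a * b * y : ℂ) * I_sq
    · have h1 := h.odd
      have h2 := h.even
      have ha : Odd a := Int.odd_iff.2 h1
      have hb : Even b := even_iff_two_dvd.2 h2
      rw [← Int.not_even_iff_odd] at hpar ha ⊢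
      simp only [Int.even_add, Int.even_mul] at hpar ⊢
      tauto
  set α : ℝ := 1 / 2 - l / p with hα
  set β : ℝ := 1 / 2 - m / p with hβ
  have hn : ∀ t : ℝ, ‖exp (2 * Real.pi * I * t)‖ = 1 := by
    intro t
    rw [show 2 * Real.pi * I * t = ((2 * Real.pi * t : ℝ) : ℂ) * I by push_cast; ring]
    exact norm_exp_ofReal_mul_I _
  have hd : ∀ w ∉ Lat, DifferentiableAt ℂ (fun w => twistSum p π B w - π * KF α β w) w :=
    fun w hw => (h.differentiableAt_twistSum B hw).sub ((differentiableAt_KF hβ0 hβ1 hw).const_mul π)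
  obtain ⟨g, hg, hg2⟩ := exists_KF_eq_inv_add (α := α) hβ0 hβ1
  have t0 : Tendsto (fun w => w * (twistSum p π B w - π * KF α β w)) (𝓝[≠] 0) (𝓝 0) := by
    have := (h.tendsto_twistSum B).sub ((tendsto_of_inv_add hg hg2).const_mul π)
    rw [mul_one, sub_self] at this
    exact this.congr fun w => by ring
  have H1' : ∀ w, twistSum p π B (w + 1) - π * KF α β (w + 1) =
      exp (2 * Real.pi * I * β) * (twistSum p π B w - π * KF α β w) := fun w => by
    rw [H1, KF_add_one]; ring
  have HI' : ∀ w, twistSum p π B (w + I) - π * KF α β (w + I) =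
      exp (2 * Real.pi * I * α) * (twistSum p π B w - π * KF α β w) := fun w => by
    rw [HI, KF_add_I]; ring
  obtain ⟨C, hC, hC0⟩ := exists_const_of_removable
    (removable_of_lat hd t0 H1' HI' (exp_ne_zero _) (exp_ne_zero _)) H1' HI' (hn _) (hn _)
  have hne : exp (2 * Real.pi * I * β) ≠ 1 := by
    intro he
    obtain ⟨k, hk⟩ := exp_two_pi_I_eq_one he
    have hk' : β = k := by exact_mod_cast hk
    rw [hk'] at hβ0 hβ1
    norm_cast at hβ0 hβ1
    omega
  have := hC v (hd v hv).continuousAt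
  rw [hC0 (Or.inl hne)] at this
  exact sub_eq_zero.1 this

set_option maxHeartbeats 800000 in
/-- The discrete Fourier transform of the values of the lemniscatic sine at `π`-division points. -/
theorem sum_ee_mul_sF (s : ℤ) :
    ∑ r ∈ Finset.range p, ee p (-2 * b * s * (r : ℕ)) * sF ((1 - I) * (r : ℕ) / π) =
      π * sF ((1 - I) * s / (starRingEnd ℂ) π) := by
  obtain ⟨x, y, hxy⟩ := h.exists_bezout
  obtain ⟨M, N, hM, hN, hT⟩ := h.pi_T0
  have h0 := h.ne_zero
  have hpc := h.p_ne_zero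
  have hcc := h.conj_ne_zero
  obtain ⟨j, hj1, hj2⟩ : ∃ j : ℤ, -(p : ℤ) < 2 * ((a - b) * s + p * j) ∧
      2 * ((a - b) * s + p * j) < p := by
    have o := h.odd_p
    obtain ⟨t, ht⟩ := o
    have hpos : (0 : ℤ) < p := by exact_mod_cast h.prime.pos
    refine ⟨-(((a - b) * s + t) / p), ?_⟩
    have e1 := Int.mul_ediv_add_emod ((a - b) * s + t) p
    have e2 := Int.emod_nonneg ((a - b) * s + t) hpos.ne'
    have e3 := Int.emod_lt_of_pos ((a - b) * s + t) hpos
    have ht' : (p : ℤ) = 2 * t + 1 := by exact_mod_cast ht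
    rw [mul_neg]
    constructor <;> linarith
  set m : ℤ := (a - b) * s + p * j with hm
  set l : ℤ := (a + b) * s with hl
  have hTn : π * T0 ∉ Lat := by
    intro hc
    have := sub_mem_Lat hc h.sub_one_T0_mem
    exact T0_notMem (by rwa [show π * T0 - (π - 1) * T0 = T0 by ring] at this)
  have hp0 : (0 : ℝ) < p := by exact_mod_cast h.prime.pos
  have hβ0 : (0 : ℝ) < 1 / 2 - m / p := by
    have : (2 * m : ℝ) < p := by exact_mod_cast hj2
    rw [sub_pos, div_lt_div_iff₀ hp0 two_pos]; linarith
  have hβ1 : (1 / 2 - m / p : ℝ) < 1 := by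
    have : -(p : ℝ) < 2 * m := by exact_mod_cast hj1
    have h2 : -(1 / 2 : ℝ) < m / p := by rw [lt_div_iff₀ hp0]; linarith
    linarith
  have key := h.twistSum_eq (B := -2 * b * s) (m := m) (l := l) hxy rfl rfl
    ⟨s * (x + (a - b) * y) + j, by
      rw [hm]; linear_combination (-(s * (a - b))) * hxy - (s * x) * h.norm⟩
    ⟨s * (x + (a + b) * y), by
      rw [hl]; linear_combination (-(s * (a + b))) * hxy - (s * x) * h.norm⟩ hj1 hj2 hTn
  set α : ℝ := 1 / 2 - l / p with hα
  set β : ℝ := 1 / 2 - m / p with hβ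
  have e1 : KF α β (π * T0) = exp (2 * Real.pi * I * β) ^ M * exp (2 * Real.pi * I * α) ^ N *
      KF α β T0 := by
    rw [hT, quasi_zmultiples (exp_ne_zero _) (KF_add_I α β) N,
      quasi_zmultiples (exp_ne_zero _) (KF_add_one α β) M]
    ring
  have hnorm := h.mul_conj
  have e2 : I * β - α = (1 - I) * s / (starRingEnd ℂ) π + T0 + (((-1 : ℤ) : ℂ) + ((-j : ℤ) : ℂ) * I) := by
    have e3 : (1 - I) * (s : ℂ) / (starRingEnd ℂ) π = (1 - I) * s * π / p := by
      rw [← hnorm]; field_simp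
    rw [e3, h.eq, hα, hβ, hm, hl]; unfold T0; push_cast; field_simp
    ring_nf
    rw [I_sq]; ring
  have e4 : exp (2 * Real.pi * I * β) ^ M * exp (2 * Real.pi * I * α) ^ N *
      exp (Real.pi * I * (α + β)) = (-1) ^ (a - 2 * s - (a - b) * j) := by
    rw [← exp_pi_mul_I, ← exp_int_mul, ← exp_int_mul, ← exp_int_mul, ← exp_add, ← exp_add]
    congr 1
    have hM' : 2 * (M : ℂ) + 1 = a - b := by exact_mod_cast hM
    have hN' : 2 * (N : ℂ) + 1 = a + b := by exact_mod_cast hN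
    have e5 : ((a : ℂ) - b) * β + (a + b) * α = a - 2 * s - (a - b) * j := by
      have hnn : (p : ℂ) = a ^ 2 + b ^ 2 := by exact_mod_cast h.norm
      rw [hα, hβ, hm, hl]; push_cast; field_simp
      rw [hnn]; ring
    push_cast
    linear_combination Real.pi * I * (β * hM' + α * hN' + e5)
  have e6 : twistSum p π (-2 * b * s) (π * T0) = c0 / varpi *
      ∑ r ∈ Finset.range p, ee p (-2 * b * s * (r : ℕ)) * sF ((1 - I) * (r : ℕ) / π) := by
    unfold twistSum
    rw [Finset.mul_sum]
    refine Finset.sum_congr rfl fun r _ => ?_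
    have := c0_ne_zero
    have := varpi_ne_zero
    unfold sF
    rw [mul_div_cancel_left₀ _ h0, add_comm T0]
    field_simp
  rw [e6, e1, KF_T0 hβ0 hβ1, e2, EF_add_lat] at key
  have e7 : (-1 : ℂ) ^ (a - 2 * s - (a - b) * j) * (-1) ^ (-1 + -j) = 1 := by
    rw [← zpow_add₀ (by norm_num)]
    refine Even.neg_one_zpow ?_
    obtain ⟨k, hk⟩ : ∃ k, a = 2 * k + 1 := ⟨(a - 1) / 2, by have := h.odd; omega⟩
    obtain ⟨k', hk'⟩ := h.even
    exact ⟨k - s - k * j + k' * j - j, by rw [hk, hk']; ring⟩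
  have c1 := c0_ne_zero
  have c2 := varpi_ne_zero
  unfold sF at key ⊢
  set Q := ∑ r ∈ Finset.range p, ee p (-2 * b * s * (r : ℕ)) *
    (varpi / c0 * EF ((1 - I) * (r : ℕ) / π + T0))
  set Z := EF ((1 - I) * s / (starRingEnd ℂ) π + T0)
  have : Q = varpi / c0 * (c0 / varpi * Q) := by field_simp
  rw [this, key]
  linear_combination (varpi / c0 * π * (-1) ^ (-1 + -j) * Z) * e4 + (varpi / c0 * π * Z) * e7

end Data

end

section

open Filter Topology

section Residue

variable (V : ValuationSubring ℂ)

/-- The residue map of a valuation subring, extended by zero. -/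
def res (x : ℂ) : IsLocalRing.ResidueField V :=
  open Classical in if h : x ∈ V then IsLocalRing.residue V ⟨x, h⟩ else 0

variable {V}

lemma res_of_mem {x : ℂ} (h : x ∈ V) : res V x = IsLocalRing.residue V ⟨x, h⟩ := dif_pos h

lemma res_add {x y : ℂ} (hx : x ∈ V) (hy : y ∈ V) : res V (x + y) = res V x + res V y := by
  rw [res_of_mem hx, res_of_mem hy, res_of_mem (V.add_mem _ _ hx hy), ← map_add]; rfl

lemma res_mul {x y : ℂ} (hx : x ∈ V) (hy : y ∈ V) : res V (x * y) = res V x * res V y := by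
  rw [res_of_mem hx, res_of_mem hy, res_of_mem (V.mul_mem _ _ hx hy), ← map_mul]; rfl

lemma res_neg {x : ℂ} (hx : x ∈ V) : res V (-x) = -res V x := by
  rw [res_of_mem hx, res_of_mem (V.neg_mem _ hx), ← map_neg]; rfl

lemma res_sub {x y : ℂ} (hx : x ∈ V) (hy : y ∈ V) : res V (x - y) = res V x - res V y := by
  rw [sub_eq_add_neg, res_add hx (V.neg_mem _ hy), res_neg hy, sub_eq_add_neg]

lemma res_one : res V 1 = 1 := by
  rw [res_of_mem V.one_mem, ← map_one (IsLocalRing.residue V)]; rfl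

lemma res_zero : res V 0 = 0 := by
  rw [res_of_mem V.zero_mem, ← map_zero (IsLocalRing.residue V)]; rfl

lemma int_mem_V (k : ℤ) : (k : ℂ) ∈ V := intCast_mem V.toSubring k

lemma nat_mem_V (k : ℕ) : (k : ℂ) ∈ V := natCast_mem V.toSubring k

lemma res_intCast (k : ℤ) : res V (k : ℂ) = k := by
  rw [res_of_mem (int_mem_V k), ← map_intCast (IsLocalRing.residue V)]; rfl

lemma res_natCast (k : ℕ) : res V (k : ℂ) = k := by
  rw [res_of_mem (nat_mem_V k), ← map_natCast (IsLocalRing.residue V)]; rfl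

lemma pow_mem_V {x : ℂ} (hx : x ∈ V) (k : ℕ) : x ^ k ∈ V := V.toSubring.pow_mem hx k

lemma res_pow {x : ℂ} (hx : x ∈ V) (k : ℕ) : res V (x ^ k) = res V x ^ k := by
  induction k with
  | zero => simp [res_one]
  | succ k ih => rw [pow_succ, pow_succ, res_mul (pow_mem_V hx k) hx, ih]

lemma sum_mem_V {ι : Type*} {s : Finset ι} {f : ι → ℂ} (hf : ∀ i ∈ s, f i ∈ V) :
    ∑ i ∈ s, f i ∈ V := sum_mem (S := V.toSubring) hf

lemma prod_mem_V {ι : Type*} {s : Finset ι} {f : ι → ℂ} (hf : ∀ i ∈ s, f i ∈ V) :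
    ∏ i ∈ s, f i ∈ V := prod_mem (S := V.toSubring) hf

lemma res_sum {ι : Type*} {s : Finset ι} {f : ι → ℂ} (hf : ∀ i ∈ s, f i ∈ V) :
    res V (∑ i ∈ s, f i) = ∑ i ∈ s, res V (f i) := by
  classical
  induction s using Finset.induction_on with
  | empty => simp [res_zero]
  | insert i s hi ih =>
    rw [Finset.sum_insert hi, Finset.sum_insert hi, res_add (hf _ (Finset.mem_insert_self _ _))
      (sum_mem_V fun j hj => hf _ (Finset.mem_insert_of_mem hj)),
      ih fun j hj => hf _ (Finset.mem_insert_of_mem hj)]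

lemma res_prod {ι : Type*} {s : Finset ι} {f : ι → ℂ} (hf : ∀ i ∈ s, f i ∈ V) :
    res V (∏ i ∈ s, f i) = ∏ i ∈ s, res V (f i) := by
  classical
  induction s using Finset.induction_on with
  | empty => simp [res_one]
  | insert i s hi ih =>
    rw [Finset.prod_insert hi, Finset.prod_insert hi, res_mul (hf _ (Finset.mem_insert_self _ _))
      (prod_mem_V fun j hj => hf _ (Finset.mem_insert_of_mem hj)),
      ih fun j hj => hf _ (Finset.mem_insert_of_mem hj)]

lemma inv_mem_of_res_ne {x : ℂ} (hr : res V x ≠ 0) : x⁻¹ ∈ V := by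
  by_cases hx : x ∈ V
  · rw [res_of_mem hx, Ne, IsLocalRing.residue_eq_zero_iff, IsLocalRing.mem_maximalIdeal,
      mem_nonunits_iff, not_not] at hr
    obtain ⟨u, hu⟩ := hr
    have h1 : x * (u⁻¹ : Vˣ) = 1 := by
      have := congrArg (fun z : V => (z : ℂ)) u.mul_inv
      rw [hu] at this
      simpa using this
    rw [inv_eq_of_mul_eq_one_right h1]
    exact (u⁻¹ : Vˣ).1.2
  · exact absurd (dif_neg hx) hr

lemma mem_of_res_ne {x : ℂ} (hr : res V x ≠ 0) : x ∈ V := by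
  by_contra hx
  exact hr (dif_neg hx)

lemma res_inv {x : ℂ} (hr : res V x ≠ 0) : res V x⁻¹ = (res V x)⁻¹ := by
  have hx : x ≠ 0 := by rintro rfl; exact hr res_zero
  refine eq_inv_of_mul_eq_one_left ?_
  rw [← res_mul (inv_mem_of_res_ne hr) (mem_of_res_ne hr), inv_mul_cancel₀ hx, res_one]

lemma res_ne_zero_of_inv_mem {x : ℂ} (h0 : x ≠ 0) (hx : x ∈ V) (hi : x⁻¹ ∈ V) : res V x ≠ 0 := by
  intro h
  have := res_mul hx hi
  rw [mul_inv_cancel₀ h0, res_one, h, zero_mul] at this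
  exact one_ne_zero this

lemma mem_of_pow_mem {x : ℂ} {n : ℕ} (hn : n ≠ 0) (h : x ^ n ∈ V) : x ∈ V := by
  by_cases h0 : x = 0
  · rw [h0]; exact V.zero_mem
  rcases V.mem_or_inv_mem x with h1 | h1
  · exact h1
  · obtain ⟨m, rfl⟩ := Nat.exists_eq_succ_of_ne_zero hn
    have := V.mul_mem _ _ h (pow_mem_V h1 m)
    rwa [pow_succ', mul_assoc, ← mul_pow, mul_inv_cancel₀ h0, one_pow, mul_one] at this

end Residue

section Smooth

/-- Functions on `ℤ` all of whose `t`-divided differences up to order `k` are `V`-valued. -/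
def SmoothTo (V : ValuationSubring ℂ) (t : ℂ) : ℕ → (ℤ → ℂ) → Prop
  | 0, f => ∀ r, f r ∈ V
  | k + 1, f => (∀ r, f r ∈ V) ∧ SmoothTo V t k (fun r => (f (r + 1) - f r) / t)

variable {V : ValuationSubring ℂ} {t : ℂ}

lemma SmoothTo.of_succ {k : ℕ} {f : ℤ → ℂ} (h : SmoothTo V t (k + 1) f) : SmoothTo V t k f := by
  induction k generalizing f with
  | zero => exact h.1
  | succ k ih => exact ⟨h.1, ih h.2⟩

lemma SmoothTo.shift {k : ℕ} {f : ℤ → ℂ} (h : SmoothTo V t k f) :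
    SmoothTo V t k (fun r => f (r + 1)) := by
  induction k generalizing f with
  | zero => exact fun r => h (r + 1)
  | succ k ih => exact ⟨fun r => h.1 (r + 1), ih h.2⟩

lemma SmoothTo.add {k : ℕ} {f g : ℤ → ℂ} (hf : SmoothTo V t k f) (hg : SmoothTo V t k g) :
    SmoothTo V t k (fun r => f r + g r) := by
  induction k generalizing f g with
  | zero => exact fun r => V.add_mem _ _ (hf r) (hg r)
  | succ k ih =>
    refine ⟨fun r => V.add_mem _ _ (hf.1 r) (hg.1 r), ?_⟩
    convert ih hf.2 hg.2 using 2 with r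
    ring

lemma SmoothTo.mul {k : ℕ} {f g : ℤ → ℂ} (hf : SmoothTo V t k f) (hg : SmoothTo V t k g) :
    SmoothTo V t k (fun r => f r * g r) := by
  induction k generalizing f g with
  | zero => exact fun r => V.mul_mem _ _ (hf r) (hg r)
  | succ k ih =>
    refine ⟨fun r => V.mul_mem _ _ (hf.1 r) (hg.1 r), ?_⟩
    convert (ih hf.2 hg.of_succ).add (ih hf.of_succ.shift hg.2) using 2 with r
    ring

lemma SmoothTo.const {c : ℂ} (hc : c ∈ V) (k : ℕ) : SmoothTo V t k (fun _ => c) := by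
  induction k generalizing c with
  | zero => exact fun _ => hc
  | succ k ih =>
    refine ⟨fun _ => hc, ?_⟩
    simpa using ih V.zero_mem

variable (V t) in
/-- The ring of functions on `ℤ` with all `t`-divided differences `V`-valued. -/
def smooth : Subring (ℤ → ℂ) where
  carrier := {f | ∀ k, SmoothTo V t k f}
  mul_mem' hf hg k := (hf k).mul (hg k)
  one_mem' k := SmoothTo.const V.one_mem k
  add_mem' hf hg k := (hf k).add (hg k)
  zero_mem' k := SmoothTo.const V.zero_mem k
  neg_mem' {f} hf k := by
    have := (SmoothTo.const (V.neg_mem _ V.one_mem) k).mul (hf k)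
    simp only [neg_one_mul] at this
    exact this

variable (V t) in
/-- The subring of functions with `t`-divided differences up to order `k`. -/
def smoothTo (k : ℕ) : Subring (ℤ → ℂ) where
  carrier := {f | SmoothTo V t k f}
  mul_mem' hf hg := SmoothTo.mul hf hg
  one_mem' := SmoothTo.const V.one_mem k
  add_mem' hf hg := SmoothTo.add hf hg
  zero_mem' := SmoothTo.const V.zero_mem k
  neg_mem' {f} hf := by
    have := (SmoothTo.const (V.neg_mem _ V.one_mem) k).mul hf
    simp only [neg_one_mul] at this
    exact this

lemma const_mem_smooth {c : ℂ} (hc : c ∈ V) : (fun _ => c) ∈ smooth V t :=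
  fun k => SmoothTo.const hc k

lemma diff_mem_smooth {f : ℤ → ℂ} (hf : f ∈ smooth V t) :
    (fun r => (f (r + 1) - f r) / t) ∈ smooth V t := fun k => (hf (k + 1)).2

lemma shift_mem_smooth {f : ℤ → ℂ} (hf : f ∈ smooth V t) : (fun r => f (r + 1)) ∈ smooth V t :=
  fun k => (hf k).shift

lemma SmoothTo.iterate (ht : t ≠ 0) {k : ℕ} {f : ℤ → ℂ} (h : SmoothTo V t k f) :
    ∃ g ∈ V, (fwdDiff 1)^[k] f 0 = t ^ k * g := by
  induction k generalizing f with
  | zero => exact ⟨f 0, h 0, by simp⟩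
  | succ k ih =>
    obtain ⟨g, hg, e⟩ := ih h.2
    refine ⟨g, hg, ?_⟩
    have : fwdDiff 1 f = t • (fun r => (f (r + 1) - f r) / t) := by
      ext r; simp [fwdDiff]; field_simp
    rw [Function.iterate_succ_apply, this, fwdDiff_iter_const_smul, Pi.smul_apply, e, smul_eq_mul]
    ring

/-- The sum of a function over `0, …, p - 1` against the powers of `x`. -/
def charSum (p : ℕ) (x : ℂ) (f : ℤ → ℂ) : ℂ := ∑ r ∈ Finset.range p, x ^ r * f (r : ℕ)

lemma choose_sum_mem {p : ℕ} (hp : p.Prime) {x : ℂ} (hx : x ^ p = 1) (hx1 : x ≠ 1) (ht : t ≠ 0)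
    (htV : t ∈ V) (hxV : x ∈ V) (hxt : t / (x - 1) ∈ V) (hpt : p / t ^ (p - 1) ∈ V) {k : ℕ}
    (hk : k < p) :
    ∃ g ∈ V, ∑ r ∈ Finset.range p, x ^ r * (r.choose k : ℂ) = t ^ (p - 1 - k) * g := by
  have hx0 : x - 1 ≠ 0 := sub_ne_zero.2 hx1
  induction k with
  | zero =>
    refine ⟨0, V.zero_mem, ?_⟩
    simp only [Nat.choose_zero_right, Nat.cast_one, mul_one, mul_zero]
    rw [geom_sum_eq hx1, hx, sub_self, zero_div]
  | succ k ih =>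
    obtain ⟨g, hg, e⟩ := ih (by omega)
    have key : (x - 1) * ∑ r ∈ Finset.range p, x ^ r * (r.choose (k + 1) : ℂ) =
        p.choose (k + 1) - x * ∑ r ∈ Finset.range p, x ^ r * (r.choose k : ℂ) := by
      have h1 := Finset.sum_range_succ (fun r : ℕ => x ^ r * (r.choose (k + 1) : ℂ)) p
      rw [Finset.sum_range_succ', hx] at h1
      simp only [Nat.choose_zero_succ, Nat.cast_zero, mul_zero, add_zero, one_mul] at h1
      have h2 : ∑ r ∈ Finset.range p, x ^ (r + 1) * ((r + 1).choose (k + 1) : ℂ) =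
          x * ∑ r ∈ Finset.range p, x ^ r * (r.choose k : ℂ) +
          x * ∑ r ∈ Finset.range p, x ^ r * (r.choose (k + 1) : ℂ) := by
        rw [Finset.mul_sum, Finset.mul_sum, ← Finset.sum_add_distrib]
        refine Finset.sum_congr rfl fun r _ => ?_
        rw [Nat.choose_succ_succ]; push_cast; ring
      linear_combination h1 - h2
    obtain ⟨q, hq⟩ := hp.dvd_choose_self (by omega : k + 1 ≠ 0) hk
    have e1 : t ^ (p - 1) = t ^ (p - 1 - (k + 1)) * t * t ^ k := by
      rw [mul_assoc, ← pow_succ', ← pow_add]; congr 1; omega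
    have e2 : t ^ (p - 1 - k) = t ^ (p - 1 - (k + 1)) * t := by
      rw [← pow_succ]; congr 1; omega
    refine ⟨t / (x - 1) * (t ^ k * (p / t ^ (p - 1)) * q - x * g), V.mul_mem _ _ hxt
      (V.toSubring.sub_mem (V.mul_mem _ _ (V.mul_mem _ _ (pow_mem_V htV k) hpt) (nat_mem_V q))
        (V.mul_mem _ _ hxV hg)), ?_⟩
    rw [hq, e] at key
    have e3 : (p : ℂ) = t ^ (p - 1) * (p / t ^ (p - 1)) := by
      field_simp
    have e4 : ∑ r ∈ Finset.range p, x ^ r * (r.choose (k + 1) : ℂ) =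
        (((p * q : ℕ) : ℂ) - x * (t ^ (p - 1 - k) * g)) / (x - 1) := by
      rw [← key]; field_simp
    rw [e4, div_eq_iff hx0]
    push_cast
    rw [e3, e2]
    nth_rw 1 [e1]
    field_simp

lemma charSum_mem {p : ℕ} (hp : p.Prime) {x : ℂ} (hx : x ^ p = 1) (hx1 : x ≠ 1) (ht : t ≠ 0)
    (htV : t ∈ V) (hxV : x ∈ V) (hxt : t / (x - 1) ∈ V) (hpt : p / t ^ (p - 1) ∈ V)
    {f : ℤ → ℂ} (hf : f ∈ smooth V t) : charSum p x f / t ^ (p - 1) ∈ V := by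
  have e1 : charSum p x f = ∑ k ∈ Finset.range p, (fwdDiff 1)^[k] f 0 *
      ∑ r ∈ Finset.range p, x ^ r * (r.choose k : ℂ) := by
    unfold charSum
    simp_rw [Finset.mul_sum]
    rw [Finset.sum_comm]
    refine Finset.sum_congr rfl fun r hr => ?_
    have h1 := shift_eq_sum_fwdDiff_iter (1 : ℤ) f r 0
    simp only [nsmul_eq_mul, mul_one, zero_add] at h1
    rw [h1, Finset.mul_sum]
    have hr := Finset.mem_range.1 hr
    rw [← Finset.sum_subset (Finset.range_subset_range.2 (show r + 1 ≤ p by omega))]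
    · exact Finset.sum_congr rfl fun k _ => by ring
    · intro k _ hk
      rw [Nat.choose_eq_zero_of_lt (by rw [Finset.mem_range] at hk; omega)]
      simp
  rw [e1, Finset.sum_div]
  refine sum_mem_V fun k hk => ?_
  have hk := Finset.mem_range.1 hk
  obtain ⟨g, hg, eg⟩ := choose_sum_mem hp hx hx1 ht htV hxV hxt hpt hk
  obtain ⟨g', hg', eg'⟩ := (hf k).iterate ht
  rw [eg, eg', show t ^ (p - 1) = t ^ k * t ^ (p - 1 - k) by rw [← pow_add]; congr 1; omega]
  convert V.mul_mem _ _ hg' hg using 1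
  field_simp

lemma charSum_add (p : ℕ) (x : ℂ) (f g : ℤ → ℂ) :
    charSum p x (f + g) = charSum p x f + charSum p x g := by
  unfold charSum
  rw [← Finset.sum_add_distrib]
  exact Finset.sum_congr rfl fun r _ => by rw [Pi.add_apply]; ring

lemma charSum_smul (p : ℕ) (x c : ℂ) (f : ℤ → ℂ) : charSum p x (c • f) = c * charSum p x f := by
  unfold charSum
  rw [Finset.mul_sum]
  exact Finset.sum_congr rfl fun r _ => by rw [Pi.smul_apply, smul_eq_mul]; ring

lemma charSum_diff {p : ℕ} {x : ℂ} (hx : x ^ p = 1) (hx0 : x ≠ 0) {f : ℤ → ℂ} (hf : f p = f 0) :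
    charSum p x (fun r => (f (r + 1) - f r) / t) = (x⁻¹ - 1) / t * charSum p x f := by
  unfold charSum
  have h1 := Finset.sum_range_succ (fun r : ℕ => x ^ r * f (r : ℤ)) p
  rw [Finset.sum_range_succ', hx] at h1
  simp only [Nat.cast_zero, pow_zero, one_mul] at h1
  rw [hf] at h1
  have h1 := add_right_cancel h1
  have h2 : ∑ r ∈ Finset.range p, x ^ (r + 1) * f ((r + 1 : ℕ) : ℤ) =
      x * ∑ r ∈ Finset.range p, x ^ r * f ((r : ℤ) + 1) := by
    rw [Finset.mul_sum]
    exact Finset.sum_congr rfl fun r _ => by push_cast; ring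
  have h3 : ∑ r ∈ Finset.range p, x ^ r * ((f ((r : ℤ) + 1) - f r) / t) =
      (∑ r ∈ Finset.range p, x ^ r * f ((r : ℤ) + 1) - ∑ r ∈ Finset.range p, x ^ r * f r) / t := by
    rw [← Finset.sum_sub_distrib, Finset.sum_div]
    exact Finset.sum_congr rfl fun r _ => by ring
  rw [h3, ← h1, h2]
  generalize ∑ r ∈ Finset.range p, x ^ r * f ((r : ℤ) + 1) = S
  have : (x⁻¹ - 1) * (x * S) = S - x * S := by
    rw [sub_mul, ← mul_assoc, inv_mul_cancel₀ hx0]; ring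
  rw [div_mul_eq_mul_div, this]

end Smooth

end

section

open Filter Topology

lemma nonunits_res {V : ValuationSubring ℂ} {x : ℂ} (hx : x ∈ V.nonunits) :
    x ∈ V ∧ res V x = 0 := by
  obtain ⟨h1, h2⟩ := V.mem_nonunits_iff_exists_mem_maximalIdeal.1 hx
  refine ⟨h1, ?_⟩
  rw [res_of_mem h1, IsLocalRing.residue_eq_zero_iff]
  exact h2

lemma exists_valuationSubring (R : Subring ℂ) (x : R) (hx : ¬ IsUnit x) :
    ∃ V : ValuationSubring ℂ, (∀ y ∈ R, y ∈ V) ∧ res V x = 0 := by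
  obtain ⟨V, hV, h⟩ := Ideal.image_subset_nonunits_valuationSubring (Ideal.span {x})
    (by rwa [Ne, Ideal.span_singleton_eq_top])
  refine ⟨V, fun y hy => hV hy, (nonunits_res (h ⟨x, ?_, rfl⟩)).2⟩
  exact Ideal.mem_span_singleton_self x

/-- A valuation subring of `ℂ` containing `i`, in whose maximal ideal `π` lies. -/
structure Place (p : ℕ) (a b : ℤ) (π : ℂ) (V : ValuationSubring ℂ) : Prop where
  data : Data p a b π
  I_mem : I ∈ V
  res_pi : res V π = 0

lemma I_mem_O8 : I ∈ O8 := by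
  have h1 : zeta8 ^ 2 = I := by
    rw [zeta8, ← Complex.exp_nat_mul]
    convert Complex.exp_pi_div_two_mul_I using 2
    push_cast; ring
  rw [← h1]
  exact O8.pow_mem (Subring.subset_closure rfl) 2

lemma O4_le_O8 : O4 ≤ O8 := (Subring.closure_le).2 fun x hx => by
  rw [Set.mem_singleton_iff.1 hx]; exact I_mem_O8

lemma exists_place {p : ℕ} {a b : ℤ} {π γ : ℂ} (h : Data p a b π) {S : Finset ℂ}
    (hS : ∀ ν ∈ S, ν ∈ O4) (hγ : IsGamma4 π p S γ) :
    ∃ V : ValuationSubring ℂ, Place p a b π V ∧ γ ∈ V ∧ res V γ = res V (∏ ν ∈ S, ν) := by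
  have key : ∀ V : ValuationSubring ℂ, (∏ ν ∈ S, ν ∈ V) → ∀ P d : ℂ, P ∈ V → d ∈ V →
      res V P = 0 → γ - ∏ ν ∈ S, ν = P * d → γ ∈ V ∧ res V γ = res V (∏ ν ∈ S, ν) := by
    intro V hp P d hP hd h0 e
    have e : γ = ∏ ν ∈ S, ν + P * d := by linear_combination e
    refine ⟨by rw [e]; exact V.add_mem _ _ hp (V.mul_mem _ _ hP hd), ?_⟩
    rw [e, res_add hp (V.mul_mem _ _ hP hd), res_mul hP hd, h0, zero_mul, add_zero]
  have h8 : p % 8 = 5 ∨ p % 8 = 1 := by have := h.mod4; omega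
  rcases h8 with h8 | h8
  · obtain ⟨-, d, hd, e⟩ := hγ.1 h8
    obtain ⟨V, hV, hr⟩ := exists_valuationSubring O4 ⟨π, h.mem⟩ (by
      intro hu
      obtain ⟨v, hv⟩ := hu.exists_right_inv
      refine h.not_cong_one_zero ⟨v, v.2, ?_⟩
      have := congrArg Subtype.val hv
      simp only [Subring.coe_mul, Subring.coe_one] at this
      rw [this, sub_zero])
    exact ⟨V, ⟨h, hV _ I_mem_O4, hr⟩, key V (prod_mem_V fun i hi => hV _ (hS i hi)) π d
      (hV _ h.mem) (hV _ hd) hr e⟩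
  · obtain ⟨-, P, hP, ⟨Q, hQ⟩, d, hd, e⟩ := hγ.2 h8
    obtain ⟨V, hV, hr⟩ := exists_valuationSubring O8 P hP.not_isUnit
    have hr' : res V π = 0 := by
      rw [hQ, res_mul (hV _ P.2) (hV _ Q.2), hr, zero_mul]
    exact ⟨V, ⟨h, hV _ I_mem_O8, hr'⟩, key V
      (prod_mem_V fun i hi => hV _ (O4_le_O8 (hS i hi))) P d (hV _ P.2) (hV _ hd) hr e⟩

namespace Place

variable {p : ℕ} {a b : ℤ} {π : ℂ} {V : ValuationSubring ℂ} (h : Place p a b π V)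
include h

lemma mem_V {x : ℂ} (hx : x ∈ O4) : x ∈ V := by
  obtain ⟨m, n, rfl⟩ := mem_O4.1 hx
  exact V.add_mem _ _ (int_mem_V m) (V.mul_mem _ _ (int_mem_V n) h.I_mem)

lemma pi_mem : π ∈ V := h.mem_V h.data.mem

lemma res_cong {x y : ℂ} (hx : x ∈ O4) (hy : y ∈ O4) (hc : GCong x y π) : res V x = res V y := by
  obtain ⟨d, hd, e⟩ := hc
  rw [← sub_eq_zero, ← res_sub (h.mem_V hx) (h.mem_V hy), e, res_mul h.pi_mem (h.mem_V hd),
    h.res_pi, zero_mul]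

lemma cast_p : ((p : ℕ) : IsLocalRing.ResidueField V) = 0 := by
  rw [← res_natCast, ← h.data.mul_conj, res_mul h.pi_mem (h.mem_V (conj_mem_O4 h.data.mem)),
    h.res_pi, zero_mul]

lemma charP : CharP (IsLocalRing.ResidueField V) p := by
  obtain ⟨q, hq⟩ := CharP.exists (IsLocalRing.ResidueField V)
  have h1 := (CharP.cast_eq_zero_iff _ q p).1 h.cast_p
  rcases (Nat.dvd_prime h.data.prime).1 h1 with h2 | h2
  · exact absurd h2 (CharP.char_ne_one (IsLocalRing.ResidueField V) q)
  · rwa [h2] at hq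

lemma cast_int_eq_zero {r : ℤ} : (r : IsLocalRing.ResidueField V) = 0 ↔ (p : ℤ) ∣ r :=
  have := h.charP
  CharP.intCast_eq_zero_iff _ p r

lemma cast_nat_eq_zero {r : ℕ} : (r : IsLocalRing.ResidueField V) = 0 ↔ p ∣ r :=
  have := h.charP
  CharP.cast_eq_zero_iff _ p r

lemma res_gcoprime {x : ℂ} (hx : x ∈ O4) (hc : GCoprime x π) : res V x ≠ 0 := by
  obtain ⟨u, hu, v, hv, e⟩ := hc
  intro h0
  have := congrArg (res V) e
  rw [res_add (V.mul_mem _ _ (h.mem_V hu) (h.mem_V hx)) (V.mul_mem _ _ (h.mem_V hv) h.pi_mem),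
    res_mul (h.mem_V hu) (h.mem_V hx), res_mul (h.mem_V hv) h.pi_mem, h0, h.res_pi, res_one] at this
  simp at this

lemma res_I : res V I ^ 2 = -1 := by
  rw [← res_pow h.I_mem, I_sq, res_neg V.one_mem, res_one]

lemma a_eq : (a : IsLocalRing.ResidueField V) = -b * res V I := by
  have := h.res_pi
  rw [h.data.eq, res_add (int_mem_V a) (V.mul_mem _ _ (int_mem_V b) h.I_mem),
    res_mul (int_mem_V b) h.I_mem, res_intCast, res_intCast] at this
  linear_combination this

lemma conj_mem : (starRingEnd ℂ) π ∈ V := h.mem_V (conj_mem_O4 h.data.mem)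

lemma res_conj : res V ((starRingEnd ℂ) π) = -2 * b * res V I := by
  rw [h.data.conj_eq, res_sub (int_mem_V a) (V.mul_mem _ _ (int_mem_V b) h.I_mem),
    res_mul (int_mem_V b) h.I_mem, res_intCast, res_intCast, h.a_eq]
  ring

lemma two_ne_zero : (2 : IsLocalRing.ResidueField V) ≠ 0 := by
  have := h.cast_nat_eq_zero (r := 2)
  rw [Nat.cast_ofNat] at this
  rw [Ne, this]
  intro hd
  have := Nat.le_of_dvd (by norm_num) hd
  have h4 := h.data.mod4
  have h5 := h.data.prime.two_le
  omega

lemma b_ne_zero : (b : IsLocalRing.ResidueField V) ≠ 0 := by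
  rw [Ne, h.cast_int_eq_zero]; exact h.data.not_dvd_b

lemma res_I_ne_zero : res V I ≠ 0 := by
  intro h0
  have := h.res_I
  rw [h0] at this
  simp at this

lemma res_conj_ne_zero : res V ((starRingEnd ℂ) π) ≠ 0 := by
  rw [h.res_conj]
  exact mul_ne_zero (mul_ne_zero (neg_ne_zero.2 h.two_ne_zero) h.b_ne_zero) h.res_I_ne_zero

end Place

end

section

open Filter Topology

/-- `x` lies in the valuation ring and reduces to `y`. -/
def Red (V : ValuationSubring ℂ) (x : ℂ) (y : IsLocalRing.ResidueField V) : Prop :=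
  x ∈ V ∧ res V x = y

namespace Red

variable {V : ValuationSubring ℂ} {x x' : ℂ} {y y' : IsLocalRing.ResidueField V}

lemma of_mem (hx : x ∈ V) : Red V x (res V x) := ⟨hx, rfl⟩

lemma congr (h : Red V x y) (hx : x = x') (hy : y = y') : Red V x' y' := hx ▸ hy ▸ h

lemma add (h : Red V x y) (h' : Red V x' y') : Red V (x + x') (y + y') :=
  ⟨V.add_mem _ _ h.1 h'.1, by rw [res_add h.1 h'.1, h.2, h'.2]⟩

lemma mul (h : Red V x y) (h' : Red V x' y') : Red V (x * x') (y * y') :=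
  ⟨V.mul_mem _ _ h.1 h'.1, by rw [res_mul h.1 h'.1, h.2, h'.2]⟩

lemma neg (h : Red V x y) : Red V (-x) (-y) := ⟨V.neg_mem _ h.1, by rw [res_neg h.1, h.2]⟩

lemma sub (h : Red V x y) (h' : Red V x' y') : Red V (x - x') (y - y') := by
  simpa only [sub_eq_add_neg] using h.add h'.neg

lemma one : Red V 1 1 := ⟨V.one_mem, res_one⟩

lemma zero : Red V 0 0 := ⟨V.zero_mem, res_zero⟩

lemma int (k : ℤ) : Red V (k : ℂ) k := ⟨int_mem_V k, res_intCast k⟩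

lemma nat (k : ℕ) : Red V (k : ℂ) k := ⟨nat_mem_V k, res_natCast k⟩

lemma pow (h : Red V x y) (k : ℕ) : Red V (x ^ k) (y ^ k) :=
  ⟨pow_mem_V h.1 k, by rw [res_pow h.1, h.2]⟩

lemma inv (h : Red V x y) (hy : y ≠ 0) : Red V x⁻¹ y⁻¹ := by
  have : res V x ≠ 0 := by rw [h.2]; exact hy
  exact ⟨inv_mem_of_res_ne this, by rw [res_inv this, h.2]⟩

lemma div (h : Red V x y) (h' : Red V x' y') (hy : y' ≠ 0) : Red V (x / x') (y / y') := by
  simpa only [div_eq_mul_inv] using h.mul (h'.inv hy)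

lemma ne_zero (h : Red V x y) (hy : y ≠ 0) : x ≠ 0 := by
  rintro rfl; exact hy (by rw [← h.2, res_zero])

lemma unique (h : Red V x y) (h' : Red V x y') : y = y' := h.2.symm.trans h'.2

lemma sum {ι : Type*} {s : Finset ι} {f : ι → ℂ} {g : ι → IsLocalRing.ResidueField V}
    (hf : ∀ i ∈ s, Red V (f i) (g i)) : Red V (∑ i ∈ s, f i) (∑ i ∈ s, g i) :=
  ⟨sum_mem_V fun i hi => (hf i hi).1, by
    rw [res_sum fun i hi => (hf i hi).1]; exact Finset.sum_congr rfl fun i hi => (hf i hi).2⟩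

lemma prod {ι : Type*} {s : Finset ι} {f : ι → ℂ} {g : ι → IsLocalRing.ResidueField V}
    (hf : ∀ i ∈ s, Red V (f i) (g i)) : Red V (∏ i ∈ s, f i) (∏ i ∈ s, g i) :=
  ⟨prod_mem_V fun i hi => (hf i hi).1, by
    rw [res_prod fun i hi => (hf i hi).1]; exact Finset.prod_congr rfl fun i hi => (hf i hi).2⟩

end Red

/-- Division values of the lemniscatic functions, abstractly. -/
structure DivVal (p : ℕ) (π : ℂ) (T c : ℤ → ℂ) : Prop where
  T_add_p : ∀ r, T (r + p) = T r
  c_add_p : ∀ r, c (r + p) = c r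
  T_zero : T 0 = 0
  c_zero : c 0 = 1
  c_sq : ∀ r, c r ^ 2 = 1 - T r ^ 4
  T_add : ∀ r s, T (r + s) * (1 + T r ^ 2 * T s ^ 2) = T r * c s + T s * c r
  c_add : ∀ r s, c (r + s) * (1 + T r ^ 2 * T s ^ 2) =
    c r * c s - 2 * T r ^ 3 * T s - 2 * T (r + s) * T r * c r * T s ^ 2
  prod : ∏ r ∈ Finset.Icc 1 (p - 1), T (r : ℕ) = π

lemma periodic_int {p : ℕ} {f : ℤ → ℂ} (hf : ∀ r, f (r + p) = f r) {r s : ℤ}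
    (h : (p : ℤ) ∣ r - s) : f r = f s := by
  obtain ⟨k, hk⟩ := h
  have h1 : Function.Periodic f (p : ℤ) := hf
  have h2 := h1.int_mul k s
  rw [← h2]; congr 1; rw [Int.cast_id]; linear_combination hk

section

variable {p : ℕ} {a b : ℤ} {π : ℂ} {V : ValuationSubring ℂ} {T c : ℤ → ℂ}

lemma DivVal.T_ne_zero (D : DivVal p π T c) (hπ : π ≠ 0) {r : ℕ} (hr : r ∈ Finset.Icc 1 (p - 1)) :
    T r ≠ 0 := by
  intro h0
  rw [← D.prod] at hπ
  exact hπ (Finset.prod_eq_zero hr h0)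

lemma Place.exists_nat_mul (h : Place p a b π V) {r₀ : ℕ} (hr : r₀ ∈ Finset.Icc 1 (p - 1)) (r : ℤ) :
    ∃ k : ℕ, (p : ℤ) ∣ r - k * r₀ := by
  have h0 : ¬ (p : ℤ) ∣ r₀ := by
    have := Finset.mem_Icc.1 hr
    intro hd
    have := Nat.le_of_dvd (by omega) (Int.natCast_dvd_natCast.1 hd)
    omega
  have hp : (0 : ℤ) < p := by exact_mod_cast h.data.prime.pos
  obtain ⟨s, t, e⟩ := h.data.exists_inv h0
  refine ⟨(r * s % p).toNat, ?_⟩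
  rw [Int.toNat_of_nonneg (Int.emod_nonneg _ hp.ne')]
  refine ⟨r * t + r * s / p * r₀, ?_⟩
  have := Int.emod_add_mul_ediv (r * s) p
  linear_combination (-r) * e + (-r₀ : ℤ) * this

lemma Place.red_all (h : Place p a b π V) (D : DivVal p π T c) (r : ℤ) :
    Red V (T r) 0 ∧ Red V (c r) 1 := by
  obtain ⟨r₀, hr₀, h0⟩ : ∃ r₀ ∈ Finset.Icc 1 (p - 1), Red V (T (r₀ : ℕ)) 0 := by
    by_contra! hcon
    have : ∀ r ∈ Finset.Icc 1 (p - 1), (T (r : ℕ))⁻¹ ∈ V := by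
      intro r hr
      rcases V.mem_or_inv_mem (T (r : ℕ)) with h1 | h1
      · exact inv_mem_of_res_ne fun h2 => hcon r hr ⟨h1, h2⟩
      · exact h1
    have h2 := prod_mem_V this
    rw [Finset.prod_inv_distrib, D.prod] at h2
    exact res_ne_zero_of_inv_mem h.data.ne_zero h.pi_mem h2 h.res_pi
  have hc0 : Red V (c r₀ ^ 2) 1 := by
    rw [D.c_sq]
    exact (Red.one.sub (h0.pow 4)).congr rfl (by simp)
  have hcV : c r₀ ∈ V := mem_of_pow_mem _root_.two_ne_zero hc0.1
  set e := res V (c r₀) with he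
  have hce : Red V (c r₀) e := ⟨hcV, rfl⟩
  have he2 : e ^ 2 = 1 := (hce.pow 2).unique hc0
  have key : ∀ k : ℕ, Red V (T (k * r₀)) 0 ∧ Red V (c (k * r₀)) (e ^ k) := by
    intro k
    induction k with
    | zero => simp only [Nat.cast_zero, zero_mul, D.T_zero, D.c_zero, pow_zero]
              exact ⟨Red.zero, Red.one⟩
    | succ k ih =>
      obtain ⟨i1, i2⟩ := ih
      have hd : Red V (1 + T (k * r₀) ^ 2 * T r₀ ^ 2) 1 :=
        (Red.one.add ((i1.pow 2).mul (h0.pow 2))).congr rfl (by simp)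
      have hd0 := hd.ne_zero one_ne_zero
      have e1 : ((k + 1 : ℕ) : ℤ) * r₀ = k * r₀ + r₀ := by push_cast; ring
      rw [e1]
      have hT : Red V (T (k * r₀ + r₀)) 0 := by
        refine (((i1.mul hce).add (h0.mul i2)).div hd one_ne_zero).congr ?_ (by simp)
        rw [← D.T_add, mul_div_cancel_right₀ _ hd0]
      refine ⟨hT, ?_⟩
      have h2 : Red V (2 : ℂ) 2 := by simpa using Red.nat (V := V) 2
      refine (((((i2.mul hce).sub ((h2.mul (i1.pow 3)).mul h0)).sub
        ((((h2.mul hT).mul i1).mul i2).mul (h0.pow 2)))).div hd one_ne_zero).congr ?_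
        (by simp [pow_succ])
      rw [← D.c_add, mul_div_cancel_right₀ _ hd0]
  have he1 : e = 1 := by
    have h1 := (key p).2
    rw [periodic_int D.c_add_p (s := 0) ⟨r₀, by ring⟩, D.c_zero] at h1
    have h2 := h1.unique Red.one
    have h4 := h.data.mod4
    rw [show p = 2 * (p / 2) + 1 by omega, pow_succ, pow_mul, he2, one_pow, one_mul] at h2
    exact h2
  obtain ⟨k, hk⟩ := h.exists_nat_mul hr₀ r
  have := key k
  rw [he1, one_pow] at this
  rwa [periodic_int D.T_add_p hk, periodic_int D.c_add_p hk]

lemma Place.T_one_ne_zero (h : Place p a b π V) (D : DivVal p π T c) : T 1 ≠ 0 := by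
  have h5 := h.data.prime.two_le
  simpa using D.T_ne_zero h.data.ne_zero (r := 1) (Finset.mem_Icc.2 ⟨le_rfl, by omega⟩)

lemma Place.red_div (h : Place p a b π V) (D : DivVal p π T c) (r : ℤ) :
    Red V (T r / T 1) r := by
  have ht := h.T_one_ne_zero D
  have key : ∀ k : ℕ, Red V (T k / T 1) k := by
    intro k
    induction k with
    | zero => simpa [D.T_zero] using Red.zero
    | succ k ih =>
      have h1 := h.red_all D 1
      have hk := h.red_all D k
      have hd : Red V (1 + T k ^ 2 * T 1 ^ 2) 1 :=
        (Red.one.add ((hk.1.pow 2).mul (h1.1.pow 2))).congr rfl (by simp)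
      have hd0 := hd.ne_zero one_ne_zero
      refine (((ih.mul h1.2).add hk.2).div hd one_ne_zero).congr ?_ (by simp)
      push_cast
      rw [div_eq_div_iff hd0 ht, D.T_add]
      field_simp
  obtain ⟨k, hk⟩ := h.exists_nat_mul (r₀ := 1)
    (Finset.mem_Icc.2 ⟨le_rfl, by have := h.data.prime.two_le; omega⟩) r
  rw [Nat.cast_one, mul_one] at hk
  rw [periodic_int D.T_add_p hk]
  refine (key k).congr rfl ?_
  have := h.cast_int_eq_zero.2 hk
  push_cast at this
  exact (sub_eq_zero.1 this).symm

lemma prod_Icc_one {M : Type*} [CommMonoid M] (f : ℕ → M) (n : ℕ) :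
    ∏ r ∈ Finset.Icc 1 n, f r = ∏ k ∈ Finset.range n, f (k + 1) := by
  rw [Finset.range_eq_Ico, Finset.prod_Ico_add' f 0 n 1]
  rfl

lemma Place.prod_Icc (h : Place p a b π V) :
    ∏ r ∈ Finset.Icc 1 (p - 1), ((r : ℕ) : IsLocalRing.ResidueField V) = -1 := by
  have := Fact.mk h.data.prime
  have h1 := ZMod.wilsons_lemma p
  have h2 : (((p - 1).factorial + 1 : ℕ) : ZMod p) = 0 := by
    push_cast; rw [h1]; ring
  have h3 := h.cast_nat_eq_zero.2 ((ZMod.natCast_eq_zero_iff _ _).1 h2)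
  push_cast at h3
  rw [← eq_neg_of_add_eq_zero_left h3]
  rw [← Nat.cast_prod, prod_Icc_one, Finset.prod_range_add_one_eq_factorial]

lemma Place.red_pi (h : Place p a b π V) (D : DivVal p π T c) :
    Red V (π / T 1 ^ (p - 1)) (-1) := by
  rw [← h.prod_Icc]
  refine (Red.prod (s := Finset.Icc 1 (p - 1)) fun r _ => h.red_div D (r : ℕ)).congr ?_ (by simp)
  rw [Finset.prod_div_distrib, D.prod, Finset.prod_const, Nat.card_Icc, Nat.add_sub_cancel]

lemma Place.red_root (h : Place p a b π V) {ζ : ℂ} (hζ : ζ ^ p = 1) : Red V ζ 1 := by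
  have := Fact.mk h.data.prime
  have := h.charP
  have h1 : ζ ∈ V := mem_of_pow_mem h.data.prime.ne_zero (by rw [hζ]; exact V.one_mem)
  refine ⟨h1, ?_⟩
  have h2 : (res V ζ - 1) ^ p = 0 := by
    rw [sub_pow_char, ← res_pow h1, hζ, res_one, one_pow, sub_self]
  exact sub_eq_zero.1 (eq_zero_of_pow_eq_zero h2)

lemma Place.red_pow_sub_one (h : Place p a b π V) {ζ : ℂ} (hζ : IsPrimitiveRoot ζ p) (r : ℕ) :
    Red V ((ζ ^ r - 1) / (ζ - 1)) r := by
  have h1 : ζ ≠ 1 := hζ.ne_one h.data.prime.one_lt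
  rw [← geom_sum_eq h1]
  exact (Red.sum fun i _ => (h.red_root hζ.pow_eq_one).pow i).congr rfl (by simp)

lemma Place.red_p (h : Place p a b π V) {ζ : ℂ} (hζ : IsPrimitiveRoot ζ p) :
    Red V (p / (ζ - 1) ^ (p - 1)) (-1) := by
  rw [← h.prod_Icc]
  refine (Red.prod fun r _ => h.red_pow_sub_one hζ r).congr ?_ rfl
  rw [Finset.prod_div_distrib, Finset.prod_const, Nat.card_Icc, Nat.add_sub_cancel]
  congr 1
  have h5 := h.data.prime.two_le
  have h4 := h.data.mod4
  have hz : IsPrimitiveRoot ζ (p - 1 + 1) := by rwa [show p - 1 + 1 = p by omega]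
  have := hz.prod_pow_sub_one_eq_order
  rw [Even.neg_one_pow ⟨2 * (p / 4), by omega⟩, one_mul] at this
  rw [prod_Icc_one, this, Nat.cast_sub (by omega)]
  simp

/-- The ratio `(ζ - 1) / T 1` is a unit whose `p - 1`-st power reduces to that of `π̄`. -/
lemma Place.exists_ratio (h : Place p a b π V) (D : DivVal p π T c) {ζ : ℂ}
    (hζ : IsPrimitiveRoot ζ p) : ∃ C : IsLocalRing.ResidueField V,
      Red V ((ζ - 1) / T 1) C ∧ C ^ (p - 1) = res V ((starRingEnd ℂ) π) ∧ C ≠ 0 := by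
  have ht := h.T_one_ne_zero D
  have hz0 : ζ - 1 ≠ 0 := sub_ne_zero.2 (hζ.ne_one h.data.prime.one_lt)
  have hp1 : p - 1 ≠ 0 := by have := h.data.prime.two_le; omega
  have h1 : Red V (((ζ - 1) / T 1) ^ (p - 1)) (res V ((starRingEnd ℂ) π)) := by
    refine (((h.red_pi D).mul (Red.of_mem h.conj_mem)).div (h.red_p hζ) (by simp)).congr ?_
      (by simp)
    rw [← h.data.mul_conj]
    have := h.data.ne_zero
    have := h.data.conj_ne_zero
    rw [div_pow]
    field_simp
  have h2 := mem_of_pow_mem hp1 h1.1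
  have h3 := ((Red.of_mem h2).pow (p - 1)).unique h1
  refine ⟨_, Red.of_mem h2, h3, ?_⟩
  intro h0
  rw [h0, zero_pow hp1] at h3
  exact h.res_conj_ne_zero h3.symm

end

end

section

open Filter Topology

/-- The `t`-divided difference. -/
def divDiff (t : ℂ) (f : ℤ → ℂ) : ℤ → ℂ := fun r => (f (r + 1) - f r) / t

section

variable {p : ℕ} {a b : ℤ} {π : ℂ} {V : ValuationSubring ℂ} {T c : ℤ → ℂ}

lemma Place.smooth_aux (h : Place p a b π V) (D : DivVal p π T c) :
    ∃ h₁ h₂ : ℤ → ℂ, T ∈ smooth V (T 1) ∧ c ∈ smooth V (T 1) ∧ h₁ ∈ smooth V (T 1) ∧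
      h₂ ∈ smooth V (T 1) ∧ divDiff (T 1) T = c + T 1 • h₁ ∧
      divDiff (T 1) c = -2 * T ^ 3 + T 1 • h₂ := by
  have ht := h.T_one_ne_zero D
  set t := T 1 with htdef
  have hr1 := h.red_all D 1
  have h2 : Red V (2 : ℂ) 2 := by simpa using Red.nat (V := V) 2
  have hu : Red V (1 + c 1) 2 := (Red.one.add hr1.2).congr rfl (by norm_num)
  have hu0 := hu.ne_zero h.two_ne_zero
  set u := (1 + c 1)⁻¹ with hudef
  have huV : u ∈ V := (hu.inv h.two_ne_zero).1
  have hc1 : c 1 = 1 - t ^ 4 * u := by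
    rw [hudef]; field_simp; linear_combination D.c_sq 1
  set v : ℤ → ℂ := fun r => (1 + t ^ 2 * T r ^ 2)⁻¹ with hv
  have hvd : ∀ r, Red V (1 + t ^ 2 * T r ^ 2) 1 := fun r =>
    (Red.one.add ((hr1.1.pow 2).mul ((h.red_all D r).1.pow 2))).congr rfl (by simp)
  have hv0 : ∀ r, 1 + t ^ 2 * T r ^ 2 ≠ 0 := fun r => (hvd r).ne_zero one_ne_zero
  have hvV : ∀ r, v r ∈ V := fun r => ((hvd r).inv one_ne_zero).1
  have hv1 : ∀ r, v r * (1 + t ^ 2 * T r ^ 2) = 1 := fun r => inv_mul_cancel₀ (hv0 r)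
  clear_value v
  have hT1 : ∀ r, T (r + 1) = (T r * c 1 + t * c r) * v r := fun r => by
    have h3 := D.T_add r 1
    rw [← htdef] at h3
    linear_combination v r * h3 - T (r + 1) * hv1 r
  have hcc1 : ∀ r, c (r + 1) =
      (c r * c 1 - 2 * T r ^ 3 * t - 2 * T (r + 1) * T r * c r * t ^ 2) * v r := fun r => by
    have h3 := D.c_add r 1
    rw [← htdef] at h3
    linear_combination v r * h3 - c (r + 1) * hv1 r
  set τ : ℤ → ℂ := fun _ => t with hτ
  set υ : ℤ → ℂ := fun _ => u with hυ
  set sT : ℤ → ℂ := fun r => T (r + 1) with hsT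
  set sv : ℤ → ℂ := fun r => v (r + 1) with hsv
  set h₁ : ℤ → ℂ := -(τ * T ^ 2 * v * c) - T ^ 3 * v - τ ^ 2 * υ * T * v with hh1
  set h₂ : ℤ → ℂ := -(c * T ^ 2 * v) - τ ^ 2 * c * υ * v + 2 * τ * T ^ 5 * v
    - 2 * sT * T * c * v with hh2
  have e1 : divDiff t T = c + t • h₁ := by
    ext r
    simp only [divDiff, Pi.add_apply, Pi.smul_apply, smul_eq_mul, hh1, Pi.sub_apply, Pi.neg_apply,
      Pi.mul_apply, Pi.pow_apply, hτ, hυ]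
    rw [div_eq_iff ht, hT1, hc1]
    linear_combination (T r + t * c r) * hv1 r
  have e2 : divDiff t c = -2 * T ^ 3 + t • h₂ := by
    ext r
    simp only [divDiff, Pi.add_apply, Pi.smul_apply, smul_eq_mul, hh2, Pi.sub_apply, Pi.neg_apply,
      Pi.mul_apply, Pi.pow_apply, Pi.ofNat_apply, hτ, hυ, hsT]
    rw [div_eq_iff ht, hcc1, hc1]
    linear_combination (c r - 2 * t * T r ^ 3) * hv1 r
  have e3 : divDiff t v = -(τ ^ 2 * v * sv * (T + sT) * divDiff t T) := by
    ext r
    simp only [divDiff, Pi.add_apply, Pi.neg_apply, Pi.mul_apply, Pi.pow_apply, hτ, hsv, hsT]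
    field_simp
    linear_combination v r * hv1 (r + 1) - v (r + 1) * hv1 r
  have hτk : ∀ k, τ ∈ smoothTo V t k := fun k => SmoothTo.const hr1.1.1 k
  have hυk : ∀ k, υ ∈ smoothTo V t k := fun k => SmoothTo.const huV k
  have h2k : ∀ k, (2 : ℤ → ℂ) ∈ smoothTo V t k := fun k => ofNat_mem _ 2
  have key : ∀ k, T ∈ smoothTo V t k ∧ c ∈ smoothTo V t k ∧ v ∈ smoothTo V t k := by
    intro k
    induction k with
    | zero => exact ⟨fun r => (h.red_all D r).1.1, fun r => (h.red_all D r).2.1, hvV⟩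
    | succ k ih =>
      obtain ⟨i1, i2, i3⟩ := ih
      have i4 : sT ∈ smoothTo V t k := SmoothTo.shift i1
      have i5 : sv ∈ smoothTo V t k := SmoothTo.shift i3
      have j1 : divDiff t T ∈ smoothTo V t k := by
        rw [e1]
        change c + τ * h₁ ∈ _
        apply_rules [Subring.pow_mem, Subring.add_mem, Subring.mul_mem, Subring.sub_mem,
          Subring.neg_mem]
      have j2 : divDiff t c ∈ smoothTo V t k := by
        rw [e2]
        change -2 * T ^ 3 + τ * h₂ ∈ _
        have j3 : h₂ ∈ smoothTo V t k := by
          apply_rules [Subring.pow_mem, Subring.add_mem, Subring.mul_mem, Subring.sub_mem,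
            Subring.neg_mem]
        clear_value h₂
        apply_rules [Subring.pow_mem, Subring.add_mem, Subring.mul_mem, Subring.sub_mem,
          Subring.neg_mem]
      have j3 : divDiff t v ∈ smoothTo V t k := by
        rw [e3]
        apply_rules [Subring.pow_mem, Subring.add_mem, Subring.mul_mem, Subring.sub_mem,
          Subring.neg_mem]
      exact ⟨⟨fun r => (h.red_all D r).1.1, j1⟩, ⟨fun r => (h.red_all D r).2.1, j2⟩, ⟨hvV, j3⟩⟩
  have kT : T ∈ smooth V t := fun k => (key k).1
  have kc : c ∈ smooth V t := fun k => (key k).2.1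
  have kv : v ∈ smooth V t := fun k => (key k).2.2
  have ks : sT ∈ smooth V t := shift_mem_smooth kT
  have kτ : τ ∈ smooth V t := const_mem_smooth hr1.1.1
  have kυ : υ ∈ smooth V t := const_mem_smooth huV
  have k2 : (2 : ℤ → ℂ) ∈ smooth V t := ofNat_mem _ 2
  refine ⟨h₁, h₂, kT, kc, ?_, ?_, e1, e2⟩ <;>
  apply_rules [Subring.pow_mem, Subring.add_mem, Subring.mul_mem, Subring.sub_mem,
    Subring.neg_mem]

end

end

section

open Filter Topology

section

variable {V : ValuationSubring ℂ} {t : ℂ} {f g : ℤ → ℂ}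

lemma divDiff_mul (ht : t ≠ 0) (f g : ℤ → ℂ) :
    divDiff t (f * g) = f * divDiff t g + g * divDiff t f + t • (divDiff t f * divDiff t g) := by
  ext r
  simp only [divDiff, Pi.add_apply, Pi.mul_apply, Pi.smul_apply, smul_eq_mul]
  field_simp
  ring

lemma smul_mem_smooth {c : ℂ} (hc : c ∈ V) (hf : f ∈ smooth V t) : c • f ∈ smooth V t :=
  (smooth V t).mul_mem (const_mem_smooth hc) hf

lemma divDiff_mem_smooth (hf : f ∈ smooth V t) : divDiff t f ∈ smooth V t := diff_mem_smooth hf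

/-- A nontrivial `p`-th root of unity, with its first-order behaviour in terms of `t`. -/
structure Twist (V : ValuationSubring ℂ) (p : ℕ) (t x : ℂ) (Y : IsLocalRing.ResidueField V) :
    Prop where
  pow_eq : x ^ p = 1
  ne_one : x ≠ 1
  div_mem : t / (x - 1) ∈ V
  red : Red V ((x⁻¹ - 1) / t) Y

/-- The leading coefficient of the twisted sum of `f`. -/
def lam (V : ValuationSubring ℂ) (p : ℕ) (t x : ℂ) (f : ℤ → ℂ) : IsLocalRing.ResidueField V :=
  res V (charSum p x f / t ^ (p - 1))

variable {p : ℕ} {a b : ℤ} {π : ℂ} {T c : ℤ → ℂ} {x : ℂ} {Y : IsLocalRing.ResidueField V}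

lemma Place.p_div_mem (h : Place p a b π V) (D : DivVal p π T c) :
    (p : ℂ) / T 1 ^ (p - 1) ∈ V := by
  convert V.mul_mem _ _ (h.red_pi D).1 h.conj_mem using 1
  rw [← h.data.mul_conj]; ring

lemma Twist.charSum_mem (h : Place p a b π V) (D : DivVal p π T c) (W : Twist V p (T 1) x Y)
    (hf : f ∈ smooth V (T 1)) : charSum p x f / T 1 ^ (p - 1) ∈ V :=
  QGS.charSum_mem h.data.prime W.pow_eq W.ne_one (h.T_one_ne_zero D) (h.red_all D 1).1.1
    (h.red_root W.pow_eq).1 W.div_mem (h.p_div_mem D) hf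

lemma Twist.lam_add (h : Place p a b π V) (D : DivVal p π T c) (W : Twist V p (T 1) x Y)
    (hf : f ∈ smooth V (T 1)) (hg : g ∈ smooth V (T 1)) :
    lam V p (T 1) x (f + g) = lam V p (T 1) x f + lam V p (T 1) x g := by
  unfold lam
  rw [charSum_add, add_div, res_add (W.charSum_mem h D hf) (W.charSum_mem h D hg)]

lemma Twist.lam_smul (h : Place p a b π V) (D : DivVal p π T c) (W : Twist V p (T 1) x Y)
    {d : ℂ} (hd : d ∈ V) (hf : f ∈ smooth V (T 1)) :
    lam V p (T 1) x (d • f) = res V d * lam V p (T 1) x f := by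
  unfold lam
  rw [charSum_smul, mul_div_assoc, res_mul hd (W.charSum_mem h D hf)]

lemma Twist.lam_congr (h : Place p a b π V) (D : DivVal p π T c) (W : Twist V p (T 1) x Y)
    (hf : f ∈ smooth V (T 1)) (hg : g ∈ smooth V (T 1)) :
    lam V p (T 1) x (f + T 1 • g) = lam V p (T 1) x f := by
  have ht := (h.red_all D 1).1
  rw [W.lam_add h D hf (smul_mem_smooth ht.1 hg), W.lam_smul h D ht.1 hg, ht.2, zero_mul, add_zero]

lemma Twist.lam_divDiff (h : Place p a b π V) (D : DivVal p π T c) (W : Twist V p (T 1) x Y)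
    (hf : f ∈ smooth V (T 1)) (hp : f p = f 0) :
    lam V p (T 1) x (divDiff (T 1) f) = Y * lam V p (T 1) x f := by
  have hx0 : x ≠ 0 := by
    rintro rfl
    have := W.pow_eq
    rw [zero_pow h.data.prime.ne_zero] at this
    exact zero_ne_one this
  unfold lam
  rw [show charSum p x (divDiff (T 1) f) = _ from charSum_diff W.pow_eq hx0 hp, mul_div_assoc,
    res_mul W.red.1 (W.charSum_mem h D hf), W.red.2]

lemma Place.divDiff_pow (h : Place p a b π V) (D : DivVal p π T c) (m : ℕ) :
    ∃ g ∈ smooth V (T 1), divDiff (T 1) (T ^ (m + 1)) =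
      ((m + 1 : ℕ) : ℂ) • (T ^ m * c) + T 1 • g := by
  obtain ⟨h₁, h₂, kT, kc, k1, k2, e1, e2⟩ := h.smooth_aux D
  have ht := h.T_one_ne_zero D
  induction m with
  | zero => exact ⟨h₁, k1, by simpa using e1⟩
  | succ m ih =>
    obtain ⟨g, hg, e⟩ := ih
    refine ⟨T ^ (m + 1) * h₁ + T * g + divDiff (T 1) (T ^ (m + 1)) * divDiff (T 1) T,
      Subring.add_mem _ (Subring.add_mem _ (Subring.mul_mem _ (Subring.pow_mem _ kT _) k1)
        (Subring.mul_mem _ kT hg)) (Subring.mul_mem _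
        (divDiff_mem_smooth (Subring.pow_mem _ kT _)) (divDiff_mem_smooth kT)), ?_⟩
    rw [pow_succ, divDiff_mul ht, smul_add (T 1) _ (divDiff (T 1) (T ^ (m + 1)) * _), ← add_assoc]
    congr 1
    rw [e, e1]
    ext r
    simp only [Pi.add_apply, Pi.mul_apply, Pi.smul_apply, smul_eq_mul, Pi.pow_apply]
    push_cast
    ring

lemma Place.divDiff_pow_mul (h : Place p a b π V) (D : DivVal p π T c) (m : ℕ) :
    ∃ g ∈ smooth V (T 1), divDiff (T 1) (T ^ (m + 1) * c) =
      ((m + 1 : ℕ) : ℂ) • T ^ m + (-((m + 3 : ℕ) : ℂ)) • T ^ (m + 4) + T 1 • g := by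
  obtain ⟨h₁, h₂, kT, kc, k1, k2, e1, e2⟩ := h.smooth_aux D
  obtain ⟨g, hg, e⟩ := h.divDiff_pow D m
  have ht := h.T_one_ne_zero D
  refine ⟨T ^ (m + 1) * h₂ + c * g + divDiff (T 1) (T ^ (m + 1)) * divDiff (T 1) c,
      Subring.add_mem _ (Subring.add_mem _ (Subring.mul_mem _ (Subring.pow_mem _ kT _) k2)
        (Subring.mul_mem _ kc hg)) (Subring.mul_mem _
        (divDiff_mem_smooth (Subring.pow_mem _ kT _)) (divDiff_mem_smooth kc)), ?_⟩
  rw [divDiff_mul ht, smul_add (T 1) _ (divDiff (T 1) (T ^ (m + 1)) * _), ← add_assoc]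
  congr 1
  rw [e, e2]
  ext r
  simp only [Pi.add_apply, Pi.mul_apply, Pi.smul_apply, smul_eq_mul, Pi.pow_apply, Pi.neg_apply,
    Pi.ofNat_apply]
  push_cast
  linear_combination ((m : ℂ) + 1) * T r ^ m * D.c_sq r

/-- The recursion satisfied by the leading coefficients of the power sums. -/
lemma Twist.recursion (h : Place p a b π V) (D : DivVal p π T c) (W : Twist V p (T 1) x Y) (m : ℕ) :
    ((m : IsLocalRing.ResidueField V) + 1) * lam V p (T 1) x (T ^ m * c) =
      Y * lam V p (T 1) x (T ^ (m + 1)) ∧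
    ((m : IsLocalRing.ResidueField V) + 1) * lam V p (T 1) x (T ^ m) -
      ((m : IsLocalRing.ResidueField V) + 3) * lam V p (T 1) x (T ^ (m + 4)) =
      Y * lam V p (T 1) x (T ^ (m + 1) * c) := by
  obtain ⟨h₁, h₂, kT, kc, k1, k2, e1, e2⟩ := h.smooth_aux D
  have kp : ∀ k, T ^ k ∈ smooth V (T 1) := fun k => Subring.pow_mem _ kT k
  have kpc : ∀ k, T ^ k * c ∈ smooth V (T 1) := fun k => Subring.mul_mem _ (kp k) kc
  have hTp : T p = T 0 := by simpa using D.T_add_p 0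
  have hcp : c p = c 0 := by simpa using D.c_add_p 0
  constructor
  · obtain ⟨g, hg, e⟩ := h.divDiff_pow D m
    rw [← W.lam_divDiff h D (kp _) (by simp [hTp]), e,
      W.lam_congr h D (smul_mem_smooth (nat_mem_V _) (kpc _)) hg,
      W.lam_smul h D (nat_mem_V _) (kpc _), res_natCast]
    push_cast; ring
  · obtain ⟨g, hg, e⟩ := h.divDiff_pow_mul D m
    have i1 := smul_mem_smooth (nat_mem_V (m + 1)) (kp m)
    have i2 := smul_mem_smooth (V.neg_mem _ (nat_mem_V (m + 3))) (kp (m + 4))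
    rw [← W.lam_divDiff h D (kpc _) (by simp [hTp, hcp]), e,
      W.lam_congr h D (Subring.add_mem _ i1 i2) hg, W.lam_add h D i1 i2,
      W.lam_smul h D (nat_mem_V _) (kp _), W.lam_smul h D (V.neg_mem _ (nat_mem_V _)) (kp _),
      res_neg (nat_mem_V _), res_natCast, res_natCast]
    push_cast; ring

lemma Twist.recursion_zero (h : Place p a b π V) (D : DivVal p π T c) (W : Twist V p (T 1) x Y) :
    -2 * lam V p (T 1) x (T ^ 3) = Y ^ 2 * lam V p (T 1) x T := by
  obtain ⟨h₁, h₂, kT, kc, k1, k2, e1, e2⟩ := h.smooth_aux D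
  have hTp : T p = T 0 := by simpa using D.T_add_p 0
  have hcp : c p = c 0 := by simpa using D.c_add_p 0
  have kp := Subring.pow_mem _ kT 3
  have e3 : (-2 * T ^ 3 : ℤ → ℂ) = (-((2 : ℕ) : ℂ)) • T ^ 3 := by
    ext r; simp [Pi.ofNat_apply]
  have i1 := W.lam_divDiff h D kc hcp
  have i2 := W.lam_divDiff h D kT hTp
  have i3 := V.neg_mem _ (nat_mem_V (V := V) 2)
  rw [e1, W.lam_congr h D kc k1] at i2
  rw [e2, e3, W.lam_congr h D (smul_mem_smooth i3 kp) k2, W.lam_smul h D i3 kp,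
    res_neg (nat_mem_V _), res_natCast, i2] at i1
  push_cast at i1
  rw [i1]; ring

lemma Twist.lam_pow_eq_zero (h : Place p a b π V) (D : DivVal p π T c) (W : Twist V p (T 1) x Y)
    {m : ℕ} (hm : p ≤ m) : lam V p (T 1) x (T ^ m) = 0 := by
  have hp := h.data.prime.pos
  have h1 : Red V (charSum p x (T ^ m) / T 1 ^ (p - 1)) (∑ r ∈ Finset.range p, 0) := by
    unfold charSum
    rw [Finset.sum_div]
    refine Red.sum fun r _ => ?_
    refine (((h.red_root W.pow_eq).pow r).mul (((h.red_div D r).pow (p - 1)).mul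
      ((h.red_all D r).1.pow (m - (p - 1))))).congr ?_ ?_
    · rw [Pi.pow_apply, div_pow, show T r ^ m = T r ^ (p - 1) * T r ^ (m - (p - 1)) by
        rw [← pow_add]; congr 1; omega]
      ring
    · rw [zero_pow (by omega)]; simp
  rw [Finset.sum_const_zero] at h1
  exact h1.2

lemma Place.sum_pow (h : Place p a b π V) :
    ∑ r ∈ Finset.range p, ((r : ℕ) : IsLocalRing.ResidueField V) ^ (p - 1) = -1 := by
  have := Fact.mk h.data.prime
  have h2 := h.data.prime.two_le
  have e : p = p - 1 + 1 := by omega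
  rw [e, Finset.sum_range_succ']
  simp only [Nat.add_sub_cancel, Nat.cast_zero]
  rw [zero_pow (by omega), add_zero, Finset.sum_congr rfl (g := fun _ => 1), Finset.sum_const,
    Finset.card_range, nsmul_eq_mul, mul_one, Nat.cast_sub (by omega), h.cast_p]
  · simp
  · intro r hr
    have hr := Finset.mem_range.1 hr
    have h3 : ((r + 1 : ℕ) : ZMod p) ≠ 0 := fun h0 => by
      have := Nat.le_of_dvd (by omega) ((ZMod.natCast_eq_zero_iff _ _).1 h0)
      omega
    have h4 := ZMod.pow_card_sub_one_eq_one h3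
    have h5 : (((r + 1) ^ (p - 1) : ℕ) : ZMod p) = (1 : ℕ) := by push_cast; push_cast at h4; rw [h4]
    have h6 := (ZMod.intCast_eq_intCast_iff_dvd_sub (1 : ℤ) ((r + 1 : ℤ) ^ (p - 1)) p).1
      (by push_cast; push_cast at h5; exact h5.symm)
    have h7 := h.cast_int_eq_zero.2 h6
    push_cast at h7 ⊢
    exact sub_eq_zero.1 h7

lemma Twist.lam_pow_pred (h : Place p a b π V) (D : DivVal p π T c) (W : Twist V p (T 1) x Y) :
    lam V p (T 1) x (T ^ (p - 2)) = Y := by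
  have h2 := h.data.prime.two_le
  have h1 : lam V p (T 1) x (T ^ (p - 1) * c) = -1 := by
    have h1 : Red V (charSum p x (T ^ (p - 1) * c) / T 1 ^ (p - 1)) (-1) := by
      rw [← h.sum_pow]
      unfold charSum
      rw [Finset.sum_div]
      refine Red.sum fun r _ => ?_
      refine (((h.red_root W.pow_eq).pow r).mul (((h.red_div D r).pow (p - 1)).mul
        (h.red_all D r).2)).congr ?_ (by simp)
      rw [Pi.mul_apply, Pi.pow_apply, div_pow]
      ring
    exact h1.2
  have h3 := (W.recursion h D (p - 2)).2
  rw [show p - 2 + 1 = p - 1 by omega, h1, W.lam_pow_eq_zero h D (by omega : p ≤ p - 2 + 4),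
    Nat.cast_sub h2, h.cast_p] at h3
  push_cast at h3
  linear_combination -h3

/-- The three-term recursion for the power sums. -/
lemma Twist.recursion_pow (h : Place p a b π V) (D : DivVal p π T c) (W : Twist V p (T 1) x Y)
    (m : ℕ) :
    ((m : IsLocalRing.ResidueField V) + 2) * (((m : IsLocalRing.ResidueField V) + 1) *
      lam V p (T 1) x (T ^ m) - ((m : IsLocalRing.ResidueField V) + 3) *
      lam V p (T 1) x (T ^ (m + 4))) = Y ^ 2 * lam V p (T 1) x (T ^ (m + 2)) := by
  have h1 := (W.recursion h D m).2
  have h2 := (W.recursion h D (m + 1)).1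
  rw [h1]
  push_cast at h2
  linear_combination Y * h2

end

end

section

open Filter Topology

section Determinant

open Polynomial

variable {K : Type*} [Field K]

lemma sign_revPerm (n : ℕ) :
    Equiv.Perm.sign (Fin.revPerm : Equiv.Perm (Fin n)) = (-1) ^ (n * (n - 1) / 2) := by
  rw [Equiv.Perm.sign_eq_prod_prod_Iio]
  have : ∀ j : Fin n, ∏ i ∈ Finset.Iio j,
      (if Fin.revPerm i < Fin.revPerm j then 1 else -1 : ℤˣ) = (-1) ^ (j : ℕ) := by
    intro j
    rw [Finset.prod_congr rfl (g := fun _ => -1), Finset.prod_const, Fin.card_Iio]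
    intro i hi
    have hi := Finset.mem_Iio.1 hi
    rw [if_neg]
    simp only [Fin.revPerm_apply, Fin.rev_lt_rev, not_lt]
    exact hi.le
  rw [Finset.prod_congr rfl fun j _ => this j, Finset.prod_pow_eq_pow_sum,
    Fin.sum_univ_eq_sum_range (fun i => i), Finset.sum_range_id]

lemma det_eval_polynomials {n : ℕ} (v : Fin n → K) (F : ℕ → K[X])
    (hF : ∀ j, (F j).natDegree ≤ j) :
    (Matrix.of fun i j : Fin n => (F j).eval (v i)).det =
      (Matrix.vandermonde v).det * ∏ j : Fin n, (F j).coeff j := by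
  rw [Matrix.eval_matrixOfPolynomials_eq_vandermonde_mul_matrixOfPolynomials v (fun j => F j)
    (fun i => hF i), Matrix.det_mul, Matrix.det_of_isUpperTriangular
    (Matrix.matrixOfPolynomials_blockTriangular (fun j : Fin n => F j) (fun i => hF i))]
  rfl

lemma exists_polynomials (α β : ℕ → K) : ∃ P Q : ℕ → K[X],
    (∀ j, (P j).natDegree ≤ j ∧ (Q j).natDegree ≤ j ∧
      (P j).coeff j = ∏ l ∈ Finset.range (2 * j), β l ∧
      (Q j).coeff j = ∏ l ∈ Finset.range (2 * j + 1), β l) ∧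
    P 0 = 1 ∧ Q 0 = C (β 0) ∧
    (∀ j, P (j + 1) = C (α (2 * j)) * P j + C (β (2 * j + 1)) * (X * Q j)) ∧
    (∀ j, Q (j + 1) = C (α (2 * j + 1)) * Q j + C (β (2 * j + 2)) * P (j + 1)) := by
  let G : ℕ → K[X] × K[X] := fun j => Nat.rec (1, C (β 0)) (fun j g =>
    (C (α (2 * j)) * g.1 + C (β (2 * j + 1)) * (X * g.2),
      C (α (2 * j + 1)) * g.2 + C (β (2 * j + 2)) *
        (C (α (2 * j)) * g.1 + C (β (2 * j + 1)) * (X * g.2)))) j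
  refine ⟨fun j => (G j).1, fun j => (G j).2, ?_, rfl, rfl, fun _ => rfl, fun _ => rfl⟩
  intro j
  induction j with
  | zero => simp [G]
  | succ j ih =>
    obtain ⟨i1, i2, i3, i4⟩ := ih
    dsimp only at i1 i2 i3 i4 ⊢
    have e1 : (G (j + 1)).1 = C (α (2 * j)) * (G j).1 + C (β (2 * j + 1)) * (X * (G j).2) := rfl
    have e2 : (G (j + 1)).2 = C (α (2 * j + 1)) * (G j).2 + C (β (2 * j + 2)) * (G (j + 1)).1 :=
      rfl
    have d1 : (G (j + 1)).1.natDegree ≤ j + 1 := by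
      rw [e1]
      refine natDegree_add_le_of_degree_le ((natDegree_C_mul_le _ _).trans (by omega))
        ((natDegree_C_mul_le _ _).trans (natDegree_mul_le.trans ?_))
      have := natDegree_X_le (R := K)
      omega
    have c1 : (G (j + 1)).1.coeff (j + 1) = ∏ l ∈ Finset.range (2 * (j + 1)), β l := by
      rw [e1, coeff_add, coeff_C_mul, coeff_C_mul, coeff_X_mul, i4,
        coeff_eq_zero_of_natDegree_lt (by omega), mul_zero, zero_add,
        show 2 * (j + 1) = 2 * j + 1 + 1 by ring, Finset.prod_range_succ _ (2 * j + 1)]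
      ring
    refine ⟨d1, ?_, c1, ?_⟩
    · rw [e2]
      exact natDegree_add_le_of_degree_le ((natDegree_C_mul_le _ _).trans (by omega))
        ((natDegree_C_mul_le _ _).trans d1)
    · rw [e2, coeff_add, coeff_C_mul, coeff_C_mul, c1,
        coeff_eq_zero_of_natDegree_lt (by omega), mul_zero, zero_add,
        Finset.prod_range_succ _ (2 * (j + 1)), mul_comm]
      rfl

lemma eval_polynomials {α β : ℕ → K} {P Q : ℕ → K[X]} (hP0 : P 0 = 1) (hQ0 : Q 0 = C (β 0))
    (hP : ∀ j, P (j + 1) = C (α (2 * j)) * P j + C (β (2 * j + 1)) * (X * Q j))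
    (hQ : ∀ j, Q (j + 1) = C (α (2 * j + 1)) * Q j + C (β (2 * j + 2)) * P (j + 1))
    {n : ℕ} {y : K} {B : ℕ → K} (h0 : B 1 = β 0 * y * B 0)
    (hB : ∀ i, i + 2 < 2 * n → B (i + 2) = α i * B i + β (i + 1) * y * B (i + 1))
    {j : ℕ} (hj : j < n) :
    B (2 * j) = (P j).eval (y ^ 2) * B 0 ∧ B (2 * j + 1) = y * (Q j).eval (y ^ 2) * B 0 := by
  induction j with
  | zero => simp [hP0, hQ0, h0, mul_comm y]
  | succ j ih =>
    obtain ⟨i1, i2⟩ := ih (by omega)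
    have e1 : B (2 * (j + 1)) = (P (j + 1)).eval (y ^ 2) * B 0 := by
      rw [show 2 * (j + 1) = 2 * j + 2 by ring, hB _ (by omega), i1, i2, hP]
      simp only [eval_add, eval_mul, eval_C, eval_X]
      ring
    refine ⟨e1, ?_⟩
    rw [show 2 * (j + 1) + 1 = 2 * j + 1 + 2 by ring, hB _ (by omega), i2,
      show 2 * j + 1 + 1 = 2 * (j + 1) by ring, e1, hQ, show 2 * j + 2 = 2 * (j + 1) by ring]
    simp only [eval_add, eval_mul, eval_C]
    ring

lemma prod_range_odd_even (k : ℕ) :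
    ∏ l ∈ Finset.range k, (-(((2 * l + 1 : ℕ) : K) * ((2 * l + 2 : ℕ) : K))⁻¹) =
      (-1) ^ k * (((2 * k).factorial : ℕ) : K)⁻¹ := by
  induction k with
  | zero => simp
  | succ k ih =>
    rw [Finset.prod_range_succ, ih, show 2 * (k + 1) = 2 * k + 1 + 1 by ring, Nat.factorial_succ,
      Nat.factorial_succ, Nat.cast_mul, Nat.cast_mul, pow_succ]
    simp only [mul_inv]
    ring

lemma prod_range_even_odd (k : ℕ) :
    ∏ l ∈ Finset.range k, (((2 * l + 2 : ℕ) : K) * ((2 * l + 3 : ℕ) : K))⁻¹ =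
      (((2 * k + 1).factorial : ℕ) : K)⁻¹ := by
  induction k with
  | zero => simp
  | succ k ih =>
    rw [Finset.prod_range_succ, ih, show 2 * (k + 1) + 1 = 2 * k + 1 + 1 + 1 by ring,
      Nat.factorial_succ (2 * k + 1 + 1), Nat.factorial_succ (2 * k + 1), Nat.cast_mul,
      Nat.cast_mul]
    simp only [mul_inv]
    ring

lemma prod_factorial_aux (n : ℕ) :
    (∏ j ∈ Finset.range n, ((4 * j + 1) * (4 * j + 2) * (4 * j + 3))) * (4 ^ n * n.factorial) =
      (4 * n).factorial := by
  induction n with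
  | zero => simp
  | succ n ih =>
    rw [Finset.prod_range_succ, show 4 * (n + 1) = 4 * n + 1 + 1 + 1 + 1 by ring,
      Nat.factorial_succ (4 * n + 1 + 1 + 1), Nat.factorial_succ (4 * n + 1 + 1),
      Nat.factorial_succ (4 * n + 1), Nat.factorial_succ (4 * n), ← ih, Nat.factorial_succ]
    ring

/-- A sequence satisfying the three-term recursion in characteristic `p`. -/
structure RecSeq (p : ℕ) (Y : K) (A : ℕ → K) : Prop where
  recursion : ∀ m : ℕ, ((m : K) + 2) * (((m : K) + 1) * A m - ((m : K) + 3) * A (m + 4)) =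
    Y ^ 2 * A (m + 2)
  init : -2 * A 3 = Y ^ 2 * A 1
  vanish : A p = 0
  last : A (p - 2) = Y

variable {p n : ℕ} [CharP K p] {Y : K} {A : ℕ → K}

lemma cast_ne_zero_of_lt {k : ℕ} (h0 : 0 < k) (hk : k < p) : (k : K) ≠ 0 := by
  rw [Ne, CharP.cast_eq_zero_iff K p]
  exact fun hd => absurd (Nat.le_of_dvd h0 hd) (by omega)

lemma RecSeq.step_up (hn : p = 4 * n + 1) (R : RecSeq p Y A) {i : ℕ} (hi : i + 2 < 2 * n) :
    A (2 * (i + 2) + 1) = ((2 * i + 2 : ℕ) : K) * ((2 * i + 4 : ℕ) : K)⁻¹ * A (2 * i + 1) +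
      -(((2 * (i + 1) + 1 : ℕ) : K) * ((2 * (i + 1) + 2 : ℕ) : K))⁻¹ * Y ^ 2 *
        A (2 * (i + 1) + 1) := by
  have h1 := R.recursion (2 * i + 1)
  have h3 : ((2 * (i + 1) + 1 : ℕ) : K) ≠ 0 := cast_ne_zero_of_lt (p := p) (by omega) (by omega)
  have h4 : ((2 * (i + 1) + 2 : ℕ) : K) ≠ 0 := cast_ne_zero_of_lt (p := p) (by omega) (by omega)
  rw [show 2 * i + 4 = 2 * (i + 1) + 2 by ring]
  rw [show 2 * i + 1 + 4 = 2 * (i + 2) + 1 by ring, show 2 * i + 1 + 2 = 2 * (i + 1) + 1 by ring]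
    at h1
  field_simp
  push_cast at h1 ⊢
  linear_combination -h1

lemma RecSeq.step_down (hn : p = 4 * n + 1) (R : RecSeq p Y A) {i : ℕ} (hi : i + 2 < 2 * n) :
    A (p - (2 * (i + 2) + 2)) =
      ((2 * i + 3 : ℕ) : K) * ((2 * i + 5 : ℕ) : K)⁻¹ * A (p - (2 * i + 2)) +
      (((2 * (i + 1) + 2 : ℕ) : K) * ((2 * (i + 1) + 3 : ℕ) : K))⁻¹ * Y ^ 2 *
        A (p - (2 * (i + 1) + 2)) := by
  have h1 := R.recursion (p - (2 * (i + 2) + 2))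
  have h3 : ((2 * (i + 1) + 2 : ℕ) : K) ≠ 0 := cast_ne_zero_of_lt (p := p) (by omega) (by omega)
  have h4 : ((2 * (i + 1) + 3 : ℕ) : K) ≠ 0 := cast_ne_zero_of_lt (p := p) (by omega) (by omega)
  rw [show 2 * i + 5 = 2 * (i + 1) + 3 by ring]
  rw [show p - (2 * (i + 2) + 2) + 4 = p - (2 * i + 2) by omega,
    show p - (2 * (i + 2) + 2) + 2 = p - (2 * (i + 1) + 2) by omega,
    Nat.cast_sub (by omega), CharP.cast_eq_zero K p] at h1
  field_simp
  push_cast at h1 ⊢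
  linear_combination h1

lemma RecSeq.first_down (hn : p = 4 * n + 1) (h0 : 0 < n) (R : RecSeq p Y A) :
    A (p - (2 * 1 + 2)) = (((2 * 0 + 2 : ℕ) : K) * ((2 * 0 + 3 : ℕ) : K))⁻¹ * Y ^ 2 *
      A (p - (2 * 0 + 2)) := by
  have h1 := R.recursion (p - 4)
  have h3 : ((2 : ℕ) : K) ≠ 0 := cast_ne_zero_of_lt (p := p) (by omega) (by omega)
  have h4 : ((3 : ℕ) : K) ≠ 0 := cast_ne_zero_of_lt (p := p) (by omega) (by omega)
  rw [show p - 4 + 4 = p by omega, show p - 4 + 2 = p - 2 by omega, R.vanish,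
    Nat.cast_sub (by omega), CharP.cast_eq_zero K p] at h1
  simp only [mul_one, mul_zero, zero_add, Nat.reduceAdd]
  field_simp
  push_cast at h1 ⊢
  linear_combination h1

lemma RecSeq.first_up (hn : p = 4 * n + 1) (h0 : 0 < n) (R : RecSeq p Y A) :
    A (2 * 1 + 1) = -(((2 * 0 + 1 : ℕ) : K) * ((2 * 0 + 2 : ℕ) : K))⁻¹ * Y ^ 2 *
      A (2 * 0 + 1) := by
  have h1 := R.init
  have h3 : ((2 : ℕ) : K) ≠ 0 := cast_ne_zero_of_lt (p := p) (by omega) (by omega)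
  norm_num at h1 h3 ⊢
  field_simp
  linear_combination -h1

lemma RecSeq.prod_fin (hp : p.Prime) (hn : p = 4 * n + 1) (Y : Fin n → K) (A : Fin n → ℕ → K)
    (R : ∀ i, RecSeq p (Y i) (A i)) (hY : Function.Injective fun i => Y i ^ 4) :
    ∏ i, A i 1 = -((-1) ^ (n * (n - 1) / 2) * 4 ^ n * (n.factorial : K) * ∏ i, Y i ^ 3) := by
  obtain ⟨α, hα⟩ : ∃ α : ℕ → K, ∀ i, α i =
    ((2 * i + 2 : ℕ) : K) * ((2 * i + 4 : ℕ) : K)⁻¹ := ⟨_, fun _ => rfl⟩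
  obtain ⟨β, hβ⟩ : ∃ β : ℕ → K, ∀ i, β i =
    -(((2 * i + 1 : ℕ) : K) * ((2 * i + 2 : ℕ) : K))⁻¹ := ⟨_, fun _ => rfl⟩
  obtain ⟨α', hα'⟩ : ∃ α : ℕ → K, ∀ i, α i =
    ((2 * i + 3 : ℕ) : K) * ((2 * i + 5 : ℕ) : K)⁻¹ := ⟨_, fun _ => rfl⟩
  obtain ⟨β', hβ'⟩ : ∃ β : ℕ → K, ∀ i, β i =
    (((2 * i + 2 : ℕ) : K) * ((2 * i + 3 : ℕ) : K))⁻¹ := ⟨_, fun _ => rfl⟩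
  obtain ⟨P, Q, hPQ, hP0, hQ0, hP, hQ⟩ := exists_polynomials α β
  obtain ⟨P', Q', hPQ', hP0', hQ0', hP', hQ'⟩ := exists_polynomials α' β'
  set v : Fin n → K := fun i => Y i ^ 4 with hv
  have hV := Matrix.det_vandermonde_ne_zero_iff.2 hY
  have hn0 : ∀ i : Fin n, 0 < n := fun i => i.pos
  have up : ∀ i j : Fin n, A i (4 * j + 1) = A i 1 * (P j).eval (v i) := by
    intro i j
    have := (eval_polynomials hP0 hQ0 hP hQ (n := n) (y := Y i ^ 2)
      (B := fun k => A i (2 * k + 1)) (by rw [hβ]; exact (R i).first_up hn (hn0 i))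
      (fun k hk => by rw [hα, hβ]; exact (R i).step_up hn hk) j.2).1
    simp only [mul_zero, zero_add, ← pow_mul] at this
    rw [show 4 * (j : ℕ) + 1 = 2 * (2 * j) + 1 by ring, this]
    ring
  have down : ∀ i j : Fin n, A i (4 * (Fin.revPerm j : Fin n) + 1) =
      Y i ^ 3 * (Q' j).eval (v i) := by
    intro i j
    have := (eval_polynomials hP0' hQ0' hP' hQ' (n := n) (y := Y i ^ 2)
      (B := fun k => A i (p - (2 * k + 2))) (by rw [hβ']; exact (R i).first_down hn (hn0 i))
      (fun k hk => by rw [hα', hβ']; exact (R i).step_down hn hk) j.2).2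
    simp only [mul_zero, zero_add, ← pow_mul, (R i).last] at this
    have hj := j.2
    rw [Fin.revPerm_apply, Fin.val_rev,
      show 4 * (n - (j + 1)) + 1 = p - (2 * (2 * (j : ℕ) + 1) + 2) by omega, this]
    ring
  set M : Matrix (Fin n) (Fin n) K := Matrix.of fun i j => A i (4 * j + 1) with hM
  have d1 : M.det = (∏ i, A i 1) * ((Matrix.vandermonde v).det *
      ∏ j : Fin n, ((((4 * (j : ℕ)).factorial : ℕ) : K)⁻¹)) := by
    have : M = Matrix.of fun i j => A i 1 * (Matrix.of fun i j : Fin n => (P j).eval (v i)) i j := by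
      ext i j; exact up i j
    rw [this, Matrix.det_mul_column, det_eval_polynomials v P fun j => (hPQ j).1]
    congr 2
    refine Finset.prod_congr rfl fun j _ => ?_
    rw [(hPQ j).2.2.1, Finset.prod_congr rfl fun l _ => hβ l, prod_range_odd_even, pow_mul,
      show 2 * (2 * (j : ℕ)) = 4 * j by ring, neg_one_sq, one_pow, one_mul]
  have d2 : ((Equiv.Perm.sign (Fin.revPerm : Equiv.Perm (Fin n)) : ℤ) : K) * M.det =
      (∏ i, Y i ^ 3) * ((Matrix.vandermonde v).det *
      ∏ j : Fin n, ((((4 * (j : ℕ) + 3).factorial : ℕ) : K)⁻¹)) := by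
    rw [← Matrix.det_permute']
    have : M.submatrix id Fin.revPerm = Matrix.of fun i j =>
        Y i ^ 3 * (Matrix.of fun i j : Fin n => (Q' j).eval (v i)) i j := by
      ext i j; exact down i j
    rw [this, Matrix.det_mul_column, det_eval_polynomials v Q' fun j => (hPQ' j).2.1]
    congr 2
    refine Finset.prod_congr rfl fun j _ => ?_
    rw [(hPQ' j).2.2.2, Finset.prod_congr rfl fun l _ => hβ' l, prod_range_even_odd,
      show 2 * (2 * (j : ℕ) + 1) + 1 = 4 * j + 3 by ring]
  have := Fact.mk hp
  have w1 : (((4 * n).factorial : ℕ) : K) = -1 := by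
    have h1 := congrArg (ZMod.castHom (dvd_refl p) K) (ZMod.wilsons_lemma p)
    rw [map_natCast, map_neg, map_one, show p - 1 = 4 * n by omega] at h1
    exact h1
  have w2 := congrArg (Nat.cast (R := K)) (prod_factorial_aux n)
  rw [w1] at w2
  push_cast at w2
  set r : K := ∏ j ∈ Finset.range n, ((4 * (j : K) + 1) * (4 * j + 2) * (4 * j + 3)) with hr
  have hr0 : r ≠ 0 := by
    intro h0
    rw [h0, zero_mul] at w2
    exact one_ne_zero (neg_eq_zero.1 w2.symm)
  set f : K := ∏ j : Fin n, ((((4 * (j : ℕ)).factorial : ℕ) : K)⁻¹) with hf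
  have hf0 : f ≠ 0 := by
    refine Finset.prod_ne_zero_iff.2 fun j _ => inv_ne_zero ?_
    have hj := j.2
    rw [Ne, CharP.cast_eq_zero_iff K p, hp.dvd_factorial]
    omega
  have hq : ∏ j : Fin n, ((((4 * (j : ℕ) + 3).factorial : ℕ) : K)⁻¹) = f * r⁻¹ := by
    rw [hr, ← Fin.prod_univ_eq_prod_range
      (fun j : ℕ => ((4 * (j : K) + 1) * (4 * j + 2) * (4 * j + 3))) n, ← Finset.prod_inv_distrib,
      ← Finset.prod_mul_distrib]
    refine Finset.prod_congr rfl fun j _ => ?_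
    rw [Nat.factorial_succ, Nat.factorial_succ, Nat.factorial_succ]
    push_cast
    simp only [mul_inv]
    ring_nf
  rw [hq, d1, sign_revPerm] at d2
  push_cast at d2
  set s : K := (-1) ^ (n * (n - 1) / 2) with hs
  have hs2 : s * s = 1 := by
    rw [hs, ← mul_pow]; norm_num
  have hr1 : r⁻¹ = -(4 ^ n * (n.factorial : K)) := by
    rw [inv_eq_iff_eq_inv, eq_comm, inv_eq_iff_eq_inv, eq_comm]
    refine inv_eq_of_mul_eq_one_right ?_
    linear_combination -w2
  rw [hr1] at d2
  refine mul_right_cancel₀ (mul_ne_zero hV hf0) ?_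
  linear_combination s * d2 - (∏ i, A i 1) * (Matrix.vandermonde v).det * f * hs2

theorem RecSeq.prod {ι : Type*} (hp : p.Prime) {S : Finset ι} (hn : p = 4 * S.card + 1)
    {Y : ι → K} {A : ι → ℕ → K} (R : ∀ i ∈ S, RecSeq p (Y i) (A i))
    (hY : ∀ i ∈ S, ∀ j ∈ S, Y i ^ 4 = Y j ^ 4 → i = j) :
    ∏ i ∈ S, A i 1 = -((-1) ^ (S.card * (S.card - 1) / 2) * 4 ^ S.card * (S.card.factorial : K) *
      ∏ i ∈ S, Y i ^ 3) := by
  have e := S.equivFin.symm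
  have h1 := RecSeq.prod_fin hp hn (fun i => Y (e i)) (fun i => A (e i)) (fun i => R _ (e i).2)
    (fun i j hij => e.injective (Subtype.ext (hY _ (e i).2 _ (e j).2 hij)))
  rw [← Finset.prod_coe_sort, ← Finset.prod_coe_sort S (fun i => Y i ^ 3),
    ← e.prod_comp (fun i : S => A i 1), ← e.prod_comp (fun i : S => Y i ^ 3)]
  exact h1

end Determinant

end

section

open Filter Topology

section

variable {p : ℕ} {a b : ℤ} {π : ℂ} {V : ValuationSubring ℂ}

/-- The division values `sl ((1-i) r ϖ / π)`. -/
def tF (π : ℂ) (r : ℤ) : ℂ := sF ((1 - I) * r / π)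

lemma Data.divVal (h : Data p a b π) {S : Finset ℂ} (hS : IsQuarterSet π S) :
    DivVal p π (tF π) (fun r : ℤ => cF ((1 - I) * r / π)) := by
  have h0 := h.ne_zero
  have hc : ∀ r : ℤ, GCong ((r + p : ℤ) : ℂ) (r : ℂ) π := fun r =>
    h.gcong_int.2 ⟨1, by ring⟩
  have e : ∀ r s : ℤ, (1 - I) * ((r + s : ℤ) : ℂ) / π = (1 - I) * r / π + (1 - I) * s / π := by
    intro r s; push_cast; ring
  refine ⟨fun r => h.sF_congr (hc r), fun r => h.cF_congr (hc r), by simp [tF, sF_zero],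
    by simp [cF_zero], fun r => cF_sq (h.div_add_T0_notMem (int_mem_O4 r)), fun r s => ?_,
    fun r s => ?_, ?_⟩
  · have i1 := h.div_add_T0_notMem (int_mem_O4 r)
    have i2 := h.div_add_T0_notMem (int_mem_O4 s)
    have i3 := h.div_add_T0_notMem (int_mem_O4 (r + s))
    rw [e] at i3
    unfold tF
    rw [e]
    exact sF_add i1 i2 i3
  · have i1 := h.div_add_T0_notMem (int_mem_O4 r)
    have i2 := h.div_add_T0_notMem (int_mem_O4 s)
    have i3 := h.div_add_T0_notMem (int_mem_O4 (r + s))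
    rw [e] at i3
    unfold tF
    rw [e]
    exact cF_add i1 i2 i3
  · exact (Finset.prod_congr rfl fun r _ => by rw [tF, Int.cast_natCast]).trans (h.prod_sF hS)

lemma ee_nat_mul (p : ℕ) (k : ℕ) (s : ℤ) : ee p (k * s) = ee p s ^ k := by
  unfold ee
  rw [← exp_nat_mul]
  congr 1
  push_cast
  ring

lemma ee_neg (p : ℕ) (s : ℤ) : ee p (-s) = (ee p s)⁻¹ := by
  refine eq_inv_of_mul_eq_one_left ?_
  rw [← ee_add, neg_add_cancel, ee_zero]

lemma isPrimitiveRoot_ee {p : ℕ} (hp : p ≠ 0) : IsPrimitiveRoot (ee p 1) p := by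
  have := Complex.isPrimitiveRoot_exp p hp
  unfold ee
  simpa using this

lemma Data.ee_eq_pow (h : Data p a b π) (m : ℤ) :
    ∃ k : ℕ, (p : ℤ) ∣ m - k ∧ ee p m = ee p 1 ^ k := by
  have hp : (0 : ℤ) < p := by exact_mod_cast h.prime.pos
  have e : (p : ℤ) ∣ m - (m % p).toNat := by
    rw [Int.toNat_of_nonneg (Int.emod_nonneg _ hp.ne')]
    exact Int.dvd_self_sub_emod
  refine ⟨_, e, ?_⟩
  rw [← ee_nat_mul, mul_one, ee_congr h.prime.ne_zero e]

lemma Place.red_ee_sub_one (h : Place p a b π V) (m : ℤ) :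
    Red V ((ee p m - 1) / (ee p 1 - 1)) m := by
  obtain ⟨k, hk, e⟩ := h.data.ee_eq_pow m
  rw [e]
  refine (h.red_pow_sub_one (isPrimitiveRoot_ee h.data.prime.ne_zero) k).congr rfl ?_
  have := h.cast_int_eq_zero.2 hk
  push_cast at this
  exact (sub_eq_zero.1 this).symm

variable {T c : ℤ → ℂ}

lemma Place.twist (h : Place p a b π V) (D : DivVal p π T c) {C : IsLocalRing.ResidueField V}
    (hC : Red V ((ee p 1 - 1) / T 1) C) (hC0 : C ≠ 0) {m : ℤ} (hm : ¬ (p : ℤ) ∣ m) :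
    Twist V p (T 1) (ee p (-m)) (m * C) := by
  have hz := isPrimitiveRoot_ee h.data.prime.ne_zero
  have hz1 : ee p 1 - 1 ≠ 0 := sub_ne_zero.2 (hz.ne_one h.data.prime.one_lt)
  have ht := h.T_one_ne_zero D
  have key : ∀ m : ℤ, Red V ((ee p m - 1) / T 1) (m * C) := fun m =>
    ((h.red_ee_sub_one m).mul hC).congr (by field_simp) rfl
  have hm0 : ((-m : ℤ) : IsLocalRing.ResidueField V) * C ≠ 0 := by
    refine mul_ne_zero ?_ hC0
    rw [Ne, h.cast_int_eq_zero, dvd_neg]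
    exact hm
  refine ⟨?_, ?_, ?_, ?_⟩
  · rw [← ee_nat_mul, ee_mul_self h.data.prime.ne_zero]
  · intro h1
    have := (key (-m)).ne_zero hm0
    rw [h1, sub_self, zero_div] at this
    exact this rfl
  · have := ((key (-m)).inv hm0).1
    rwa [inv_div] at this
  · rw [ee_neg, inv_inv]
    exact key m

lemma Twist.recSeq {x : ℂ} {Y : IsLocalRing.ResidueField V} (h : Place p a b π V)
    (D : DivVal p π T c) (W : Twist V p (T 1) x Y) :
    RecSeq p Y (fun m => lam V p (T 1) x (T ^ m)) where
  recursion m := W.recursion_pow h D m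
  init := by simpa using W.recursion_zero h D
  vanish := W.lam_pow_eq_zero h D le_rfl
  last := W.lam_pow_pred h D

/-- The reduction of the division values of order `π̄`. -/
lemma Place.red_sF_conj (h : Place p a b π V) {S : Finset ℂ} (hS : IsQuarterSet π S)
    {C : IsLocalRing.ResidueField V} (hC : Red V ((ee p 1 - 1) / tF π 1) C) (hC0 : C ≠ 0) {s : ℤ}
    (hs : ¬ (p : ℤ) ∣ s) :
    ∃ A : ℕ → IsLocalRing.ResidueField V, RecSeq p (2 * b * s * C) A ∧
      Red V (sF ((1 - I) * s / (starRingEnd ℂ) π)) (-A 1) := by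
  have D := h.data.divVal hS
  have ht := h.T_one_ne_zero D
  have hπ := h.data.ne_zero
  have hm : ¬ (p : ℤ) ∣ 2 * b * s := by
    have hp := h.data.prime_int
    rw [hp.dvd_mul, hp.dvd_mul, not_or, not_or]
    refine ⟨⟨fun h2 => ?_, h.data.not_dvd_b⟩, hs⟩
    have := Int.le_of_dvd (by norm_num) h2
    have h3 := h.data.mod4
    have h4 := h.data.prime.one_lt
    omega
  have W := h.twist D hC hC0 hm
  push_cast at W
  refine ⟨_, W.recSeq h D, ?_⟩
  have e : charSum p (ee p (-(2 * b * s))) (tF π) =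
      π * sF ((1 - I) * s / (starRingEnd ℂ) π) := by
    rw [← h.data.sum_ee_mul_sF]
    refine Finset.sum_congr rfl fun r _ => ?_
    rw [← ee_nat_mul, tF, Int.cast_natCast]
    congr 2
    ring
  have h1 : Red V (charSum p (ee p (-(2 * b * s))) (tF π) / tF π 1 ^ (p - 1))
      (lam V p (tF π 1) (ee p (-(2 * b * s))) (tF π ^ 1)) := by
    rw [pow_one]
    exact Red.of_mem (W.charSum_mem h D (h.smooth_aux D).choose_spec.choose_spec.1)
  refine (h1.div (h.red_pi D) (by simp)).congr ?_ (by rw [div_neg, div_one])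
  rw [e]
  field_simp

end

end

section

open Filter Topology

section

variable {p : ℕ} {a b : ℤ} {π : ℂ} {V : ValuationSubring ℂ}

/-- Moments of the binomial-coefficient character sum. -/
def chooseSum (p : ℕ) (x : ℂ) (k j : ℕ) : ℂ := ∑ r ∈ Finset.range p, (r : ℂ) ^ j * r.choose k * x ^ r

lemma chooseSum_succ (p : ℕ) (x : ℂ) (k j : ℕ) :
    chooseSum p x k (j + 1) = (k + 1) * chooseSum p x (k + 1) j + k * chooseSum p x k j := by
  unfold chooseSum
  rw [Finset.mul_sum, Finset.mul_sum, ← Finset.sum_add_distrib]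
  refine Finset.sum_congr rfl fun r _ => ?_
  have : (r : ℂ) * r.choose k = (k + 1) * r.choose (k + 1) + k * r.choose k := by
    have h := Nat.choose_succ_right_eq r k
    by_cases hk : k ≤ r
    · have h2 : (r.choose (k + 1) : ℂ) * (k + 1) = r.choose k * (r - k) := by
        rw [← Nat.cast_sub hk]; exact_mod_cast h
      linear_combination -h2
    · rw [Nat.choose_eq_zero_of_lt (by omega), Nat.choose_eq_zero_of_lt (by omega)]; simp
  rw [pow_succ]
  linear_combination (r : ℂ) ^ j * x ^ r * this

lemma chooseSum_zero_succ (p : ℕ) (x : ℂ) (k : ℕ) (hx : x ^ p = 1) :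
    (x - 1) * chooseSum p x (k + 1) 0 = p.choose (k + 1) - x * chooseSum p x k 0 := by
  have h := Finset.sum_range_sub (fun r : ℕ => (r.choose (k + 1) : ℂ) * x ^ r) p
  simp only [hx, Nat.choose_zero_succ] at h
  unfold chooseSum
  rw [Finset.mul_sum, Finset.mul_sum]
  have h2 : ∑ r ∈ Finset.range p, (((r + 1).choose (k + 1) : ℂ) * x ^ (r + 1) -
      (r.choose (k + 1) : ℂ) * x ^ r) = ∑ r ∈ Finset.range p, (x - 1) * ((r : ℂ) ^ 0 *
      r.choose (k + 1) * x ^ r) + ∑ r ∈ Finset.range p, x * ((r : ℂ) ^ 0 * r.choose k * x ^ r) := by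
    rw [← Finset.sum_add_distrib]
    refine Finset.sum_congr rfl fun r _ => ?_
    rw [Nat.choose_succ_succ]
    push_cast
    ring
  rw [h2] at h
  linear_combination h

lemma Place.red_chooseSum_zero (h : Place p a b π V) {x : ℂ} (hx : IsPrimitiveRoot x p) (k : ℕ)
    (hk : k + 1 < p) : Red V (chooseSum p x (k + 1) 0 * (x - 1) ^ (k + 1) / p) ((-1) ^ k) := by
  have hp := h.data.p_ne_zero
  have hx1 : x ≠ 1 := hx.ne_one h.data.prime.one_lt
  induction k with
  | zero =>
    have h0 : chooseSum p x 0 0 = 0 := by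
      simp [chooseSum, geom_sum_eq hx1, hx.pow_eq_one]
    have h1 := chooseSum_zero_succ p x 0 hx.pow_eq_one
    rw [h0] at h1
    refine Red.one.congr ?_ (by simp)
    rw [eq_div_iff hp]
    simp at h1 ⊢
    linear_combination -h1
  | succ k ih =>
    have h1 := chooseSum_zero_succ p x (k + 1) hx.pow_eq_one
    have hx0 : Red V (x - 1) 0 := ((h.red_root hx.pow_eq_one).sub Red.one).congr rfl (sub_self _)
    obtain ⟨c, hc⟩ := h.data.prime.dvd_choose_self (by omega : k + 2 ≠ 0) hk
    have hc' : ((p.choose (k + 2) : ℕ) : ℂ) = p * c := by exact_mod_cast congrArg (Nat.cast (R := ℂ)) hc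
    refine (((hx0.pow (k + 1)).mul (Red.nat c)).sub
      ((h.red_root hx.pow_eq_one).mul (ih (by omega)))).congr ?_ (by simp [pow_succ])
    rw [eq_div_iff hp, show k + 1 + 1 = k + 2 by ring, pow_succ (x - 1) (k + 1)]
    rw [show k + 1 + 1 = k + 2 by ring, hc'] at h1
    rw [sub_mul, mul_assoc x, div_mul_cancel₀ _ hp]
    linear_combination -(x - 1) ^ (k + 1) * h1

lemma Place.red_chooseSum (h : Place p a b π V) {x : ℂ} (hx : IsPrimitiveRoot x p) (j k : ℕ)
    (hk : k + 1 + j < p) : Red V ((k + 1).factorial *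
      (chooseSum p x (k + 1) j * (x - 1) ^ (k + 1 + j) / p))
      ((-1) ^ (k + j) * (k + 1 + j).factorial) := by
  induction j generalizing k with
  | zero =>
    exact ((Red.nat _).mul (h.red_chooseSum_zero hx k (by omega))).congr rfl (mul_comm _ _)
  | succ j ih =>
    have hx0 : Red V (x - 1) 0 := ((h.red_root hx.pow_eq_one).sub Red.one).congr rfl (sub_self _)
    refine ((ih (k + 1) (by omega)).add
      ((hx0.mul (Red.nat (k + 1))).mul (ih k (by omega)))).congr ?_ ?_
    · rw [chooseSum_succ, Nat.factorial_succ (k + 1)]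
      push_cast
      ring
    · rw [zero_mul, zero_mul, add_zero]
      congr 2 <;> ring_nf

/-- Power sums twisted by a `p`-th root of unity. -/
lemma Place.red_powSum (h : Place p a b π V) {x : ℂ} (hx : IsPrimitiveRoot x p) (n : ℕ)
    (hn : n + 1 < p) : Red V ((∑ r ∈ Finset.range p, (r : ℂ) ^ (n + 1) * x ^ r) *
      (x - 1) ^ (n + 1) / p) ((-1) ^ n * (n + 1).factorial) := by
  refine (h.red_chooseSum hx n 0 (by omega)).congr ?_ (by congr 2 <;> ring_nf)
  have := chooseSum_succ p x 0 n
  simp only [Nat.cast_zero, zero_add, one_mul, zero_mul, add_zero] at this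
  simp only [zero_add, Nat.factorial_one, Nat.cast_one, one_mul, ← this, add_comm 1 n]
  simp [chooseSum]

lemma G4sum_eq (p : ℕ) (χ : ℂ → ℂ) :
    G4sum p χ = ∑ r ∈ Finset.Icc 1 (p - 1), χ (r : ℂ) * ee p 1 ^ r := by
  refine Finset.sum_congr rfl fun r _ => ?_
  rw [← ee_nat_mul]
  simp [ee]

lemma Place.red_G4sum (h : Place p a b π V) {χ : ℂ → ℂ} (hχ : IsQuarticChar π p χ)
    {n : ℕ} (hn : p = 4 * n + 1) {S : Finset ℂ} (hS : IsQuarterSet π S) :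
    Red V (G4sum p χ / (ee p 1 - 1) ^ (3 * n)) ((-1) ^ n * n.factorial) := by
  have hp0 := h.data.p_ne_zero
  have D := h.data.divVal hS
  have hx := isPrimitiveRoot_ee h.data.prime.ne_zero
  have hx1 : ee p 1 - 1 ≠ 0 := sub_ne_zero.2 (hx.ne_one h.data.prime.one_lt)
  have hx0 : Red V (ee p 1 - 1) 0 := ((h.red_root hx.pow_eq_one).sub Red.one).congr rfl (sub_self _)
  have h5 := h.data.prime.two_le
  obtain ⟨m, rfl⟩ : ∃ m, n = m + 1 := ⟨n - 1, by omega⟩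
  have hp1 : p - 1 = 4 * (m + 1) := by omega
  have key : ∀ r : ℕ, ∃ d ∈ O4, r ∈ Finset.Icc 1 (p - 1) → χ (r : ℂ) - r ^ (m + 1) = π * d := by
    intro r
    by_cases hr : r ∈ Finset.Icc 1 (p - 1)
    · obtain ⟨h1, h2⟩ := Finset.mem_Icc.1 hr
      obtain ⟨d, hd, e⟩ := hχ.euler r (nat_mem_O4 r) (h.data.gcoprime_nat h1 h2)
      rw [show (p - 1) / 4 = m + 1 by omega] at e
      exact ⟨d, hd, fun _ => e⟩
    · exact ⟨0, O4.zero_mem, fun h => absurd h hr⟩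
  choose d hd hd' using key
  set E := ∑ r ∈ Finset.Icc 1 (p - 1), d r * ee p 1 ^ r with hE
  have hEV : E ∈ V := sum_mem_V fun r _ =>
    V.mul_mem _ _ (h.mem_V (hd r)) (pow_mem_V (h.red_root hx.pow_eq_one).1 r)
  have e1 : G4sum p χ = (∑ r ∈ Finset.range p, (r : ℂ) ^ (m + 1) * ee p 1 ^ r) + π * E := by
    have e2 : Finset.range p = insert 0 (Finset.Icc 1 (p - 1)) := by
      ext r; simp only [Finset.mem_range, Finset.mem_insert, Finset.mem_Icc]; omega
    rw [G4sum_eq, e2, Finset.sum_insert (by simp), hE, Finset.mul_sum]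
    simp only [Nat.cast_zero, ne_eq, Nat.add_eq_zero_iff, one_ne_zero, and_false,
      not_false_eq_true, zero_pow, zero_mul, zero_add]
    rw [← Finset.sum_add_distrib]
    refine Finset.sum_congr rfl fun r hr => ?_
    linear_combination ee p 1 ^ r * hd' r hr
  obtain ⟨C, hC, -, hC0⟩ := h.exists_ratio D hx
  have r1 := (h.red_powSum hx m (by omega)).mul (h.red_p hx)
  have hT := h.T_one_ne_zero D
  have hu : Red V (π / (ee p 1 - 1) ^ (p - 1)) (-1 / C ^ (p - 1)) := by
    refine ((h.red_pi D).div (hC.pow (p - 1)) (pow_ne_zero _ hC0)).congr ?_ rfl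
    rw [div_pow]
    field_simp
  have r2 := ((hu.mul (hx0.pow (m + 1))).mul (Red.of_mem hEV))
  refine (r1.add r2).congr ?_ ?_
  · rw [e1, hp1, show 4 * (m + 1) = 3 * (m + 1) + (m + 1) by ring, pow_add]
    field_simp
    ring
  · rw [pow_succ (-1 : IsLocalRing.ResidueField V) m, zero_pow (by omega)]
    ring

end

end

section

open Filter Topology

section

lemma sF_I_mul (v : ℂ) : sF (I * v) = I * sF v := by
  rw [sF_eq, sF_eq, EF_I_mul]
  by_cases h : EF v = 0
  · simp [h]
  · field_simp
    rw [I_sq]; ring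

lemma conj_sF (v : ℂ) : (starRingEnd ℂ) (sF v) = sF ((starRingEnd ℂ) v) := by
  have := conj_EF ((starRingEnd ℂ) v)
  rw [Complex.conj_conj] at this
  rw [sF_eq, sF_eq, map_div₀, this, conj_ofReal]

variable {p : ℕ} {a b : ℤ} {π γ : ℂ} {V : ValuationSubring ℂ} {S : Finset ℂ}

lemma Data.phi4_div (h : Data p a b π) {ν : ℂ} (hν : ν ∈ O4) (hc : GCoprime ν π) :
    phi4 (ν / π) = sF ((1 - I) * ν / π) := by
  rw [phi4_eq_sF, mul_div_assoc]
  rw [← mul_div_assoc, h.div_mem_Lat_iff hν]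
  intro h0
  obtain ⟨u, hu, v, hv, e⟩ := Data.gcoprime_congr h0 hc
  refine h.not_cong_one_zero ⟨v, hv, ?_⟩
  linear_combination -e

lemma Data.phi4_div_int (h : Data p a b π) {ν : ℂ} (hν : ν ∈ O4) (hc : GCoprime ν π) {r : ℤ}
    (hr : GCong ν r π) : phi4 (ν / π) = tF π r := by
  rw [h.phi4_div hν hc, h.sF_congr hr, tF]

lemma Data.conj_tF (r : ℤ) :
    (starRingEnd ℂ) (tF π r) = I * sF ((1 - I) * r / (starRingEnd ℂ) π) := by
  rw [tF, conj_sF, ← sF_I_mul]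
  congr 1
  simp only [map_div₀, map_mul, map_sub, map_one, conj_I, map_intCast]
  rw [← mul_div_assoc]
  congr 1
  linear_combination (r : ℂ) * I_sq

lemma gamma_pow_four (hn : p = 4 * S.card + 1) (hγ : IsGamma4 π p S γ) :
    γ ^ 4 = (-1) ^ (S.card + 1) := by
  rcases Nat.even_or_odd S.card with h | h
  · rw [(hγ.2 (by obtain ⟨k, hk⟩ := h; omega)).1, Odd.neg_one_pow h.add_one]
  · rw [(hγ.1 (by obtain ⟨k, hk⟩ := h; omega)).1, Even.neg_one_pow h.add_one]

lemma conj_gamma (hn : p = 4 * S.card + 1) (hγ : IsGamma4 π p S γ) :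
    (starRingEnd ℂ) γ = γ⁻¹ := by
  have h1 : ‖γ‖ ^ 4 = 1 := by
    rw [← norm_pow, gamma_pow_four hn hγ]; simp
  have h2 : ‖γ‖ = 1 := (pow_eq_one_iff_of_nonneg (norm_nonneg _) (by norm_num)).1 h1
  rw [Complex.inv_def, Complex.normSq_eq_norm_sq, h2]
  simp

/-- The canonical quartic root is a fourth root of `-π`. -/
lemma Data.root_pow_four (h : Data p a b π) (hS : IsQuarterSet π S) (hγ : IsGamma4 π p S γ) :
    (γ⁻¹ * ∏ ν ∈ S, phi4 (ν / π)) ^ 4 = -π := by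
  have hn := h.card_quarter hS
  have h1 := h.prod_quarter hS (fun α => sF ((1 - I) * α / π)) (fun x _ y _ hc => h.sF_congr hc)
  rw [h.prod_sF hS] at h1
  have h2 : π = (-1) ^ S.card * (∏ ν ∈ S, phi4 (ν / π)) ^ 4 := by
    rw [← Finset.prod_pow, ← Finset.prod_const, ← Finset.prod_mul_distrib]
    refine h1.trans ?_
    refine Finset.prod_congr rfl fun ν hν => ?_
    rw [h.phi4_div (hS.1 ν hν).1 (hS.1 ν hν).2,
      show (1 - I) * -ν / π = -((1 - I) * ν / π) by ring,
      show (1 - I) * (I * ν) / π = I * ((1 - I) * ν / π) by ring,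
      show (1 - I) * (I * -ν) / π = -(I * ((1 - I) * ν / π)) by ring,
      sF_neg, sF_neg, sF_I_mul]
    linear_combination (sF ((1 - I) * ν / π)) ^ 4 * I_sq
  rw [mul_pow, inv_pow, gamma_pow_four hn hγ]
  nth_rewrite 2 [h2]
  rw [pow_succ]
  have h3 : ((-1 : ℂ) ^ S.card) ^ 2 = 1 := by rw [← pow_mul, mul_comm, pow_mul]; norm_num
  have h4 : ((-1 : ℂ) ^ S.card) ≠ 0 := by simp
  field_simp
  rw [h3, one_mul]

lemma Place.gcong_of_res (h : Place p a b π V) {x y : ℂ} (hx : x ∈ O4) (hy : y ∈ O4)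
    (h0 : res V x = res V y) : GCong x y π := by
  obtain ⟨r, hr⟩ := h.data.exists_int_cong hx
  obtain ⟨s, hs⟩ := h.data.exists_int_cong hy
  refine hr.trans (GCong.trans ?_ hs.symm)
  rw [h.res_cong hx (int_mem_O4 r) hr, h.res_cong hy (int_mem_O4 s) hs, res_intCast,
    res_intCast, ← sub_eq_zero, ← Int.cast_sub, h.cast_int_eq_zero] at h0
  exact h.data.gcong_int.2 h0

lemma Place.eq_of_pow_four (h : Place p a b π V) (hS : IsQuarterSet π S) {ν μ : ℂ} (hν : ν ∈ S)
    (hμ : μ ∈ S) (he : res V ν ^ 4 = res V μ ^ 4) : ν = μ := by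
  have hν' := (hS.1 ν hν).1
  have hμ' := (hS.1 μ hμ).1
  have hk : ∃ k : ℕ, res V ν = res V (I ^ k * μ) := by
    have : (res V ν - res V μ) * ((res V ν + res V μ) * ((res V ν - res V I * res V μ) *
        (res V ν + res V I * res V μ))) = 0 := by
      linear_combination he + (res V μ ^ 4 - res V ν ^ 2 * res V μ ^ 2) * h.res_I
    have hI := h.I_mem
    simp only [mul_eq_zero] at this
    rcases this with h1 | h1 | h1 | h1
    · exact ⟨0, by simpa using sub_eq_zero.1 h1⟩
    · refine ⟨2, ?_⟩
      rw [I_sq, neg_one_mul, res_neg (h.mem_V hμ')]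
      exact eq_neg_of_add_eq_zero_left h1
    · refine ⟨1, ?_⟩
      rw [pow_one, res_mul hI (h.mem_V hμ')]
      exact sub_eq_zero.1 h1
    · refine ⟨3, ?_⟩
      rw [I_pow_three, neg_mul, res_neg (V.mul_mem _ _ hI (h.mem_V hμ')),
        res_mul hI (h.mem_V hμ')]
      exact eq_neg_of_add_eq_zero_left h1
  obtain ⟨k, hk⟩ := hk
  have := h.gcong_of_res hν' (O4.mul_mem (I_pow_mem_O4 k) hμ') hk
  exact (hS.2.2 ν hν μ hμ 1 (by simp) (I ^ k) (I_pow_mem k) (by simpa using this)).1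

section

variable (h : Place p a b π V) (hS : IsQuarterSet π S) (hγV : γ ∈ V)
  (hγr : res V γ = res V (∏ ν ∈ S, ν))

include h hS hγV hγr

lemma Place.red_root_div :
    Red V ((γ⁻¹ * ∏ ν ∈ S, phi4 (ν / π)) / tF π 1 ^ S.card) 1 := by
  have D := h.data.divVal hS
  have hg0 : res V γ ≠ 0 := by
    rw [hγr, res_prod fun ν hν => h.mem_V (hS.1 ν hν).1]
    exact Finset.prod_ne_zero_iff.2 fun ν hν => h.res_gcoprime (hS.1 ν hν).1 (hS.1 ν hν).2
  have h1 : ∀ ν ∈ S, Red V (phi4 (ν / π) / tF π 1) (res V ν) := by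
    intro ν hν
    obtain ⟨h1, h2⟩ := hS.1 ν hν
    obtain ⟨r, hr⟩ := h.data.exists_int_cong h1
    rw [h.data.phi4_div_int h1 h2 hr, h.res_cong h1 (int_mem_O4 r) hr, res_intCast]
    exact h.red_div D r
  refine (((Red.of_mem hγV).inv hg0).mul (Red.prod h1)).congr ?_ ?_
  · rw [Finset.prod_div_distrib, Finset.prod_const, mul_div_assoc]
  · rw [hγr, res_prod fun ν hν => h.mem_V (hS.1 ν hν).1]
    rw [hγr, res_prod fun ν hν => h.mem_V (hS.1 ν hν).1] at hg0
    exact inv_mul_cancel₀ hg0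

lemma Place.red_conj_root (hγ : IsGamma4 π p S γ) {C : IsLocalRing.ResidueField V}
    (hC : Red V ((ee p 1 - 1) / tF π 1) C) (hC0 : C ≠ 0) :
    Red V ((starRingEnd ℂ) (γ⁻¹ * ∏ ν ∈ S, phi4 (ν / π)))
      (res V I ^ S.card * (-1) ^ (S.card * (S.card - 1) / 2) * 4 ^ S.card *
        (S.card.factorial : IsLocalRing.ResidueField V) * (2 * b * C) ^ (3 * S.card)) := by
  have hn := h.data.card_quarter hS
  have key : ∀ ν ∈ S, ∃ A : ℕ → IsLocalRing.ResidueField V,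
      RecSeq p (2 * b * res V ν * C) A ∧
        Red V ((starRingEnd ℂ) (phi4 (ν / π))) (res V I * -A 1) := by
    intro ν hν
    obtain ⟨h1, h2⟩ := hS.1 ν hν
    obtain ⟨r, hr⟩ := h.data.exists_int_cong h1
    have hr0 : ¬ (p : ℤ) ∣ r := h.data.gcoprime_int.1 (Data.gcoprime_congr hr h2)
    obtain ⟨A, hA, hA'⟩ := h.red_sF_conj hS hC hC0 hr0
    rw [h.data.phi4_div_int h1 h2 hr, h.res_cong h1 (int_mem_O4 r) hr, res_intCast, Data.conj_tF]
    exact ⟨A, hA, (Red.of_mem h.I_mem).mul hA'⟩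
  choose! A hA hA' using key
  have hY : ∀ ν ∈ S, ∀ μ ∈ S, (2 * b * res V ν * C) ^ 4 = (2 * b * res V μ * C) ^ 4 → ν = μ := by
    intro ν hν μ hμ he
    refine h.eq_of_pow_four hS hν hμ ?_
    have h0 : (2 * b * C) ^ 4 ≠ 0 :=
      pow_ne_zero _ (mul_ne_zero (mul_ne_zero h.two_ne_zero h.b_ne_zero) hC0)
    refine mul_left_cancel₀ h0 ?_
    linear_combination he
  have := h.charP
  have hP := RecSeq.prod h.data.prime hn hA hY
  have hg4 : res V γ ^ 4 = (-1) ^ (S.card + 1) := by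
    rw [← res_pow hγV, gamma_pow_four hn hγ]
    exact ((Red.one.neg).pow _).2
  refine ((Red.of_mem hγV).mul (Red.prod hA')).congr ?_ ?_
  · rw [map_mul, map_inv₀, conj_gamma hn hγ, inv_inv, map_prod]
  · have e1 : ∏ ν ∈ S, (2 * b * res V ν * C) ^ 3 = (2 * b * C) ^ (3 * S.card) * res V γ ^ 3 := by
      rw [hγr, res_prod fun ν hν => h.mem_V (hS.1 ν hν).1, ← Finset.prod_pow, pow_mul,
        ← Finset.prod_const, ← Finset.prod_mul_distrib]
      exact Finset.prod_congr rfl fun ν _ => by ring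
    have e2 : ∀ ν ∈ S, res V I * -A ν 1 = -res V I * A ν 1 := fun ν _ => by ring
    rw [Finset.prod_congr rfl e2, Finset.prod_mul_distrib, Finset.prod_const, hP, e1, neg_pow]
    have e3 : ((-1 : IsLocalRing.ResidueField V) ^ S.card) ^ 2 = 1 := by
      rw [← pow_mul, mul_comm, pow_mul]; norm_num
    rw [pow_succ] at hg4
    linear_combination (-1 : IsLocalRing.ResidueField V) ^ S.card * -(res V I ^ S.card *
      (-1) ^ (S.card * (S.card - 1) / 2) * 4 ^ S.card *
        (S.card.factorial : IsLocalRing.ResidueField V) * (2 * b * C) ^ (3 * S.card)) * hg4 +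
      (res V I ^ S.card *
      (-1) ^ (S.card * (S.card - 1) / 2) * 4 ^ S.card *
        (S.card.factorial : IsLocalRing.ResidueField V) * (2 * b * C) ^ (3 * S.card)) * e3

end

end

end

section

open Filter Topology

section

variable {p : ℕ} {a b : ℤ} {π : ℂ} {V : ValuationSubring ℂ} {χ : ℂ → ℂ} {n : ℕ}

lemma Data.chi_eq_zero (h : Data p a b π) (hχ : IsQuarticChar π p χ) {r : ℤ} (hr : (p : ℤ) ∣ r) :
    χ r = 0 :=
  hχ.resChar.vanish _ (int_mem_O4 r) fun hc => h.gcoprime_int.1 hc hr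

lemma Data.chi_congr (h : Data p a b π) (hχ : IsQuarticChar π p χ) {r s : ℤ}
    (hr : (p : ℤ) ∣ r - s) : χ r = χ s :=
  hχ.resChar.periodic _ (int_mem_O4 r) _ (int_mem_O4 s) (h.gcong_int.2 hr)

/-- The quartic residue character as a multiplicative character of `ZMod p`. -/
lemma Data.exists_mulChar [Fact p.Prime] (h : Data p a b π) (hχ : IsQuarticChar π p χ) :
    ∃ X : MulChar (ZMod p) ℂ, ∀ r : ℤ, X (r : ZMod p) = χ r := by
  have key : ∀ r : ℤ, χ (((r : ZMod p).val : ℤ) : ℂ) = χ r := by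
    intro r
    refine h.chi_congr hχ ?_
    rw [← ZMod.intCast_eq_intCast_iff_dvd_sub, Int.cast_natCast, ZMod.natCast_zmod_val]
  refine ⟨⟨⟨⟨fun x => χ ((x.val : ℤ) : ℂ), ?_⟩, ?_⟩, ?_⟩, key⟩
  · have := key 1
    simpa [hχ.resChar.map_one] using this
  · intro x y
    have := key ((x.val : ℤ) * y.val)
    simp only [Int.cast_mul, Int.cast_natCast, ZMod.natCast_zmod_val] at this ⊢
    rw [this, hχ.resChar.map_mul _ (nat_mem_O4 _) _ (nat_mem_O4 _)]
  · intro x hx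
    have hx0 : x = 0 := by
      by_contra h0
      exact hx (isUnit_iff_ne_zero.2 h0)
    subst hx0
    exact h.chi_eq_zero hχ (by simp)

lemma mem_O4_of_mem_adjoin {z : ℂ} (hz : z ∈ Algebra.adjoin ℤ {I}) : z ∈ O4 := by
  induction hz using Algebra.adjoin_induction with
  | mem x hx => rw [Set.mem_singleton_iff] at hx; rw [hx]; exact I_mem_O4
  | algebraMap r => exact int_mem_O4 r
  | add x y _ _ hx hy => exact O4.add_mem hx hy
  | mul x y _ _ hx hy => exact O4.mul_mem hx hy

lemma isPrimitiveRoot_I : IsPrimitiveRoot I 4 := by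
  rw [IsPrimitiveRoot.iff (by norm_num)]
  refine ⟨I_pow_four, fun l h1 h2 h3 => ?_⟩
  have h0 := I_pow_inj (k := l) (l := 0) h2 (by norm_num) (by rw [h3, pow_zero])
  omega

lemma Place.red_chi (h : Place p a b π V) (hχ : IsQuarticChar π p χ) (hn : p = 4 * n + 1)
    {x : ℂ} (hx : x ∈ O4) (hc : GCoprime x π) : Red V (χ x) (res V x ^ n) := by
  have e := hχ.euler _ hx hc
  rw [show (p - 1) / 4 = n by omega] at e
  obtain ⟨d, hd, e⟩ := e
  refine (((Red.of_mem (h.mem_V hx)).pow n).add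
    ((Red.of_mem h.pi_mem).mul (Red.of_mem (h.mem_V hd)))).congr ?_ ?_
  · rw [← e]; ring
  · rw [h.res_pi, zero_mul, add_zero]

variable [Fact p.Prime] {X : MulChar (ZMod p) ℂ}

lemma Data.mulChar_pow_four (h : Data p a b π) (hχ : IsQuarticChar π p χ)
    (hX : ∀ r : ℤ, X (r : ZMod p) = χ r) : X ^ 4 = 1 := by
  ext x
  have hv := hX (x : ZMod p).val
  rw [Int.cast_natCast, ZMod.natCast_zmod_val] at hv
  rw [MulChar.pow_apply_coe, hv, MulChar.one_apply_coe]
  refine hχ.quart _ (int_mem_O4 _) (h.gcoprime_int.2 fun hd => ?_)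
  have : ((x : ZMod p).val : ZMod p) = 0 := by
    have := (ZMod.intCast_zmod_eq_zero_iff_dvd ((x : ZMod p).val : ℤ) p).2 hd
    rwa [Int.cast_natCast] at this
  rw [ZMod.natCast_zmod_val] at this
  exact x.ne_zero this

lemma Place.red_mulChar (h : Place p a b π V) (hχ : IsQuarticChar π p χ) (hn : p = 4 * n + 1)
    (hX : ∀ r : ℤ, X (r : ZMod p) = χ r) [CharP (IsLocalRing.ResidueField V) p] (x : ZMod p) :
    Red V (X x) (ZMod.castHom dvd_rfl (IsLocalRing.ResidueField V) x ^ n) := by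
  have hn0 : n ≠ 0 := by have := h.data.prime.two_le; omega
  obtain ⟨r, rfl⟩ := ZMod.intCast_surjective x
  rw [hX, map_intCast]
  by_cases hr : (p : ℤ) ∣ r
  · rw [h.data.chi_eq_zero hχ hr, h.cast_int_eq_zero.2 hr, zero_pow hn0]
    exact Red.zero
  · rw [← res_intCast (V := V)]
    exact h.red_chi hχ hn (int_mem_O4 r) (h.data.gcoprime_int.2 hr)

lemma Place.mulChar_sq_ne_one (h : Place p a b π V) (hχ : IsQuarticChar π p χ)
    (hn : p = 4 * n + 1) (hX : ∀ r : ℤ, X (r : ZMod p) = χ r) : X ^ 2 ≠ 1 := by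
  have := h.charP
  have hn0 : n ≠ 0 := by have := h.data.prime.two_le; omega
  intro h1
  have h2 := FiniteField.sum_pow_lt_card_sub_one (K := ZMod p) (n * 2)
    (by rw [ZMod.card]; omega)
  have h3 := congrArg (ZMod.castHom dvd_rfl (IsLocalRing.ResidueField V)) h2
  rw [map_sum, map_zero] at h3
  have h4 : Red V (∑ x : ZMod p, (X ^ 2) x) (∑ x : ZMod p,
      ZMod.castHom dvd_rfl (IsLocalRing.ResidueField V) (x ^ (n * 2))) := by
    refine Red.sum fun x _ => ?_
    rw [MulChar.pow_apply' _ (by norm_num), map_pow, pow_mul]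
    exact (h.red_mulChar hχ hn hX x).pow 2
  rw [h3, h1, MulChar.sum_one_eq_card_units, ZMod.card_units_eq_totient,
    Nat.totient_prime h.data.prime] at h4
  have h5 := (Red.nat (V := V) (p - 1)).unique h4
  rw [h.cast_nat_eq_zero] at h5
  have := Nat.le_of_dvd (by omega) h5
  omega

lemma Place.res_jacobiSum (h : Place p a b π V) (hχ : IsQuarticChar π p χ)
    (hn : p = 4 * n + 1) (hX : ∀ r : ℤ, X (r : ZMod p) = χ r) : Red V (jacobiSum X X) 0 := by
  have := h.charP
  have hn0 : n ≠ 0 := by have := h.data.prime.two_le; omega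
  have h1 : ∑ x : ZMod p, x ^ n * (1 - x) ^ n = 0 := by
    have e : ∀ x : ZMod p, x ^ n * (1 - x) ^ n =
        ∑ k ∈ Finset.range (n + 1), (-1) ^ k * (n.choose k : ZMod p) * x ^ (n + k) := by
      intro x
      rw [sub_eq_neg_add, add_pow, Finset.mul_sum]
      refine Finset.sum_congr rfl fun k _ => ?_
      rw [one_pow, neg_pow, pow_add]
      ring
    simp_rw [e]
    rw [Finset.sum_comm]
    refine Finset.sum_eq_zero fun k hk => ?_
    rw [← Finset.mul_sum, FiniteField.sum_pow_lt_card_sub_one, mul_zero]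
    rw [ZMod.card]
    have := Finset.mem_range.1 hk
    omega
  have h3 := congrArg (ZMod.castHom dvd_rfl (IsLocalRing.ResidueField V)) h1
  rw [map_sum, map_zero] at h3
  rw [← h3]
  refine Red.sum fun x _ => ?_
  rw [map_mul, map_pow, map_pow]
  exact (h.red_mulChar hχ hn hX x).mul (h.red_mulChar hχ hn hX (1 - x))

lemma conj_jacobiSum : jacobiSum X⁻¹ X⁻¹ = (starRingEnd ℂ) (jacobiSum X X) := by
  simp only [jacobiSum, map_sum, map_mul]
  refine Finset.sum_congr rfl fun x _ => ?_
  rw [← MulChar.star_apply', ← MulChar.star_apply']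
  rfl

lemma Place.jacobiSum_sq (h : Place p a b π V) (hχ : IsQuarticChar π p χ)
    (hn : p = 4 * n + 1) (hX : ∀ r : ℤ, X (r : ZMod p) = χ r) : jacobiSum X X ^ 2 = π ^ 2 := by
  have h4 := h.data.mulChar_pow_four hχ hX
  have h2 := h.mulChar_sq_ne_one hχ hn hX
  have h1 : X ≠ 1 := fun h0 => h2 (by rw [h0, one_pow])
  obtain ⟨z, hz, hz'⟩ := exists_jacobiSum_eq_neg_one_add (by norm_num : 2 < 4) h4 h4
    (by rw [ZMod.card]; exact ⟨n, by omega⟩) isPrimitiveRoot_I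
  have hzO := mem_O4_of_mem_adjoin hz
  have hJ : jacobiSum X X ∈ O4 := by
    rw [hz']
    exact O4.add_mem (O4.neg_mem O4.one_mem) (O4.mul_mem hzO
      (O4.pow_mem (O4.sub_mem I_mem_O4 O4.one_mem) 2))
  obtain ⟨d, hd, e⟩ := h.gcong_of_res hJ O4.zero_mem
    (by rw [(h.res_jacobiSum hχ hn hX).2, res_zero])
  rw [sub_zero] at e
  have hn1 := jacobiSum_mul_jacobiSum_inv (by
    rw [ringChar.eq_zero, ZMod.ringChar_zmod_n]; exact h.data.prime.ne_zero.symm) h1 h1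
    (by rwa [← sq])
  rw [conj_jacobiSum, e, ZMod.card, map_mul] at hn1
  have hd1 : d * (starRingEnd ℂ) d = 1 := by
    refine mul_left_cancel₀ h.data.p_ne_zero ?_
    rw [mul_one]
    nth_rewrite 1 [← h.data.mul_conj]
    linear_combination hn1
  obtain ⟨k, l, rfl⟩ := mem_O4.1 hd
  obtain ⟨s, t, rfl⟩ := mem_O4.1 hzO
  have hkl : k ^ 2 + l ^ 2 = 1 := by
    have : ((k ^ 2 + l ^ 2 : ℤ) : ℂ) = (1 : ℤ) := by
      push_cast
      rw [← hd1]
      simp only [map_add, map_mul, map_intCast, conj_I]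
      linear_combination (l : ℂ) ^ 2 * I_sq
    exact_mod_cast this
  have e2 : ((a * k - b * l : ℤ) : ℂ) + ((a * l + b * k : ℤ) : ℂ) * I =
      ((2 * t - 1 : ℤ) : ℂ) + ((-2 * s : ℤ) : ℂ) * I := by
    have := e.symm.trans hz'
    rw [h.data.eq] at this
    push_cast
    linear_combination this + (-(b : ℂ) * l - 2 * t + t * I + s) * I_sq
  obtain ⟨e3, e4⟩ := add_mul_I_inj e2
  have hb := h.data.even
  have hl : l = 0 := by
    by_contra hl
    have hk : k = 0 := by
      by_contra hk
      have := sq_pos_of_ne_zero hk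
      have := sq_pos_of_ne_zero hl
      omega
    rw [hk] at e3
    obtain ⟨c, rfl⟩ := hb
    have : 2 * (c * l) + 2 * t = 1 := by linear_combination -e3
    omega
  rw [e, hl]
  rw [hl] at hkl
  have : (k : ℂ) ^ 2 = 1 := by
    have : k ^ 2 = 1 := by linear_combination hkl
    exact_mod_cast this
  push_cast
  linear_combination π ^ 2 * this

lemma G4sum_eq_gaussSum (hX : ∀ r : ℤ, X (r : ZMod p) = χ r) :
    G4sum p χ = gaussSum X ZMod.stdAddChar := by
  have hp : p.Prime := Fact.out
  have e2 : Finset.range p = insert 0 (Finset.Icc 1 (p - 1)) := by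
    have := hp.two_le
    ext r; simp only [Finset.mem_range, Finset.mem_insert, Finset.mem_Icc]; omega
  have h0 : gaussSum X ZMod.stdAddChar =
      ∑ r ∈ Finset.range p, X ((r : ℤ) : ZMod p) * ZMod.stdAddChar ((r : ℤ) : ZMod p) := by
    rw [gaussSum]
    refine Finset.sum_bij' (fun x _ => x.val) (fun r _ => (r : ZMod p)) ?_ ?_ ?_ ?_ ?_
    · intro x _; exact Finset.mem_range.2 (ZMod.val_lt x)
    · intro r _; exact Finset.mem_univ _
    · intro x _; simp
    · intro r hr; exact ZMod.val_cast_of_lt (Finset.mem_range.1 hr)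
    · intro x _; simp
  rw [h0, e2, Finset.sum_insert (by simp)]
  have : X (((0 : ℕ) : ℤ) : ZMod p) = 0 := by
    rw [Nat.cast_zero, Int.cast_zero, MulChar.map_zero]
  rw [this, zero_mul, zero_add, G4sum]
  refine Finset.sum_congr rfl fun r _ => ?_
  rw [hX, ZMod.stdAddChar_coe]
  simp

lemma Place.gaussSum_pow_four (h : Place p a b π V) (hχ : IsQuarticChar π p χ)
    (hn : p = 4 * n + 1) (hX : ∀ r : ℤ, X (r : ZMod p) = χ r) :
    gaussSum X ZMod.stdAddChar ^ 4 = π ^ 2 * p := by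
  have h4 := h.data.mulChar_pow_four hχ hX
  have h2 := h.mulChar_sq_ne_one hχ hn hX
  have e := jacobiSum_mul_nontrivial (χ := X) (φ := X) (by rwa [← sq]) ZMod.stdAddChar
  rw [← sq, ← sq] at e
  have hq : (X ^ 2).IsQuadratic := by
    intro x
    by_cases hx : IsUnit x
    · right
      have := congrArg (fun Y : MulChar (ZMod p) ℂ => Y x) h4
      simp only [MulChar.one_apply hx, MulChar.pow_apply' _ (by norm_num : 4 ≠ 0)] at this
      rw [MulChar.pow_apply' _ (by norm_num)]
      exact sq_eq_one_iff.1 (by rw [← pow_mul]; exact this)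
    · exact Or.inl (MulChar.map_nonunit _ hx)
  have e2 := gaussSum_sq h2 hq (ZMod.isPrimitive_stdAddChar p)
  have e3 : (X ^ 2) (-1) = 1 := by
    rw [MulChar.pow_apply' _ (by norm_num), ← map_pow]; simp
  rw [e3, ZMod.card, one_mul] at e2
  calc gaussSum X ZMod.stdAddChar ^ 4 = (gaussSum X ZMod.stdAddChar ^ 2) ^ 2 := by ring
    _ = gaussSum (X ^ 2) ZMod.stdAddChar ^ 2 * jacobiSum X X ^ 2 := by rw [← e]; ring
    _ = _ := by rw [e2, h.jacobiSum_sq hχ hn hX]; ring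

end

end

section

open Filter Topology

section

variable {V : ValuationSubring ℂ}

lemma exists_charP_residueField {q : ℕ} (hq : q.Prime) :
    ∃ V : ValuationSubring ℂ, CharP (IsLocalRing.ResidueField V) q := by
  obtain ⟨V, -, hr⟩ := exists_valuationSubring (Int.castRingHom ℂ).range
    ⟨((q : ℤ) : ℂ), (q : ℤ), rfl⟩ (by
      intro hu
      obtain ⟨⟨v, m, hm⟩, hv⟩ := hu.exists_right_inv
      have h1 := congrArg Subtype.val hv
      have h2 : ((q * m : ℤ) : ℂ) = (1 : ℤ) := by
        rw [Int.cast_mul, Int.cast_one]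
        have h2 : ((q : ℤ) : ℂ) * v = 1 := h1
        rw [← h2, ← hm]
        simp
      have h3 : (q : ℤ) ∣ 1 := ⟨m, by exact_mod_cast h2.symm⟩
      exact hq.one_lt.ne' (by exact_mod_cast Int.eq_one_of_dvd_one (by positivity) h3))
  refine ⟨V, ?_⟩
  have h0 : ((q : ℕ) : IsLocalRing.ResidueField V) = 0 := by
    rw [← res_natCast]
    exact hr
  exact (CharP.charP_iff_prime_eq_zero hq).2 h0

lemma eq_one_of_res {z : ℂ} (hz : z ^ 4 = 1) (h2 : (2 : IsLocalRing.ResidueField V) ≠ 0)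
    (h : Red V z 1) : z = 1 := by
  have hm : Red V (-1) (-1) := Red.one.neg
  have hne : (-1 : IsLocalRing.ResidueField V) ≠ 1 := fun h0 => h2 (by linear_combination -h0)
  rcases sq_eq_one_iff.1 (show (z ^ 2) ^ 2 = 1 by rw [← pow_mul]; exact hz) with h1 | h1
  · rcases sq_eq_one_iff.1 h1 with h1 | h1
    · exact h1
    · rw [h1] at h
      exact absurd (hm.unique h) hne
  · have h3 := h.pow 2
    rw [h1, one_pow] at h3
    exact absurd (hm.unique h3) hne

variable {p : ℕ} {a b : ℤ} {π : ℂ} [Fact p.Prime] {X : MulChar (ZMod p) ℂ}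

lemma mulChar_mem (x : ZMod p) : X x ∈ V := by
  have hp : p.Prime := Fact.out
  by_cases hx : x = 0
  · rw [hx, MulChar.map_zero]; exact V.zero_mem
  · refine mem_of_pow_mem (n := p - 1) (by have := hp.two_le; omega) ?_
    rw [← map_pow, ZMod.pow_card_sub_one_eq_one hx, map_one]
    exact V.one_mem

lemma addChar_mem (ψ : AddChar (ZMod p) ℂ) (x : ZMod p) : ψ x ∈ V := by
  have hp : p.Prime := Fact.out
  refine mem_of_pow_mem hp.ne_zero ?_
  rw [← AddChar.map_nsmul_eq_pow]
  simp

lemma gaussSum_mem (ψ : AddChar (ZMod p) ℂ) : gaussSum X ψ ∈ V :=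
  sum_mem_V fun x _ => V.mul_mem _ _ (mulChar_mem x) (addChar_mem ψ x)

lemma res_gaussSum_pow {q : ℕ} (hq : q.Prime) [CharP (IsLocalRing.ResidueField V) q]
    (ψ : AddChar (ZMod p) ℂ) :
    res V (gaussSum X ψ) ^ q = res V (gaussSum (X ^ q) (ψ ^ q)) := by
  have := Fact.mk hq
  rw [gaussSum, gaussSum,
    res_sum (fun x _ => V.mul_mem _ _ (mulChar_mem x) (addChar_mem ψ x)),
    res_sum (fun x _ => V.mul_mem _ _ (mulChar_mem x) (addChar_mem _ x)), sum_pow_char]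
  refine Finset.sum_congr rfl fun x _ => ?_
  rw [MulChar.pow_apply' _ hq.ne_zero, AddChar.pow_apply,
    ← res_pow (V.mul_mem _ _ (mulChar_mem x) (addChar_mem ψ x)), mul_pow]

lemma mulChar_apply_pow_four (h4 : X ^ 4 = 1) {x : ZMod p} (hx : x ≠ 0) : X x ^ 4 = 1 := by
  have := congrArg (fun Y : MulChar (ZMod p) ℂ => Y x) h4
  simpa only [MulChar.one_apply hx.isUnit, MulChar.pow_apply' _ (by norm_num : 4 ≠ 0)] using this

/-- Rational quartic reciprocity for the odd primes dividing `b`. -/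
lemma Data.mulChar_prime (h : Data p a b π) (h1 : X ≠ 1) (h4 : X ^ 4 = 1)
    (hg : gaussSum X ZMod.stdAddChar ^ 4 = π ^ 2 * p) {q : ℕ} (hq : q.Prime) (hq2 : q % 2 = 1)
    (hb : (q : ℤ) ∣ b) :
    (q % 4 = 1 → X q = 1) ∧ (q % 4 = 3 → X (-q) = 1) := by
  have hpb := h.not_dvd_b
  have hqp : ¬ p ∣ q := by
    intro hd
    rw [(Nat.prime_dvd_prime_iff_eq h.prime hq).1 hd] at hpb
    exact hpb hb
  have hqu : (q : ZMod p) ≠ 0 := by rwa [Ne, ZMod.natCast_eq_zero_iff]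
  have hqa : ¬ (q : ℤ) ∣ a := by
    intro ha
    have h0 : (q : ℤ) ∣ p := by
      rw [h.norm]
      exact dvd_add (ha.trans (dvd_pow_self _ two_ne_zero)) (hb.trans (dvd_pow_self _ two_ne_zero))
    exact hqp ((Nat.prime_dvd_prime_iff_eq hq h.prime).1 (by exact_mod_cast h0) ▸ dvd_rfl)
  obtain ⟨V, hV⟩ := exists_charP_residueField hq
  have := Fact.mk hq
  set K := IsLocalRing.ResidueField V
  have hb0 : (b : K) = 0 := (CharP.intCast_eq_zero_iff K q b).2 hb
  have ha0 : (a : K) ≠ 0 := fun h0 => hqa ((CharP.intCast_eq_zero_iff K q a).1 h0)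
  have h2 : (2 : K) ≠ 0 := by
    intro h0
    have := (CharP.cast_eq_zero_iff K q 2).1 (by exact_mod_cast h0)
    have := (Nat.prime_dvd_prime_iff_eq hq Nat.prime_two).1 this
    omega
  have hI : I ∈ V := mem_of_pow_mem (n := 4) (by norm_num) (by rw [I_pow_four]; exact V.one_mem)
  have hpa : (p : K) = (a : K) ^ 2 := by
    have := congrArg (fun z : ℤ => (z : K)) h.norm
    push_cast at this
    rw [this, hb0]; ring
  set g := res V (gaussSum X ZMod.stdAddChar) with hgd
  have hG : Red V (gaussSum X ZMod.stdAddChar) g := Red.of_mem (gaussSum_mem _)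
  have hg4 : g ^ 4 = (a : K) ^ 4 := by
    refine (hG.pow 4).unique ?_
    rw [hg, h.eq]
    refine (((((Red.int a).add ((Red.int b).mul (Red.of_mem hI))).pow 2)).mul (Red.nat p)).congr
      rfl ?_
    rw [hb0, hpa]; ring
  have hg0 : g ≠ 0 := by
    intro h0
    rw [h0] at hg4
    exact ha0 (pow_eq_zero_iff (n := 4) (by norm_num) |>.1 (by rw [← hg4]; norm_num))
  have hfer : (a : K) ^ q = a := by
    have := congrArg (ZMod.castHom dvd_rfl K) (ZMod.pow_card (p := q) (a : ZMod q))
    rwa [map_pow, map_intCast] at this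
  have hshift (Y : MulChar (ZMod p) ℂ) : Y q * gaussSum Y (ZMod.stdAddChar ^ q) =
      gaussSum Y ZMod.stdAddChar := by
    rw [AddChar.pow_mulShift]
    have := gaussSum_mulShift Y ZMod.stdAddChar (Units.mk0 _ hqu)
    rwa [Units.val_mk0] at this
  have hfrob := res_gaussSum_pow (V := V) (X := X) hq ZMod.stdAddChar
  constructor
  · intro hq4
    refine eq_one_of_res (V := V) (mulChar_apply_pow_four h4 hqu) h2
      (((Red.of_mem (mulChar_mem _))).congr rfl ?_)
    have hX : X ^ q = X := by
      rw [show q = 4 * (q / 4) + 1 by omega, pow_succ, pow_mul, h4, one_pow, one_mul]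
    rw [hX, ← hgd] at hfrob
    have e := ((Red.of_mem (V := V) (mulChar_mem (X := X) (q : ZMod p))).mul
      (Red.of_mem (gaussSum_mem (X := X) (ZMod.stdAddChar ^ q)))).unique
      (hG.congr (hshift X).symm rfl)
    rw [← hfrob] at e
    have e2 : g ^ q * g ^ 3 = g * g ^ 3 := by
      have h5 : g ^ q * g ^ 3 = (g ^ 4) ^ (q / 4 + 1) := by
        rw [← pow_add, ← pow_mul]; congr 1; omega
      have h6 : (a : K) ^ q * a ^ 3 = (a ^ 4) ^ (q / 4 + 1) := by
        rw [← pow_add, ← pow_mul]; congr 1; omega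
      rw [h5, hg4, ← h6, hfer]
      linear_combination -hg4
    rw [mul_right_cancel₀ (pow_ne_zero 3 hg0) e2] at e
    exact mul_right_cancel₀ hg0 (by rw [e, one_mul])
  · intro hq4
    have hnq : (-(q : ZMod p)) ≠ 0 := neg_ne_zero.2 hqu
    have hX : X ^ q = X⁻¹ := by
      rw [eq_inv_iff_mul_eq_one, ← pow_succ, show q + 1 = 4 * (q / 4 + 1) by omega, pow_mul, h4,
        one_pow]
    rw [hX, ← hgd] at hfrob
    have e := ((Red.of_mem (V := V) (mulChar_mem (X := X⁻¹) (q : ZMod p))).mul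
      (Red.of_mem (gaussSum_mem (X := X⁻¹) (ZMod.stdAddChar ^ q))))
    rw [hshift, ← hfrob] at e
    have e1 : gaussSum X ZMod.stdAddChar * gaussSum X⁻¹ ZMod.stdAddChar = X⁻¹ (-1) * p := by
      have h5 := gaussSum_mul_gaussSum_eq_card h1 (ZMod.isPrimitive_stdAddChar p)
      rw [ZMod.card] at h5
      rw [← mul_gaussSum_inv_eq_gaussSum X⁻¹ ZMod.stdAddChar, ← h5]
      ring
    have e2 := ((hG.mul e).congr e1 rfl).unique
      ((Red.of_mem (mulChar_mem (X := X⁻¹) (-1))).mul (Red.nat p))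
    have e3 : g * g ^ q = p := by
      have h5 : g * g ^ q = (g ^ 4) ^ (q / 4 + 1) := by
        rw [← pow_succ', ← pow_mul]; congr 1; omega
      have h6 : (a : K) * a ^ q = (a ^ 4) ^ (q / 4 + 1) := by
        rw [← pow_succ', ← pow_mul]; congr 1; omega
      rw [h5, hg4, ← h6, hfer, hpa]; ring
    have hp0 : (p : K) ≠ 0 := by rw [hpa]; exact pow_ne_zero 2 ha0
    have e4 : res V (X⁻¹ (q : ZMod p)) = res V (X⁻¹ (-1)) := by
      refine mul_right_cancel₀ hp0 ?_
      rw [← e2, ← e3]; ring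
    have hi4 : X⁻¹ ^ 4 = 1 := by rw [inv_pow, h4, inv_one]
    have e5 : X⁻¹ (-q : ZMod p) = 1 := by
      refine eq_one_of_res (V := V) (mulChar_apply_pow_four hi4 hnq) h2 ?_
      refine ((Red.of_mem (mulChar_mem (X := X⁻¹) (-1))).mul
        (Red.of_mem (mulChar_mem (X := X⁻¹) (q : ZMod p)))).congr ?_ ?_
      · rw [← map_mul, neg_one_mul]
      · rw [e4, ← res_mul (mulChar_mem _) (mulChar_mem _), ← map_mul, neg_one_mul, neg_neg,
          map_one, res_one]
    rw [MulChar.inv_apply_eq_inv'] at e5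
    exact inv_eq_one.1 e5

end

end

section

open Filter Topology

section

variable {p : ℕ} {a b : ℤ} {π : ℂ} {V : ValuationSubring ℂ} {χ : ℂ → ℂ} {n : ℕ}

lemma Place.pow_eq_jacobiSym (h : Place p a b π V) (hn : p = 4 * n + 1) (r : ℕ) :
    (r : IsLocalRing.ResidueField V) ^ (2 * n) = (jacobiSym r p : ℤ) := by
  have := Fact.mk h.data.prime
  have := h.charP
  have e := congrArg (ZMod.castHom dvd_rfl (IsLocalRing.ResidueField V)) (legendreSym.eq_pow p r)
  rw [show p / 2 = 2 * n by omega, map_pow, map_intCast, map_intCast, Int.cast_natCast] at e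
  rw [← e, jacobiSym.legendreSym.to_jacobiSym]

lemma natAbs_pow_two_mul {R : Type*} [CommRing R] (r : ℤ) (n : ℕ) :
    (r.natAbs : R) ^ (2 * n) = (r : R) ^ (2 * n) := by
  rw [pow_mul, pow_mul, ← Int.cast_natCast, ← Int.cast_pow, Int.natAbs_sq, Int.cast_pow]

lemma jacobiSym_natAbs_prime {p : ℕ} (hp : p.Prime) (hp4 : p % 4 = 1) {r : ℤ} (hr : r % 2 = 1)
    (h0 : ¬ (p : ℤ) ∣ r) :
    jacobiSym r.natAbs p = jacobiSym p r.natAbs ∧ jacobiSym p r.natAbs ≠ 0 := by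
  have ho : Odd r.natAbs := Nat.odd_iff.2 (by omega)
  have e := jacobiSym.quadratic_reciprocity_one_mod_four hp4 ho
  refine ⟨e.symm, jacobiSym.ne_zero ?_⟩
  rw [Int.gcd_natCast_natCast]
  exact (Nat.Prime.coprime_iff_not_dvd hp).2 fun hd => h0 (Int.natCast_dvd.2 hd)

lemma Place.a_pow (h : Place p a b π V) (hn : p = 4 * n + 1) :
    (a : IsLocalRing.ResidueField V) ^ (2 * n) = 1 := by
  have h0 : ¬ (p : ℤ) ∣ a := by
    rw [← h.cast_int_eq_zero, h.a_eq]
    exact mul_ne_zero (neg_ne_zero.2 h.b_ne_zero) h.res_I_ne_zero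
  obtain ⟨e1, e2⟩ := jacobiSym_natAbs_prime h.data.prime h.data.mod4 h.data.odd h0
  have e3 : jacobiSym p a.natAbs = jacobiSym b a.natAbs ^ 2 := by
    rw [← jacobiSym.pow_left, h.data.norm]
    refine jacobiSym.mod_left' (Int.ModEq.symm (Int.modEq_iff_dvd.2 ?_))
    have : ((a.natAbs : ℕ) : ℤ) ∣ a := Int.natAbs_dvd.2 dvd_rfl
    rw [add_sub_cancel_right]
    exact this.trans (dvd_pow_self _ (by norm_num))
  rw [← natAbs_pow_two_mul, h.pow_eq_jacobiSym hn, e1]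
  rw [e3] at e2 ⊢
  rcases jacobiSym.trichotomy b a.natAbs with h1 | h1 | h1 <;> rw [h1] at e2 ⊢ <;> simp at e2 ⊢

/-- The quartic character of `2`, due to Dirichlet. -/
lemma Place.two_pow (h : Place p a b π V) (hn : p = 4 * n + 1) :
    (2 * res V I) ^ n = if (a + b) % 8 = 1 then 1 else -1 := by
  have hI := h.res_I
  have hne : (1 : IsLocalRing.ResidueField V) - res V I ≠ 0 := by
    intro h0
    refine mul_ne_zero h.two_ne_zero h.res_I_ne_zero ?_
    linear_combination -(1 - res V I) * h0 + hI
  have hab : ((a + b : ℤ) : IsLocalRing.ResidueField V) = b * (1 - res V I) := by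
    push_cast
    rw [h.a_eq]; ring
  have h0 : ¬ (p : ℤ) ∣ a + b := by
    rw [← h.cast_int_eq_zero, hab]
    exact mul_ne_zero h.b_ne_zero hne
  have hodd : (a + b) % 2 = 1 := by have := h.data.primary; omega
  obtain ⟨e1, e2⟩ := jacobiSym_natAbs_prime h.data.prime h.data.mod4 hodd h0
  set c := (a + b).natAbs with hc
  have hco : Odd c := Nat.odd_iff.2 (by omega)
  have e3 : jacobiSym 2 c * jacobiSym p c = jacobiSym (a - b) c ^ 2 := by
    rw [← jacobiSym.pow_left, ← jacobiSym.mul_left, h.data.norm]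
    refine jacobiSym.mod_left' (Int.ModEq.symm (Int.modEq_iff_dvd.2 ?_))
    have : (c : ℤ) ∣ a + b := Int.natAbs_dvd.2 dvd_rfl
    rw [show 2 * (a ^ 2 + b ^ 2) - (a - b) ^ 2 = (a + b) ^ 2 by ring]
    exact this.trans (dvd_pow_self _ (by norm_num))
  have e4 : jacobiSym p c = jacobiSym 2 c := by
    have h2 : jacobiSym 2 c ≠ 0 := by
      refine jacobiSym.ne_zero ?_
      rw [show (2 : ℤ) = (2 : ℕ) by norm_num, Int.gcd_natCast_natCast]
      exact (Nat.coprime_two_left).2 hco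
    rcases jacobiSym.trichotomy (a - b) c with h1 | h1 | h1 <;>
    rcases jacobiSym.trichotomy 2 c with h3 | h3 | h3 <;>
    rcases jacobiSym.trichotomy p c with h5 | h5 | h5 <;>
    rw [h1, h3, h5] at e3 <;> simp_all
  have e5 : ((a + b : ℤ) : IsLocalRing.ResidueField V) ^ (2 * n) = (2 * res V I) ^ n := by
    have h1 := h.a_pow hn
    rw [h.a_eq, pow_mul] at h1
    rw [hab, pow_mul]
    have h2 : (b * (1 - res V I)) ^ 2 = (-b * res V I) ^ 2 * (2 * res V I) := by
      linear_combination (b : IsLocalRing.ResidueField V) ^ 2 * (1 - 2 * res V I) * hI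
    rw [h2, mul_pow, h1, one_mul]
  rw [← e5, ← natAbs_pow_two_mul, h.pow_eq_jacobiSym hn, e1, e4, jacobiSym.at_two hco,
    ZMod.χ₈_nat_eq_if_mod_eight]
  have := h.data.primary
  split_ifs <;> first | omega | simp

lemma Place.two_pow_sq (h : Place p a b π V) (hn : p = 4 * n + 1) :
    (2 : IsLocalRing.ResidueField V) ^ (2 * n) = (-1) ^ n := by
  have e : ((2 * res V I) ^ n) ^ 2 = 1 := by
    rw [h.two_pow hn]; split_ifs <;> simp
  rw [← pow_mul, mul_comm n 2, pow_mul, mul_pow, h.res_I, mul_neg_one, neg_pow, ← pow_mul] at e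
  have e2 : ((-1 : IsLocalRing.ResidueField V) ^ n) * (-1) ^ n = 1 := by
    rw [← mul_pow]; simp
  linear_combination (-1) ^ n * e - (2 : IsLocalRing.ResidueField V) ^ (2 * n) * e2

lemma Place.odd_dvd_pow (h : Place p a b π V) (hχ : IsQuarticChar π p χ) (hn : p = 4 * n + 1)
    {m : ℤ} (hm : m ∣ b) (hm4 : m % 4 = 1) : (m : IsLocalRing.ResidueField V) ^ n = 1 := by
  have := Fact.mk h.data.prime
  have := h.charP
  obtain ⟨X, hX⟩ := h.data.exists_mulChar hχ
  have h4 := h.data.mulChar_pow_four hχ hX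
  have h2 := h.mulChar_sq_ne_one hχ hn hX
  have h1 : X ≠ 1 := fun h0 => h2 (by rw [h0, one_pow])
  have key : ∀ k : ℕ, (k : ℤ) ∣ b → k % 2 = 1 →
      (k % 4 = 1 → X k = 1) ∧ (k % 4 = 3 → X (-k) = 1) := by
    intro k
    induction k using induction_on_primes with
    | zero => intro _ h0; omega
    | one => intro _ _; exact ⟨fun _ => by simp, fun h0 => by omega⟩
    | prime_mul q k hq ih =>
      intro hd ho
      have hqo : q % 2 = 1 := by
        rcases Nat.mod_two_eq_zero_or_one q with h0 | h0
        · rw [Nat.mul_mod, h0] at ho; simp at ho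
        · exact h0
      have hko : k % 2 = 1 := by
        rcases Nat.mod_two_eq_zero_or_one k with h0 | h0
        · rw [Nat.mul_mod, h0] at ho; simp at ho
        · exact h0
      rw [Nat.cast_mul] at hd
      obtain ⟨i1, i2⟩ := ih ((dvd_mul_left _ _).trans hd) hko
      obtain ⟨j1, j2⟩ := h.data.mulChar_prime h1 h4 (h.gaussSum_pow_four hχ hn hX) hq hqo
        ((dvd_mul_right _ _).trans hd)
      have hmod := Nat.mul_mod q k 4
      rw [Nat.cast_mul]
      rcases (show q % 4 = 1 ∨ q % 4 = 3 by omega) with hq4 | hq4 <;>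
      rcases (show k % 4 = 1 ∨ k % 4 = 3 by omega) with hk4 | hk4 <;>
      rw [hq4, hk4] at hmod <;> refine ⟨fun h0 => ?_, fun h0 => ?_⟩ <;> try omega
      · rw [map_mul, i1 hk4, j1 hq4, mul_one]
      · rw [← mul_neg, map_mul, i2 hk4, j1 hq4, mul_one]
      · rw [← neg_mul, map_mul, i1 hk4, j2 hq4, mul_one]
      · rw [← neg_mul_neg, map_mul, i2 hk4, j2 hq4, mul_one]
  have hXm : X (m : ZMod p) = 1 := by
    obtain ⟨k1, k2⟩ := key m.natAbs (Int.natAbs_dvd.2 hm) (by omega)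
    rcases le_or_gt 0 m with h0 | h0
    · have := k1 (by omega)
      rwa [← Int.cast_natCast, Int.natAbs_of_nonneg h0] at this
    · have := k2 (by omega)
      rwa [← Int.cast_natCast, Int.ofNat_natAbs_of_nonpos h0.le, Int.cast_neg, neg_neg] at this
  have := h.red_mulChar hχ hn hX m
  rw [hXm, map_intCast] at this
  exact (Red.one.unique this).symm

/-- The quartic character of `b` modulo `π = a + bi`. -/
lemma Place.b_pow (h : Place p a b π V) (hχ : IsQuarticChar π p χ) (hn : p = 4 * n + 1) :
    (b : IsLocalRing.ResidueField V) ^ n = if n % 2 = 0 then 1 else -res V I := by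
  have hI := h.res_I
  have hnorm := h.data.norm
  have hprim := h.data.primary
  have h2 := h.two_pow hn
  have h22 := h.two_pow_sq hn
  rw [mul_pow] at h2
  rcases Nat.even_or_odd' n with ⟨j, rfl | rfl⟩
  · rw [if_pos (by omega)]
    have hm1 : (-1 : IsLocalRing.ResidueField V) ^ (2 * j) = 1 := by rw [pow_mul]; simp
    have hodd {m : ℤ} (hm : m ∣ b) (hm2 : m % 2 = 1) :
        (m : IsLocalRing.ResidueField V) ^ (2 * j) = 1 := by
      rcases (show m % 4 = 1 ∨ (-m) % 4 = 1 by omega) with h4 | h4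
      · exact h.odd_dvd_pow hχ hn hm h4
      · have := h.odd_dvd_pow hχ hn ((neg_dvd).2 hm) h4
        rwa [Int.cast_neg, neg_pow, hm1, one_mul] at this
    rw [hm1] at h22
    obtain ⟨t, ht⟩ : ∃ t, a = 2 * t + 1 := ⟨a / 2, by have := h.data.odd; omega⟩
    obtain ⟨u, hu⟩ := h.data.even
    have e : 2 * (j : ℤ) = t * (t + 1) + u ^ 2 := by
      rw [hn, ht, hu] at hnorm
      push_cast at hnorm
      linarith
    have hu2 : u % 2 = 0 := by
      have h1 : (t * (t + 1)) % 2 = 0 := by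
        rcases Int.emod_two_eq_zero_or_one t with h0 | h0 <;> simp [Int.mul_emod, Int.add_emod, h0]
      rcases Int.emod_two_eq_zero_or_one u with h0 | h0
      · exact h0
      · have : u ^ 2 % 2 = 1 := by simp [pow_two, Int.mul_emod, h0]
        omega
    obtain ⟨w, rfl⟩ : ∃ w, u = 2 * w := ⟨u / 2, by omega⟩
    rcases Int.emod_two_eq_zero_or_one w with hw | hw
    · have htwo : (2 : IsLocalRing.ResidueField V) ^ (2 * j) = 1 := by
        obtain ⟨v, rfl⟩ : ∃ v, t = 2 * v := ⟨t / 2, by omega⟩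
        have e2 : (j : ℤ) = v + 2 * (v ^ 2 + w ^ 2) := by linarith
        rw [pow_mul (res V I), hI] at h2
        rcases Nat.even_or_odd j with hj | hj
        · rw [hj.neg_one_pow, mul_one, if_pos (by
            obtain ⟨k, rfl⟩ := hj
            push_cast at e2
            omega)] at h2
          exact h2
        · rw [hj.neg_one_pow, if_neg (by
            obtain ⟨k, rfl⟩ := hj
            push_cast at e2
            omega)] at h2
          linear_combination -h2
      have hb0 : b ≠ 0 := fun h0 => h.b_ne_zero (by rw [h0, Int.cast_zero])
      obtain ⟨s, m, hm, hs⟩ := Nat.exists_eq_two_pow_mul_odd (Int.natAbs_ne_zero.2 hb0)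
      have hmb : (m : ℤ) ∣ b := Int.natCast_dvd.2 (hs ▸ dvd_mul_left _ _)
      rw [← natAbs_pow_two_mul, hs, Nat.cast_mul, Nat.cast_pow, mul_pow, ← pow_mul, mul_comm s,
        pow_mul, Nat.cast_ofNat, htwo, one_pow, one_mul]
      have := hodd hmb (by have := Nat.odd_iff.1 hm; omega)
      rwa [Int.cast_natCast] at this
    · have := hodd (m := w) ⟨4, by rw [hu]; ring⟩ hw
      rw [hu, show 2 * (2 * w) = 2 ^ 2 * w by ring, Int.cast_mul, mul_pow, this, mul_one]
      push_cast
      rw [show (4 : IsLocalRing.ResidueField V) = 2 ^ 2 by norm_num, ← pow_mul, h22]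
  · rw [if_neg (by omega)]
    obtain ⟨t, ht⟩ : ∃ t, a = 2 * t + 1 := ⟨a / 2, by have := h.data.odd; omega⟩
    obtain ⟨u, hu⟩ := h.data.even
    have e : 2 * (j : ℤ) + 1 = t * (t + 1) + u ^ 2 := by
      rw [hn, ht, hu] at hnorm
      push_cast at hnorm
      linarith
    have hu2 : u % 2 = 1 := by
      have h1 : (t * (t + 1)) % 2 = 0 := by
        rcases Int.emod_two_eq_zero_or_one t with h0 | h0 <;> simp [Int.mul_emod, Int.add_emod, h0]
      rcases Int.emod_two_eq_zero_or_one u with h0 | h0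
      · have : u ^ 2 % 2 = 0 := by simp [pow_two, Int.mul_emod, h0]
        omega
      · exact h0
    have hmo : (-1 : IsLocalRing.ResidueField V) ^ (2 * j + 1) = -1 := by
      rw [pow_succ, pow_mul]; simp
    have hbu : (b : IsLocalRing.ResidueField V) ^ (2 * j + 1) =
        2 ^ (2 * j + 1) * (u : IsLocalRing.ResidueField V) ^ (2 * j + 1) := by
      rw [hu, Int.cast_mul, mul_pow, Int.cast_ofNat]
    have hupow : (u : IsLocalRing.ResidueField V) ^ (2 * j + 1) = if u % 4 = 1 then 1 else -1 := by
      split_ifs with h4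
      · exact h.odd_dvd_pow hχ hn ⟨2, by rw [hu]; ring⟩ h4
      · have := h.odd_dvd_pow hχ hn (m := -u) ⟨-2, by rw [hu]; ring⟩ (by omega)
        rw [Int.cast_neg, neg_pow, hmo] at this
        linear_combination -this
    obtain ⟨v, rfl⟩ : ∃ v, t = 2 * v + 1 := ⟨t / 2, by omega⟩
    obtain ⟨w, rfl⟩ : ∃ w, u = 2 * w + 1 := ⟨u / 2, by omega⟩
    have e2 : (j : ℤ) = v + 1 + 2 * (v ^ 2 + v + w ^ 2 + w) := by linarith
    rw [hbu, hupow]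
    rw [pow_succ (res V I), pow_mul (res V I), hI] at h2
    rcases Nat.even_or_odd j with hj | hj
    · rw [hj.neg_one_pow, one_mul] at h2
      obtain ⟨k, rfl⟩ := hj
      push_cast at e2
      rcases Int.emod_two_eq_zero_or_one w with hw | hw
      · rw [if_pos (by omega)] at h2 ⊢
        linear_combination (-res V I) * h2 + 2 ^ (2 * (k + k) + 1) * hI
      · rw [if_neg (by omega)] at h2 ⊢
        linear_combination res V I * h2 - 2 ^ (2 * (k + k) + 1) * hI
    · rw [hj.neg_one_pow] at h2
      obtain ⟨k, rfl⟩ := hj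
      push_cast at e2
      rcases Int.emod_two_eq_zero_or_one w with hw | hw
      · rw [if_neg (by omega)] at h2
        rw [if_pos (by omega)]
        linear_combination res V I * h2 + 2 ^ (2 * (2 * k + 1) + 1) * hI
      · rw [if_pos (by omega)] at h2
        rw [if_neg (by omega)]
        linear_combination -res V I * h2 - 2 ^ (2 * (2 * k + 1) + 1) * hI

end

end

section

open Filter Topology

section

variable {p : ℕ} {a b : ℤ} {π γ : ℂ} {V : ValuationSubring ℂ} {χ : ℂ → ℂ} {n : ℕ} {S : Finset ℂ}

lemma Place.const_eq (h : Place p a b π V) (hχ : IsQuarticChar π p χ) (hn : p = 4 * n + 1)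
    (C : IsLocalRing.ResidueField V) :
    (-2) ^ n * (res V I ^ n * (-1) ^ (n * (n - 1) / 2) * 4 ^ n * n.factorial *
      (2 * b * C) ^ (3 * n)) = (-1) ^ n * n.factorial * (C ^ n) ^ 3 := by
  have h1 : res V I ^ n * (-1) ^ (n * (n - 1) / 2) * (-1) ^ n *
      ((b : IsLocalRing.ResidueField V) ^ n) ^ 3 = 1 := by
    rw [h.b_pow hχ hn]
    have hI := h.res_I
    rcases Nat.even_or_odd' n with ⟨j, hj | hj⟩
    · rw [if_pos (by omega), show n * (n - 1) / 2 = j * (n - 1) by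
        rw [hj, mul_assoc]; exact Nat.mul_div_cancel_left _ (by norm_num), one_pow, mul_one]
      rcases Nat.eq_zero_or_pos j with h0 | h0
      · rw [hj, h0]; simp
      · have e : (res V I) ^ n = (-1) ^ j := by rw [hj, pow_mul, hI]
        rw [e, ← pow_add, ← pow_add, Even.neg_one_pow]
        refine ⟨j * j + j, ?_⟩
        obtain ⟨k, rfl⟩ : ∃ k, j = k + 1 := ⟨j - 1, by omega⟩
        rw [show n - 1 = 2 * k + 1 by omega, hj]
        ring
    · rw [if_neg (by omega), show n * (n - 1) / 2 = j * n by
        rw [hj, Nat.add_sub_cancel, mul_comm, mul_assoc]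
        exact Nat.mul_div_cancel_left _ (by norm_num)]
      have e : (res V I) ^ n = res V I * (-1) ^ j := by rw [hj, pow_succ, pow_mul, hI, mul_comm]
      have e2 : ((-1 : IsLocalRing.ResidueField V)) ^ j * (-1) ^ (j * n) * (-1) ^ n = -1 := by
        rw [← pow_add, ← pow_add, Odd.neg_one_pow]
        refine ⟨j * j + 2 * j, ?_⟩
        rw [hj]; ring
      rw [e]
      linear_combination (res V I * (-res V I) ^ 3) * e2 + (res V I ^ 2 - 1) * hI
  have h2 := h.two_pow_sq hn
  have h3 : (2 : IsLocalRing.ResidueField V) ^ (6 * n) = (-1) ^ n := by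
    rw [show 6 * n = 2 * n * 3 by ring, pow_mul, h2, ← pow_mul, mul_comm, pow_mul]
    norm_num
  have h4 : (4 : IsLocalRing.ResidueField V) ^ n = 2 ^ (2 * n) := by
    rw [pow_mul]; norm_num
  have h5 : (-2 : IsLocalRing.ResidueField V) ^ n = (-1) ^ n * 2 ^ n := by
    rw [← mul_pow]; norm_num
  have h6 : (2 * b * C : IsLocalRing.ResidueField V) ^ (3 * n) =
      2 ^ (3 * n) * (b ^ n) ^ 3 * (C ^ n) ^ 3 := by
    rw [mul_pow, mul_pow, ← pow_mul, ← pow_mul, mul_comm n 3]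
  have h7 : (2 : IsLocalRing.ResidueField V) ^ (6 * n) = 2 ^ n * 2 ^ (2 * n) * 2 ^ (3 * n) := by
    rw [← pow_add, ← pow_add]; congr 1; ring
  rw [h4, h5, h6]
  rw [h7] at h3
  linear_combination ((-1) ^ n * n.factorial * (C ^ n) ^ 3) * h1 +
    ((-1) ^ n * (res V I ^ n * (-1) ^ (n * (n - 1) / 2)) * n.factorial * (b ^ n) ^ 3 *
      (C ^ n) ^ 3) * h3

lemma Data.gcoprime_neg_two (h : Data p a b π) : GCoprime (-2) π := by
  have := h.gcoprime_int (r := -2)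
  rw [show (((-2 : ℤ)) : ℂ) = -2 by norm_num] at this
  rw [this, dvd_neg]
  intro h0
  have h1 := Int.le_of_dvd (by norm_num) h0
  have h2 := h.prime.two_le
  have h3 := h.mod4
  omega

lemma neg_two_mem_O4 : (-2 : ℂ) ∈ O4 := by
  have := int_mem_O4 (-2)
  rwa [show (((-2 : ℤ)) : ℂ) = -2 by norm_num] at this

lemma Data.chi_neg_two_sq (h : Data p a b π) (hχ : IsQuarticChar π p χ) :
    χ (-2) ^ 2 = χ (-1) := by
  have h1 : (-1 : ℂ) ∈ O4 := O4.neg_mem O4.one_mem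
  have h2 : (1 + I) ∈ O4 := O4.add_mem O4.one_mem I_mem_O4
  have h3 : (1 + I) * (1 + I) ∈ O4 := O4.mul_mem h2 h2
  have e : (-2 : ℂ) * (-2) = (-1) * (((1 + I) * (1 + I)) * ((1 + I) * (1 + I))) := by
    linear_combination (I ^ 2 + 4 * I + 5) * I_sq
  have hc : GCoprime (1 + I) π := by
    refine Data.gcoprime_of_mul (y := I - 1) (O4.sub_mem I_mem_O4 O4.one_mem) ?_
    rw [show (1 + I) * (I - 1) = -2 by linear_combination I_sq]
    exact h.gcoprime_neg_two
  rw [sq, ← hχ.resChar.map_mul _ neg_two_mem_O4 _ neg_two_mem_O4, e,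
    hχ.resChar.map_mul _ h1 _ (O4.mul_mem h3 h3), hχ.resChar.map_mul _ h3 _ h3,
    hχ.resChar.map_mul _ h2 _ h2]
  linear_combination χ (-1) * hχ.quart _ h2 hc

theorem Data.G4sum_eq (h : Data p a b π) (hχ : IsQuarticChar π p χ) (hS : IsQuarterSet π S)
    (hγ : IsGamma4 π p S γ) {W : ℂ} (hW : W = γ⁻¹ * ∏ ν ∈ S, phi4 (ν / π)) :
    G4sum p χ = χ (-2) * W ^ 3 * (starRingEnd ℂ) W ∧
      G4sum p χ ^ 4 = π ^ 3 * (starRingEnd ℂ) π := by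
  have := Fact.mk h.prime
  have hn := h.card_quarter hS
  obtain ⟨V, P, hγV, hγr⟩ := exists_place h (fun ν hν => (hS.1 ν hν).1) hγ
  obtain ⟨X, hX⟩ := h.exists_mulChar hχ
  have hW4 : W ^ 4 = -π := by rw [hW]; exact h.root_pow_four hS hγ
  have hG4 : G4sum p χ ^ 4 = π ^ 3 * (starRingEnd ℂ) π := by
    rw [G4sum_eq_gaussSum hX, P.gaussSum_pow_four hχ hn hX, ← h.mul_conj]; ring
  refine ⟨?_, hG4⟩
  have hχ4 := hχ.quart _ neg_two_mem_O4 h.gcoprime_neg_two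
  set R := χ (-2) * W ^ 3 * (starRingEnd ℂ) W with hR
  have hR4 : R ^ 4 = π ^ 3 * (starRingEnd ℂ) π := by
    have hc4 : (starRingEnd ℂ) W ^ 4 = -(starRingEnd ℂ) π := by rw [← map_pow, hW4, map_neg]
    calc R ^ 4 = χ (-2) ^ 4 * (W ^ 4) ^ 3 * (starRingEnd ℂ) W ^ 4 := by rw [hR]; ring
      _ = _ := by rw [hχ4, hW4, hc4]; ring
  have hR0 : R ≠ 0 := by
    intro h0
    rw [h0] at hR4
    exact mul_ne_zero (pow_ne_zero 3 h.ne_zero) h.conj_ne_zero (by rw [← hR4]; norm_num)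
  have D := h.divVal hS
  have ht := P.T_one_ne_zero D
  have hz := isPrimitiveRoot_ee h.prime.ne_zero
  have hz1 : ee p 1 - 1 ≠ 0 := sub_ne_zero.2 (hz.ne_one h.prime.one_lt)
  obtain ⟨C, hC, -, hC0⟩ := P.exists_ratio D hz
  have r1 := P.red_G4sum hχ hn hS
  have r2 : Red V (R / (ee p 1 - 1) ^ (3 * S.card)) ((-1) ^ S.card * S.card.factorial) := by
    have r3 := P.red_root_div hS hγV hγr
    have r4 := P.red_conj_root hS hγV hγr hγ hC hC0
    have r5 := P.red_chi hχ hn neg_two_mem_O4 h.gcoprime_neg_two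
    rw [← hW] at r3 r4
    refine (((r5.mul (r3.pow 3)).mul r4).div ((hC.pow S.card).pow 3)
      (pow_ne_zero 3 (pow_ne_zero _ hC0))).congr ?_ ?_
    · have e1 := pow_ne_zero S.card hz1
      have e2 := pow_ne_zero S.card ht
      rw [hR, div_pow (ee p 1 - 1), mul_comm 3 S.card, pow_mul (ee p 1 - 1)]
      generalize (ee p 1 - 1) ^ S.card = A at e1 ⊢
      generalize tF π 1 ^ S.card = B at e2 ⊢
      field_simp
    · rw [div_eq_iff (pow_ne_zero 3 (pow_ne_zero _ hC0)), ← P.const_eq hχ hn C,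
        show res V (-2) = -2 by
          have := res_intCast (V := V) (-2)
          rwa [show (((-2 : ℤ)) : ℂ) = -2 by norm_num,
            show (((-2 : ℤ)) : IsLocalRing.ResidueField V) = -2 by norm_num] at this]
      ring
  have hf : ((-1) ^ S.card * S.card.factorial : IsLocalRing.ResidueField V) ≠ 0 := by
    refine mul_ne_zero (pow_ne_zero _ (by simp)) ?_
    rw [Ne, P.cast_nat_eq_zero, h.prime.dvd_factorial]
    omega
  have r6 : Red V (G4sum p χ / R) 1 := by
    refine (r1.div r2 hf).congr ?_ (div_self hf)
    field_simp
  have := eq_one_of_res (by rw [div_pow, hG4, hR4]; exact div_self (hR4 ▸ pow_ne_zero 4 hR0))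
    P.two_ne_zero r6
  rwa [div_eq_one_iff_eq hR0] at this

lemma mul_conj_sq_of_pow_four {W : ℂ} (hW : W ^ 4 = -π) (hp : (p : ℂ) = π * (starRingEnd ℂ) π) :
    (W * (starRingEnd ℂ) W) ^ 2 = (Real.sqrt p : ℝ) := by
  have h1 : ‖W‖ ^ 4 = ‖π‖ := by rw [← norm_pow, hW, norm_neg]
  have h2 : (p : ℝ) = ‖π‖ ^ 2 := by
    rw [Complex.mul_conj, Complex.normSq_eq_norm_sq] at hp
    exact_mod_cast hp
  rw [h2, Real.sqrt_sq (norm_nonneg _), Complex.mul_conj, Complex.normSq_eq_norm_sq, ← h1]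
  push_cast
  ring

end

end

end QGS

/-- **Lemma II.9 (`G₄`-formula; Matthews).** Let `π ∈ ℤ[i]` be a primary prime with
`p = π·π̄`. Then the quartic Gauss sum satisfies `G₄(π) = χ_π(−2)·π̃³·π̃̄`, where `π̃̄`
is the complex conjugate of the canonical quartic root `π̃` of `−π`; in particular
`G₄(π)² = −χ_π(−1)·π·√p` and `G₄(π)⁴ = π³·π̄`. -/
theorem stmt_18
    (p : ℕ) (hp : p.Prime) (hp4 : p % 4 = 1)
    (π : ℂ) (hπ : π ∈ O4) (hprimary : GCong π 1 ((1 + Complex.I) ^ 3))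
    (hnorm : (p : ℂ) = π * (starRingEnd ℂ) π)
    (χ : ℂ → ℂ) (hχ : IsQuarticChar π p χ)
    (S : Finset ℂ) (hS : IsQuarterSet π S)
    (γ : ℂ) (hγ : IsGamma4 π p S γ)
    (πt : ℂ) (hπt : πt = γ⁻¹ * ∏ ν ∈ S, phi4 (ν / π)) :
    G4sum p χ = χ (-2) * πt ^ 3 * (starRingEnd ℂ) πt ∧
    (G4sum p χ) ^ 2 = -(χ (-1)) * π * ((Real.sqrt p : ℝ) : ℂ) ∧
    (G4sum p χ) ^ 4 = π ^ 3 * (starRingEnd ℂ) π := by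
  obtain ⟨a, b, h⟩ := QGS.exists_data hp hp4 hπ hprimary hnorm
  obtain ⟨h1, h4⟩ := h.G4sum_eq hχ hS hγ hπt
  have hW : πt ^ 4 = -π := by rw [hπt]; exact h.root_pow_four hS hγ
  refine ⟨h1, ?_, h4⟩
  rw [h1, ← QGS.mul_conj_sq_of_pow_four hW hnorm, ← h.chi_neg_two_sq hχ]
  linear_combination (χ (-2) * πt * (starRingEnd ℂ) πt) ^ 2 * hW

end
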